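/- Let k ≥ 2 and m ≥ 1 be integers. Suppose there is a fixed 0 < θ < 1 such that EH[θ] holds and such that M_k > 2m/θ. Then DHL[k,m+1] holds: for every admissible k-tuple (h_1,…,h_k) there are infinitely many n for which at least m+1 of n+h_1,…,n+h_k are prime. -/

import Mathlib

open MeasureTheory Filter

/-- A `k`-tuple of increasing integers is admissible if for every prime `p`
its entries do not occupy all residue classes modulo `p`. -/
def Admissible {k : ℕ} (h : Fin k → ℤ) : Prop :=
  StrictMono h ∧ ∀ p : ℕ, p.Prime → ∃ a : ZMod p, ∀ i, (h i : ZMod p) ≠ a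

/-- `DHL[k,j]`: for every admissible `k`-tuple `(h₁,…,h_k)` there are infinitely many
`n` for which at least `j` of `n + h₁, …, n + h_k` are prime. -/
def DHL (k j : ℕ) : Prop :=
  ∀ h : Fin k → ℤ, Admissible h →
    ∀ N : ℤ, ∃ n : ℤ, N < n ∧ j ≤ {i : Fin k | Prime (n + h i)}.ncard

/-- The discrepancy `Δ(f 1_{[x,2x]}; a (q))` of an arithmetic function `f` in the
residue class `a` modulo `q`. -/
noncomputable def disc (f : ℕ → ℝ) (x : ℝ) (q a : ℕ) : ℝ :=
  (∑ n ∈ Finset.Icc ⌈x⌉₊ ⌊2 * x⌋₊, if n % q = a % q then f n else 0) -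
    (1 / (Nat.totient q : ℝ)) *
      ∑ n ∈ Finset.Icc ⌈x⌉₊ ⌊2 * x⌋₊, if Nat.gcd n q = 1 then f n else 0

/-- The Elliott–Halberstam conjecture `EH[θ]`: for every `A ≥ 1` there is `C_A` with
`∑_{q ≤ x^θ} max_{a : gcd(a,q)=1} |Δ(Λ 1_{[x,2x]}; a (q))| ≤ C_A x (log x)^{-A}`
for all `x ≥ 2`. -/
def EH (θ : ℝ) : Prop :=
  ∀ A : ℝ, 1 ≤ A → ∃ C : ℝ, ∀ x : ℝ, 2 ≤ x →
    ∑ q ∈ Finset.Icc 1 ⌊x ^ θ⌋₊,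
        (⨆ a : {a : ℕ // a < q ∧ Nat.Coprime a q},
          |disc (fun n => ArithmeticFunction.vonMangoldt n) x q a|)
      ≤ C * x * Real.log x ^ (-A)

/-- The simplex `R_k = {t ∈ [0,∞)^k : t₁ + ⋯ + t_k ≤ 1}`. -/
def simplex (k : ℕ) : Set (Fin k → ℝ) :=
  {t | (∀ i, 0 ≤ t i) ∧ ∑ i, t i ≤ 1}

/-- `I(F) = ∫_{[0,∞)^k} F(t)² dt`. -/
noncomputable def sieveI {k : ℕ} (F : (Fin k → ℝ) → ℝ) : ℝ :=
  ∫ t in {t : Fin k → ℝ | ∀ i, 0 ≤ t i}, (F t) ^ 2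

/-- `J_i(F) = ∫_{[0,∞)^{k-1}} (∫_0^∞ F(t) dt_i)² dt_1 ⋯ dt_{i-1} dt_{i+1} ⋯ dt_k`. -/
noncomputable def sieveJ {k : ℕ} (i : Fin k) (F : (Fin k → ℝ) → ℝ) : ℝ :=
  ∫ y in {y : {j : Fin k // j ≠ i} → ℝ | ∀ j, 0 ≤ y j},
    (∫ s in Set.Ioi (0 : ℝ), F (fun j => if h : j = i then s else y ⟨j, h⟩)) ^ 2

/-- `M_k`, the supremum of `(∑ᵢ J_i(F))/I(F)` over square-integrable `F` supported on
the simplex `R_k` that are not almost everywhere zero. -/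
noncomputable def Mquant (k : ℕ) : ℝ :=
  sSup {r : ℝ | ∃ F : (Fin k → ℝ) → ℝ, MemLp F 2 volume ∧
    (∀ t, t ∉ simplex k → F t = 0) ∧ ¬ (F =ᵐ[volume] 0) ∧
    r = (∑ i, sieveJ i F) / sieveI F}

section
namespace MT
open Finset

local notation "Λ" => ArithmeticFunction.vonMangoldt

lemma log_factorial_eq (N : ℕ) :
    Real.log (N.factorial : ℝ) = ∑ n ∈ Ioc 0 N, Λ n * ((N / n : ℕ) : ℝ) := by
  have h := ArithmeticFunction.sum_Ioc_mul_zeta_eq_sum Λ N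
  rw [← h, ArithmeticFunction.vonMangoldt_mul_zeta]
  simp only [ArithmeticFunction.log_apply]
  induction N with
  | zero => simp
  | succ n ih =>
    rw [← Finset.insert_Ioc_right_eq_Ioc_add_one (by omega), Finset.sum_insert (by simp), ← ih,
      Nat.factorial_succ]
    · push_cast
      rw [Real.log_mul (by positivity) (by positivity)]
    · exact ArithmeticFunction.sum_Ioc_mul_zeta_eq_sum Λ n

lemma mertens_lower (N : ℕ) (hN : 1 ≤ N) :
    Real.log N - 1 ≤ ∑ n ∈ Ioc 0 N, Λ n / n := by
  have h1 := Stirling.le_log_factorial_stirling (n := N) (by omega)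
  have hN' : (1:ℝ) ≤ N := by exact_mod_cast hN
  have h2 : Real.log (N.factorial : ℝ) ≤ N * ∑ n ∈ Ioc 0 N, Λ n / n := by
    rw [log_factorial_eq, mul_sum]
    refine sum_le_sum fun n hn => ?_
    have : ((N / n : ℕ) : ℝ) ≤ N / n := Nat.cast_div_le
    calc Λ n * ((N / n : ℕ) : ℝ) ≤ Λ n * (N / n) := by
          gcongr
      _ = N * (Λ n / n) := by ring
  have h3 : 0 ≤ Real.log N := Real.log_nonneg hN'
  have h4 : 0 ≤ Real.log (2 * Real.pi) := Real.log_nonneg (by linarith [Real.pi_gt_three])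
  have : (N:ℝ) * (Real.log N - 1) ≤ N * ∑ n ∈ Ioc 0 N, Λ n / n := by linarith
  exact le_of_mul_le_mul_left this (by linarith)

lemma mertens_upper (N : ℕ) (hN : 1 ≤ N) :
    ∑ n ∈ Ioc 0 N, Λ n / n ≤ Real.log N + (Real.log 4 + 4) := by
  have hN' : (1:ℝ) ≤ N := by exact_mod_cast hN
  have hps := Chebyshev.psi_le_const_mul_self (x := N) (by linarith)
  have hpsi : Chebyshev.psi N = ∑ n ∈ Ioc 0 N, Λ n := by
    simp [Chebyshev.psi]
  have h2 : N * ∑ n ∈ Ioc 0 N, Λ n / n ≤ Real.log (N.factorial : ℝ) + Chebyshev.psi N := by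
    rw [log_factorial_eq, mul_sum, hpsi, ← sum_add_distrib]
    refine sum_le_sum fun n hn => ?_
    have : (N / n : ℝ) ≤ ((N / n : ℕ) : ℝ) + 1 := by
      have := Nat.lt_floor_add_one ((N:ℝ) / n)
      rw [Nat.floor_div_eq_div] at this
      exact this.le
    calc N * (Λ n / n) = Λ n * (N / n) := by ring
      _ ≤ Λ n * (((N / n : ℕ) : ℝ) + 1) := by
          gcongr
      _ = _ := by ring
  have h5 : Real.log (N.factorial : ℝ) ≤ N * Real.log N := by
    rw [← Real.log_pow]
    apply Real.log_le_log (by positivity)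
    exact_mod_cast Nat.factorial_le_pow N
  have : (N:ℝ) * ∑ n ∈ Ioc 0 N, Λ n / n ≤ N * (Real.log N + (Real.log 4 + 4)) := by linarith
  exact le_of_mul_le_mul_left this (by linarith)

lemma loglog_step (N : ℕ) (hN : 2 ≤ N) :
    Real.log N * (1 / Real.log N - 1 / Real.log (N+1 : ℕ)) ≤
      Real.log (Real.log (N+1 : ℕ)) - Real.log (Real.log N) := by
  have h1 : 0 < Real.log N := Real.log_pos (by exact_mod_cast hN)
  have h2 : 0 < Real.log (N+1 : ℕ) := Real.log_pos (by exact_mod_cast (by omega : 1 < N+1))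
  rw [← Real.log_div h2.ne' h1.ne']
  have := Real.one_sub_inv_le_log_of_pos (x := Real.log (N+1 : ℕ) / Real.log N) (by positivity)
  rw [inv_div] at this
  refine le_trans (le_of_eq ?_) this
  field_simp

lemma mertens_two_aux (N : ℕ) (hN : 2 ≤ N) :
    ∑ n ∈ Ioc 0 N, Λ n / n / Real.log n - (∑ n ∈ Ioc 0 N, Λ n / n) / Real.log N ≤
      Real.log (Real.log N) - Real.log (Real.log 2) +
        (Real.log 4 + 4) * (1 / Real.log 2 - 1 / Real.log N) := by
  induction N, hN using Nat.le_induction with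
  | base =>
    have : Ioc 0 2 = ({1, 2} : Finset ℕ) := by decide
    rw [this]
    simp
  | succ N hN ih =>
    rw [← Finset.insert_Ioc_right_eq_Ioc_add_one (by omega), Finset.sum_insert (by simp),
      Finset.sum_insert (by simp)]
    have h0 := loglog_step N hN
    have h1 : 0 < Real.log N := Real.log_pos (by exact_mod_cast hN)
    have h2 : 0 < Real.log (N+1 : ℕ) := Real.log_pos (by exact_mod_cast (by omega : 1 < N+1))
    have h12 : Real.log N ≤ Real.log (N+1 : ℕ) := by
      apply Real.log_le_log (by positivity); push_cast; linarith
    have h3 := mertens_upper N (by omega)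
    have h4 : 0 ≤ 1 / Real.log N - 1 / Real.log (N+1 : ℕ) := by
      rw [sub_nonneg]; exact one_div_le_one_div_of_le h1 h12
    have h5 := mul_le_mul_of_nonneg_right h3 h4
    set S := ∑ n ∈ Ioc 0 N, Λ n / n
    have e1 : (Λ (N+1) / ((N+1 : ℕ) : ℝ) + S) / Real.log (N+1 : ℕ) =
      Λ (N+1) / ((N+1 : ℕ) : ℝ) / Real.log (N+1 : ℕ) + S / Real.log N
        - S * (1 / Real.log N - 1 / Real.log (N+1 : ℕ)) := by
      field_simp; ring
    rw [e1]
    nlinarith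

lemma mertens_two : ∃ C : ℝ, ∀ N : ℕ, 2 ≤ N →
    ∑ p ∈ Nat.primesLE N, (1 / (p:ℝ)) ≤ Real.log (Real.log N) + C := by
  refine ⟨1 + (Real.log 4 + 4) / Real.log 2 - Real.log (Real.log 2) +
        (Real.log 4 + 4) * (1 / Real.log 2), fun N hN => ?_⟩
  have h1 : 0 < Real.log N := Real.log_pos (by exact_mod_cast hN)
  have l2 : 0 < Real.log 2 := Real.log_pos (by norm_num)
  have l4 : 0 < Real.log 4 := Real.log_pos (by norm_num)
  have h12 : Real.log 2 ≤ Real.log N := by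
    apply Real.log_le_log (by positivity); exact_mod_cast hN
  have h0 := mertens_two_aux N hN
  have h3 : (∑ n ∈ Ioc 0 N, Λ n / n) / Real.log N ≤ 1 + (Real.log 4 + 4) / Real.log 2 := by
    calc _ ≤ (Real.log N + (Real.log 4 + 4)) / Real.log N := by
            gcongr; exact mertens_upper N (by omega)
      _ = 1 + (Real.log 4 + 4) / Real.log N := by field_simp
      _ ≤ _ := by gcongr
  have h4 : ∑ p ∈ Nat.primesLE N, (1 / (p:ℝ)) ≤ ∑ n ∈ Ioc 0 N, Λ n / n / Real.log n := by
    have hsub : Nat.primesLE N ⊆ Ioc 0 N := by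
      intro p hp
      rw [Nat.mem_primesLE] at hp
      simp [hp.1, hp.2.pos]
    refine le_trans (le_of_eq ?_) (sum_le_sum_of_subset_of_nonneg hsub ?_)
    · refine sum_congr rfl fun p hp => ?_
      rw [Nat.mem_primesLE] at hp
      rw [ArithmeticFunction.vonMangoldt_apply_prime hp.2]
      have : 0 < Real.log p := Real.log_pos (by exact_mod_cast hp.2.one_lt)
      field_simp
    · intro n hn _
      rw [mem_Ioc] at hn
      have : 0 ≤ Real.log n := Real.log_nonneg (by exact_mod_cast hn.1)
      have := ArithmeticFunction.vonMangoldt_nonneg (n := n)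
      positivity
  have h6 : 0 ≤ (Real.log 4 + 4) * (1 / Real.log N) := by positivity
  linarith

lemma sum_inv_mul_pred_le (D N : ℕ) (hD : 1 ≤ D) :
    ∑ n ∈ Ioc D N, 1 / (((n:ℝ) - 1) * n) ≤ 1 / D := by
  have key : ∀ N, D ≤ N → ∑ n ∈ Ioc D N, 1 / (((n:ℝ) - 1) * n) = 1 / D - 1 / N := by
    intro N hN
    induction N, hN using Nat.le_induction with
    | base => simp
    | succ N hN ih =>
      rw [← Finset.insert_Ioc_right_eq_Ioc_add_one (by omega), Finset.sum_insert (by simp), ih]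
      have : (0:ℝ) < N := by exact_mod_cast (by omega)
      have : (0:ℝ) < D := by exact_mod_cast (by omega)
      push_cast
      rw [add_sub_cancel_right]
      field_simp
      ring
  rcases le_total D N with h | h
  · rw [key N h]; linarith [show (0:ℝ) ≤ 1 / N by positivity]
  · rw [Ioc_eq_empty (by omega)]; simp

/-- Upper bound in Mertens' third theorem. -/
lemma mertens_three : ∃ C : ℝ, 0 < C ∧ ∀ N : ℕ, 2 ≤ N →
    ∏ p ∈ Nat.primesLE N, (1 + 1 / ((p:ℝ) - 1)) ≤ C * Real.log N := by
  obtain ⟨C, hC⟩ := mertens_two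
  refine ⟨Real.exp (C + 1), Real.exp_pos _, fun N hN => ?_⟩
  have h1 : 0 < Real.log N := Real.log_pos (by exact_mod_cast hN)
  calc ∏ p ∈ Nat.primesLE N, (1 + 1 / ((p:ℝ) - 1))
      ≤ ∏ p ∈ Nat.primesLE N, Real.exp (1 / ((p:ℝ) - 1)) := by
        refine prod_le_prod (fun p hp => ?_) (fun p hp => ?_)
        · rw [Nat.mem_primesLE] at hp
          have : (2:ℝ) ≤ p := by exact_mod_cast hp.2.two_le
          have : 0 ≤ (p:ℝ) - 1 := by linarith
          positivity
        · rw [add_comm]; exact Real.add_one_le_exp _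
    _ = Real.exp (∑ p ∈ Nat.primesLE N, 1 / ((p:ℝ) - 1)) := by rw [Real.exp_sum]
    _ ≤ Real.exp (Real.log (Real.log N) + (C + 1)) := by
        apply Real.exp_le_exp.mpr
        have : ∀ p ∈ Nat.primesLE N, 1 / ((p:ℝ) - 1) = 1 / p + 1 / (((p:ℝ) - 1) * p) := by
          intro p hp
          rw [Nat.mem_primesLE] at hp
          have : (2:ℝ) ≤ p := by exact_mod_cast hp.2.two_le
          have : (p:ℝ) - 1 ≠ 0 := by linarith
          field_simp; ring
        rw [sum_congr rfl this, sum_add_distrib]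
        have h2 := hC N hN
        have h3 : ∑ p ∈ Nat.primesLE N, 1 / (((p:ℝ) - 1) * p) ≤ 1 := by
          have := sum_inv_mul_pred_le 1 N le_rfl
          refine le_trans (sum_le_sum_of_subset_of_nonneg ?_ ?_) (this.trans (by simp))
          · intro p hp
            rw [Nat.mem_primesLE] at hp
            simp [hp.1, hp.2.one_lt]
          · intro p hp _
            rw [mem_Ioc] at hp
            have : (2:ℝ) ≤ p := by exact_mod_cast hp.1
            have : 0 ≤ (p:ℝ) - 1 := by linarith
            positivity
        linarith
    _ = _ := by rw [Real.exp_add, Real.exp_log h1, mul_comm]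

/-- Prime mass: infinitely many dyadic intervals carry at least the expected mass. -/
lemma prime_mass (ε : ℝ) (hε : 0 < ε) (X : ℕ) : ∃ x : ℕ, X ≤ x ∧
    (1 - ε) * x ≤ ∑ n ∈ Icc x (2 * x), Λ n := by
  by_contra! hcon
  set X₀ := X + 1 with hX₀
  have hlt : ∀ x : ℕ, X₀ ≤ x → ∑ n ∈ Icc x (2 * x), Λ n ≤ (1 - ε) * x := fun x hx =>
    (hcon x (by omega)).le
  have hε1 : ε ≤ 1 := by
    by_contra! h
    have h1 := hlt X₀ le_rfl
    have h2 : 0 ≤ ∑ n ∈ Icc X₀ (2 * X₀), Λ n :=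
      sum_nonneg fun _ _ => ArithmeticFunction.vonMangoldt_nonneg
    have : (0:ℝ) < X₀ := by exact_mod_cast (by omega)
    nlinarith
  -- lower bound for the tail sums of 1/x^2
  have htail : ∀ n : ℕ, 1 ≤ n → (1:ℝ) / (n + 1) ≤ ∑ x ∈ Icc ((n + 1) / 2) n, 1 / (x:ℝ)^2 := by
    intro n hn
    have key : ∀ a b : ℕ, 1 ≤ a → a ≤ b →
        (1:ℝ) / a - 1 / (b + 1) ≤ ∑ x ∈ Icc a b, 1 / (x:ℝ)^2 := by
      intro a b ha hab
      have ha' : (0:ℝ) < a := by exact_mod_cast ha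
      induction b, hab using Nat.le_induction with
      | base =>
        simp only [Icc_self, sum_singleton]
        rw [div_sub_div _ _ (by positivity) (by positivity), div_le_div_iff₀ (by positivity) (by positivity)]
        nlinarith
      | succ b hab ih =>
        rw [← Finset.insert_Icc_right_eq_Icc_add_one (by omega), Finset.sum_insert (by simp)]
        have : (1:ℝ) / (b + 1) - 1 / ((b + 1 : ℕ) + 1) ≤ 1 / ((b + 1 : ℕ) : ℝ)^2 := by
          push_cast
          rw [div_sub_div _ _ (by positivity) (by positivity), div_le_div_iff₀ (by positivity) (by positivity)]
          ring_nf
          have : (0:ℝ) ≤ b := by positivity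
          nlinarith
        push_cast at *
        linarith
    have h1 := key ((n+1)/2) n (by omega) (by omega)
    have h2 : (((n + 1) / 2 : ℕ) : ℝ) ≤ (n + 1) / 2 := by
      have := @Nat.cast_div_le ℝ _ _ _ (n+1) 2
      push_cast at this; exact this
    have h3 : (0:ℝ) < ((n + 1) / 2 : ℕ) := by exact_mod_cast (by omega)
    have h4 : (1:ℝ) / ((n + 1) / 2) ≤ 1 / (((n + 1) / 2 : ℕ) : ℝ) := one_div_le_one_div_of_le h3 h2
    have h5 : (1:ℝ) / ((n + 1) / 2) = 2 * (1 / (n + 1)) := by field_simp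
    linarith
  -- compare
  have hmain : ∀ N : ℕ, 2 * X₀ ≤ N →
      ∑ n ∈ Icc (2 * X₀) N, Λ n / (n + 1) ≤ (1 - ε) * (1 + Real.log N) := by
    intro N hN
    calc ∑ n ∈ Icc (2 * X₀) N, Λ n / (n + 1)
        ≤ ∑ n ∈ Icc (2 * X₀) N, ∑ x ∈ Icc ((n + 1) / 2) n, Λ n * (1 / (x:ℝ)^2) := by
          refine sum_le_sum fun n hn => ?_
          rw [mem_Icc] at hn
          rw [← mul_sum, div_eq_mul_one_div]
          gcongr
          exact htail n (by omega)
      _ ≤ ∑ x ∈ Icc X₀ N, ∑ n ∈ Icc x (2 * x), Λ n * (1 / (x:ℝ)^2) := by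
          rw [sum_sigma', sum_sigma']
          refine le_trans (le_of_eq ?_) (sum_le_sum_of_subset_of_nonneg (s := ((Icc (2 * X₀) N).sigma
            fun n => Icc ((n + 1) / 2) n).map ⟨fun a => ⟨a.2, a.1⟩, ?_⟩) ?_ ?_)
          · rw [sum_map]; rfl
          · rintro ⟨a, b⟩ ⟨c, d⟩ h; simp at h; simp [h]
          · rintro ⟨x, n⟩ h
            simp only [Finset.mem_map, mem_sigma, mem_Icc, Function.Embedding.coeFn_mk, Sigma.exists] at h ⊢
            obtain ⟨a, b, h, h2⟩ := h
            injection h2 with h3 h4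
            simp only at h3 h4
            subst h3; subst h4
            omega
          · intro i _ _
            have := ArithmeticFunction.vonMangoldt_nonneg (n := i.2)
            positivity
      _ ≤ ∑ x ∈ Icc X₀ N, (1 - ε) * (1 / (x:ℝ)) := by
          refine sum_le_sum fun x hx => ?_
          rw [mem_Icc] at hx
          rw [← sum_mul]
          have hx0 : (0:ℝ) < x := by exact_mod_cast (by omega)
          calc _ ≤ (1 - ε) * x * (1 / (x:ℝ)^2) := by
                gcongr; exact hlt x hx.1
            _ = _ := by field_simp
      _ ≤ (1 - ε) * ∑ x ∈ Icc 1 N, (1 / (x:ℝ)) := by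
          rw [← mul_sum]
          gcongr
          omega
      _ ≤ _ := by
          gcongr
          have := harmonic_le_one_add_log N
          rw [harmonic_eq_sum_Icc] at this
          simpa using this
  -- contradiction
  obtain ⟨C, hC⟩ : ∃ C : ℝ, ∀ N : ℕ, 2 * X₀ ≤ N →
      Real.log N - C ≤ ∑ n ∈ Icc (2 * X₀) N, Λ n / (n + 1) := by
    refine ⟨1 + ∑ n ∈ Ioc 0 (2 * X₀), Λ n / n + (2 * (Real.log 4 + 4) + 1 + 100), fun N hN => ?_⟩
    have h1 := mertens_lower N (by omega)
    have h2 : ∑ n ∈ Ioc 0 N, Λ n / n ≤ ∑ n ∈ Ioc 0 (2 * X₀), Λ n / n +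
        ∑ n ∈ Icc (2 * X₀) N, Λ n / n := by
      rw [← sum_union_inter]
      refine le_add_of_le_of_nonneg (sum_le_sum_of_subset_of_nonneg ?_ ?_) ?_
      · intro n hn; simp at hn ⊢; omega
      · intro n _ _
        have := ArithmeticFunction.vonMangoldt_nonneg (n := n)
        positivity
      · refine sum_nonneg fun n _ => ?_
        have := ArithmeticFunction.vonMangoldt_nonneg (n := n)
        positivity
    have h3 : ∑ n ∈ Icc (2 * X₀) N, Λ n / n ≤ ∑ n ∈ Icc (2 * X₀) N, Λ n / (n + 1) +
        ∑ n ∈ Icc (2 * X₀) N, Λ n / (n * (n + 1)) := by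
      rw [← sum_add_distrib]
      refine sum_le_sum fun n hn => le_of_eq ?_
      rw [mem_Icc] at hn
      have : (0:ℝ) < n := by exact_mod_cast (by omega)
      field_simp
    have h4 : ∑ n ∈ Icc (2 * X₀) N, Λ n / ((n:ℝ) * (n + 1)) ≤ 4 := by
      have h5 : ∀ n ∈ Icc (2 * X₀) N, Λ n / ((n:ℝ) * (n + 1)) ≤
          4 * (1 / Real.sqrt n - 1 / Real.sqrt (n + 1 : ℕ)) := by
        intro n hn
        rw [mem_Icc] at hn
        have hn0 : (0:ℝ) < n := by exact_mod_cast (by omega)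
        have hn1 : (1:ℝ) ≤ n := by exact_mod_cast (by omega)
        have hL : Λ n ≤ 2 * Real.sqrt n := by
          refine ArithmeticFunction.vonMangoldt_le_log.trans ?_
          have : Real.log n = 2 * Real.log (Real.sqrt n) := by
            rw [Real.log_sqrt hn0.le]; ring
          rw [this]
          have := Real.log_le_self (Real.sqrt_nonneg n)
          linarith
        push_cast
        set a := Real.sqrt n with ha
        set b := Real.sqrt (n + 1) with hb
        have ha0 : 0 < a := Real.sqrt_pos.mpr hn0
        have hb0 : 0 < b := Real.sqrt_pos.mpr (by linarith)
        have ha2 : (n:ℝ) = a ^ 2 := (Real.sq_sqrt hn0.le).symm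
        have hb2 : (n:ℝ) + 1 = b ^ 2 := (Real.sq_sqrt (by linarith)).symm
        have hab : a ≤ b := Real.sqrt_le_sqrt (by linarith)
        calc Λ n / ((n:ℝ) * (n + 1)) ≤ 2 * a / ((n:ℝ) * (n + 1)) := by gcongr
          _ = 2 * a / (a ^ 2 * b ^ 2) := by rw [hb2, ← ha2]
          _ ≤ 4 * (1 / a - 1 / b) := by
            rw [div_sub_div _ _ ha0.ne' hb0.ne', ← mul_div_assoc, div_le_div_iff₀ (by positivity) (by positivity)]
            have hd : (b - a) * (b + a) = 1 := by nlinarith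
            have hd' : 1 ≤ 2 * b * (b - a) := by nlinarith
            have : 2 * a * (a * b) * 1 ≤ 2 * a * (a * b) * (2 * b * (b - a)) := by gcongr
            nlinarith
      refine (sum_le_sum h5).trans ?_
      rw [← mul_sum]
      have : ∀ N, 2 * X₀ ≤ N → ∑ n ∈ Icc (2 * X₀) N, (1 / Real.sqrt n - 1 / Real.sqrt (n + 1 : ℕ)) =
          1 / Real.sqrt (2 * X₀ : ℕ) - 1 / Real.sqrt (N + 1 : ℕ) := by
        intro N hN
        induction N, hN using Nat.le_induction with
        | base => simp
        | succ b hab ih =>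
          rw [← Finset.insert_Icc_right_eq_Icc_add_one (by omega), Finset.sum_insert (by simp), ih]
          ring
      rw [this N hN]
      have h6 : 1 / Real.sqrt (2 * X₀ : ℕ) ≤ 1 := by
        rw [div_le_one (Real.sqrt_pos.mpr (by exact_mod_cast (by omega)))]
        rw [Real.one_le_sqrt]; exact_mod_cast (by omega)
      have : 0 ≤ 1 / Real.sqrt (N + 1 : ℕ) := by positivity
      linarith
    have : 0 ≤ Real.log 4 := Real.log_nonneg (by norm_num)
    linarith
  have hlim : Filter.Tendsto (fun N : ℕ => ε * Real.log N) Filter.atTop Filter.atTop :=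
    (Real.tendsto_log_atTop.comp tendsto_natCast_atTop_atTop).const_mul_atTop hε
  obtain ⟨N, hN1, hN2⟩ := ((hlim.eventually_gt_atTop (C + (1 - ε))).and
    (Filter.eventually_ge_atTop (2 * X₀))).exists
  have h1 := hmain N hN2
  have h2 := hC N hN2
  nlinarith

end MT

end

section
namespace MT
open Finset

/-- primes in `(D, Y]` -/
def PS (D Y : ℕ) : Finset ℕ := (Ioc D Y).filter Nat.Prime

lemma mem_PS {D Y p : ℕ} : p ∈ PS D Y ↔ (D < p ∧ p ≤ Y) ∧ p.Prime := by
  simp [PS]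

/-- reciprocal sum of integers below `M` coprime to `W` -/
noncomputable def Hs (W M : ℕ) : ℝ := ∑ n ∈ (range M).filter (fun n => W.Coprime n), 1 / (n:ℝ)

/-- `φ(W)/W` -/
noncomputable def dens (W : ℕ) : ℝ := (Nat.totient W : ℝ) / W

lemma dens_pos {W : ℕ} (hW : 0 < W) : 0 < dens W := by
  have := Nat.totient_pos.mpr hW
  unfold dens; positivity

lemma Hs_mono (W : ℕ) {M N : ℕ} (h : M ≤ N) : Hs W M ≤ Hs W N := by
  refine sum_le_sum_of_subset_of_nonneg ?_ (fun _ _ _ => by positivity)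
  intro n hn
  simp only [mem_filter, mem_range] at hn ⊢
  exact ⟨by omega, hn.2⟩

lemma Hs_block (W T : ℕ) : Hs W (W * (T + 1)) = Hs W (W * T) +
    ∑ n ∈ (Ico (W * T) (W * T + W)).filter (fun n => W.Coprime n), 1 / (n:ℝ) := by
  unfold Hs
  rw [← sum_union]
  · congr 1
    rw [← filter_union]
    congr 1
    rw [range_eq_Ico, range_eq_Ico, mul_add, mul_one, Ico_union_Ico_eq_Ico (by omega) (by omega)]
  · refine disjoint_filter_filter ?_
    rw [range_eq_Ico]; exact Ico_disjoint_Ico_consecutive _ _ _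

lemma Hs_lower (W T : ℕ) (hW : 0 < W) :
    dens W * ((harmonic T : ℚ) - 1 : ℝ) ≤ Hs W (W * T) := by
  have hd := (dens_pos hW).le
  induction T with
  | zero => simp [Hs, hd]
  | succ T ih =>
    rw [Hs_block, harmonic_succ]
    rcases Nat.eq_zero_or_pos T with rfl | hT
    · have : (0:ℝ) ≤ Hs W (W * 0) + ∑ n ∈ (Ico (W * 0) (W * 0 + W)).filter
        (fun n => W.Coprime n), 1 / (n:ℝ) := by unfold Hs; positivity
      simpa using this
    have : dens W * (1 / (T + 1)) ≤ ∑ n ∈ (Ico (W * T) (W * T + W)).filter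
        (fun n => W.Coprime n), 1 / (n:ℝ) := by
      calc dens W * (1 / (T + 1)) = #((Ico (W * T) (W * T + W)).filter
        (fun n => W.Coprime n)) • (1 / ((W:ℝ) * (T + 1))) := by
            rw [Nat.filter_coprime_Ico_eq_totient, nsmul_eq_mul, dens]
            have : (0:ℝ) < W := by exact_mod_cast hW
            field_simp
        _ ≤ _ := by
            refine card_nsmul_le_sum _ _ _ fun n hn => ?_
            simp only [mem_filter, mem_Ico] at hn
            have h1 : 0 < n := lt_of_lt_of_le (by positivity) hn.1.1
            have h2 : (n:ℝ) ≤ W * (T + 1) := by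
              have : n ≤ W * (T + 1) := by rw [mul_add]; omega
              exact_mod_cast this
            exact one_div_le_one_div_of_le (by exact_mod_cast h1) h2
    push_cast
    rw [← one_div]
    linarith

lemma Hs_upper (W T : ℕ) (hW : 0 < W) :
    Hs W (W * (T + 1)) ≤ Nat.totient W + dens W * ((harmonic T : ℚ) : ℝ) := by
  have hd := (dens_pos hW).le
  induction T with
  | zero =>
    have h0 : Hs W (W * 0) = 0 := by simp [Hs]
    rw [Hs_block, h0]
    simp only [harmonic_zero, Rat.cast_zero, mul_zero, add_zero, zero_add]
    have := Nat.filter_coprime_Ico_eq_totient W 0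
    rw [zero_add] at this
    rw [← this]
    refine (sum_le_card_nsmul _ _ 1 fun n hn => ?_).trans (by simp)
    rcases Nat.eq_zero_or_pos n with rfl | h
    · simp
    · rw [div_le_one (by exact_mod_cast h)]; exact_mod_cast h
  | succ T ih =>
    rw [Hs_block, harmonic_succ]
    have : ∑ n ∈ (Ico (W * (T+1)) (W * (T+1) + W)).filter
        (fun n => W.Coprime n), 1 / (n:ℝ) ≤ dens W * (1 / (T + 1)) := by
      calc _ ≤ #((Ico (W * (T+1)) (W * (T+1) + W)).filter
        (fun n => W.Coprime n)) • (1 / ((W:ℝ) * (T + 1))) := by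
            refine sum_le_card_nsmul _ _ _ fun n hn => ?_
            simp only [mem_filter, mem_Ico] at hn
            have hW' : (0:ℝ) < W := by exact_mod_cast hW
            have h2 : (W:ℝ) * (T + 1) ≤ n := by
              exact_mod_cast hn.1.1
            exact one_div_le_one_div_of_le (by positivity) h2
        _ = _ := by
            rw [Nat.filter_coprime_Ico_eq_totient, nsmul_eq_mul, dens]
            have : (0:ℝ) < W := by exact_mod_cast hW
            field_simp
    push_cast
    rw [← one_div]
    linarith

lemma Hs_asymp (W : ℕ) (hW : 0 < W) : ∃ C : ℝ, 0 ≤ C ∧ ∀ M : ℕ, 1 ≤ M →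
    |Hs W M - dens W * Real.log M| ≤ C := by
  have hd := (dens_pos hW).le
  have hW1 : (1:ℝ) ≤ W := by exact_mod_cast hW
  have hlW : 0 ≤ Real.log W := Real.log_nonneg hW1
  refine ⟨Nat.totient W + dens W * (1 + Real.log W), by positivity, fun M hM => ?_⟩
  set T := M / W with hT
  have h1 : W * T ≤ M := Nat.mul_div_le M W
  have h2 : M < W * (T + 1) := by
    have := Nat.lt_mul_div_succ M hW
    simpa using this
  have hM' : (0:ℝ) < M := by exact_mod_cast hM
  have hlo := (Hs_lower W T hW).trans (Hs_mono W h1)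
  have hup := (Hs_mono W h2.le).trans (Hs_upper W T hW)
  have e1 : Real.log M - Real.log W ≤ ((harmonic T : ℚ) : ℝ) := by
    refine le_trans ?_ (log_add_one_le_harmonic T)
    rw [← Real.log_div hM'.ne' (by positivity)]
    apply Real.log_le_log (by positivity)
    rw [div_le_iff₀ (by positivity)]
    have : M ≤ (T + 1) * W := by rw [mul_comm]; exact h2.le
    exact_mod_cast this
  have e2 : ((harmonic T : ℚ) : ℝ) ≤ 1 + Real.log M := by
    refine (harmonic_le_one_add_log T).trans ?_
    rcases Nat.eq_zero_or_pos T with h | h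
    · rw [h]; simp
      exact Real.log_nonneg (by exact_mod_cast hM)
    · have : T ≤ M := Nat.div_le_self _ _
      gcongr
  have e3 := mul_le_mul_of_nonneg_left e1 hd
  have e4 := mul_le_mul_of_nonneg_left e2 hd
  have : (0:ℝ) ≤ Nat.totient W := by positivity
  rw [abs_le]
  constructor <;> nlinarith

lemma coprime_primorial_iff {D n : ℕ} :
    (primorial D).Coprime n ↔ ∀ p, p.Prime → p ∣ n → D < p := by
  constructor
  · intro h p hp hpn
    by_contra! hle
    have : p ∣ primorial D := by
      rw [primorial]
      apply dvd_prod_of_mem (fun p => p)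
      simp [hp]; omega
    have := Nat.dvd_gcd this hpn
    rw [h] at this
    exact hp.one_lt.ne' (Nat.dvd_one.mp this)
  · intro h
    rw [primorial, Nat.coprime_prod_left_iff]
    intro p hp
    simp only [mem_filter, mem_range] at hp
    rw [hp.2.coprime_iff_not_dvd]
    intro hd
    have := h p hp.2 hd
    omega

/-- weight of a set of primes -/
noncomputable def gU (U : Finset ℕ) : ℝ := ∏ p ∈ U, (1 / ((p:ℝ) - 1))

lemma prime_sub_one_pos {p : ℕ} (hp : p.Prime) : (0:ℝ) < (p:ℝ) - 1 := by
  have : (2:ℝ) ≤ p := by exact_mod_cast hp.two_le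
  linarith

lemma prod_inj_aux {D Y : ℕ} {U V : Finset ℕ} (hU : U ⊆ PS D Y) (hV : V ⊆ PS D Y)
    (h : ∏ p ∈ U, p = ∏ p ∈ V, p) : U = V := by
  have h1 : (∏ p ∈ U, p).primeFactors = U := Nat.primeFactors_prod fun p hp => (mem_PS.mp (hU hp)).2
  have h2 : (∏ p ∈ V, p).primeFactors = V := Nat.primeFactors_prod fun p hp => (mem_PS.mp (hV hp)).2
  rw [← h1, ← h2, h]

lemma recip_upper (D Y M : ℕ) :
    ∑ U ∈ (PS D Y).powerset.filter (fun U => ∏ p ∈ U, p < M), 1 / ((∏ p ∈ U, p : ℕ) : ℝ) ≤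
      Hs (primorial D) M := by
  unfold Hs
  rw [← sum_image (f := fun n : ℕ => 1 / (n:ℝ)) (g := fun U : Finset ℕ => ∏ p ∈ U, p)]
  · refine sum_le_sum_of_subset_of_nonneg ?_ (fun _ _ _ => by positivity)
    intro n hn
    simp only [mem_image, mem_filter, mem_powerset] at hn
    obtain ⟨U, ⟨hU, hM⟩, rfl⟩ := hn
    simp only [mem_filter, mem_range, hM, true_and]
    rw [coprime_primorial_iff]
    intro p hp hd
    rw [hp.prime.dvd_finset_prod_iff] at hd
    obtain ⟨q, hq, hd⟩ := hd
    have hq' := mem_PS.mp (hU hq)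
    rw [(Nat.prime_dvd_prime_iff_eq hp hq'.2).mp hd]
    exact hq'.1.1
  · intro U hU V hV h
    simp only [coe_filter, mem_powerset, Set.mem_setOf_eq] at hU hV
    exact prod_inj_aux hU.1 hV.1 h

lemma recip_lower (D Y M : ℕ) (hD : 1 ≤ D) (hM : M ≤ Y + 1) :
    (1 - 1 / (D:ℝ)) * Hs (primorial D) M ≤
    ∑ U ∈ (PS D Y).powerset.filter (fun U => ∏ p ∈ U, p < M), 1 / ((∏ p ∈ U, p : ℕ) : ℝ) := by
  set W := primorial D with hW
  have h1 : Hs W M = ∑ n ∈ ((range M).filter (fun n => W.Coprime n)).filter Squarefree, 1 / (n:ℝ) +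
     ∑ n ∈ ((range M).filter (fun n => W.Coprime n)).filter (fun n => ¬ Squarefree n), 1 / (n:ℝ) := by
    rw [Hs, sum_filter_add_sum_filter_not]
  have h2 : ∑ n ∈ ((range M).filter (fun n => W.Coprime n)).filter Squarefree, 1 / (n:ℝ) ≤
      ∑ U ∈ (PS D Y).powerset.filter (fun U => ∏ p ∈ U, p < M), 1 / ((∏ p ∈ U, p : ℕ) : ℝ) := by
    rw [← sum_image (f := fun n : ℕ => 1 / (n:ℝ)) (g := fun U : Finset ℕ => ∏ p ∈ U, p)]
    · refine sum_le_sum_of_subset_of_nonneg ?_ (fun _ _ _ => by positivity)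
      intro n hn
      simp only [mem_filter, mem_range] at hn
      obtain ⟨⟨hn1, hn2⟩, hn3⟩ := hn
      simp only [mem_image, mem_filter, mem_powerset]
      have hpr := Nat.prod_primeFactors_of_squarefree hn3
      refine ⟨n.primeFactors, ⟨?_, by rw [hpr]; exact hn1⟩, hpr⟩
      intro p hp
      rw [Nat.mem_primeFactors] at hp
      rw [mem_PS]
      refine ⟨⟨coprime_primorial_iff.mp hn2 p hp.1 hp.2.1, ?_⟩, hp.1⟩
      have := Nat.le_of_dvd (Nat.pos_of_ne_zero hp.2.2) hp.2.1
      omega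
    · intro U hU V hV h
      simp only [coe_filter, mem_powerset, Set.mem_setOf_eq] at hU hV
      exact prod_inj_aux hU.1 hV.1 h
  have h3 : ∑ n ∈ ((range M).filter (fun n => W.Coprime n)).filter (fun n => ¬ Squarefree n),
      1 / (n:ℝ) ≤ 1 / (D:ℝ) * Hs W M := by
    calc _ ≤ ∑ x ∈ (Ioc D M) ×ˢ ((range M).filter (fun n => W.Coprime n)),
          1 / ((x.1 * x.1 * x.2 : ℕ) : ℝ) := by
          rw [← Finset.sum_fiberwise_of_maps_to (s := _ ×ˢ _) (t := insert 0 (image (fun x : ℕ × ℕ => x.1 * x.1 * x.2)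
            ((Ioc D M) ×ˢ ((range M).filter (fun n => W.Coprime n)))))
            (g := fun x : ℕ × ℕ => x.1 * x.1 * x.2)]
          · refine (sum_le_sum_of_subset_of_nonneg (t := insert 0 (image (fun x : ℕ × ℕ => x.1 * x.1 * x.2)
              ((Ioc D M) ×ˢ ((range M).filter (fun n => W.Coprime n))))) ?_
              (fun _ _ _ => by positivity)).trans (sum_le_sum fun n hn => ?_)
            · intro n hn
              simp only [mem_filter, mem_range] at hn
              obtain ⟨⟨hn1, hn2⟩, hn3⟩ := hn
              rw [mem_insert]
              rcases Nat.eq_zero_or_pos n with rfl | hpos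
              · left; rfl
              right
              rw [Nat.squarefree_iff_prime_squarefree] at hn3
              push Not at hn3
              obtain ⟨p, hp, m, hm⟩ := hn3
              have hpn : p ∣ n := ⟨p * m, by rw [hm]; ring⟩
              have hmn : m ∣ n := ⟨p * p, by rw [hm]; ring⟩
              refine mem_image.mpr ⟨(p, m), ?_, hm.symm⟩
              simp only [mem_product, mem_Ioc, mem_filter, mem_range]
              refine ⟨⟨coprime_primorial_iff.mp hn2 p hp hpn, ?_⟩, ?_, hn2.coprime_dvd_right hmn⟩
              · have := Nat.le_of_dvd hpos hpn
                omega
              · exact (Nat.le_of_dvd hpos hmn).trans_lt hn1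
            · rw [mem_insert, mem_image] at hn
              rcases hn with rfl | ⟨x, hx, rfl⟩
              · simp only [Nat.cast_zero, div_zero]; positivity
              · refine single_le_sum (f := fun i : ℕ × ℕ => 1 / ((i.1 * i.1 * i.2 : ℕ) : ℝ))
                  (fun _ _ => by positivity) (mem_filter.mpr ⟨hx, rfl⟩)
          · intro x hx
            exact mem_insert_of_mem (mem_image_of_mem _ hx)
      _ = (∑ p ∈ Ioc D M, 1 / ((p:ℝ) * p)) * Hs W M := by
          rw [sum_product, Hs, sum_mul_sum]
          refine sum_congr rfl fun p _ => sum_congr rfl fun m _ => ?_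
          push_cast
          rw [div_mul_div_comm, one_mul]
      _ ≤ _ := by
          have : 0 ≤ Hs W M := by unfold Hs; positivity
          gcongr
          refine le_trans (sum_le_sum fun p hp => ?_) (sum_inv_mul_pred_le D M hD)
          rw [mem_Ioc] at hp
          have : (2:ℝ) ≤ p := by exact_mod_cast (by omega)
          apply one_div_le_one_div_of_le
          · nlinarith
          · nlinarith
  linarith

lemma TU_lower (D Y M : ℕ) (hD : 1 ≤ D) (hM : M ≤ Y + 1) :
    (1 - 1 / (D:ℝ)) * Hs (primorial D) M ≤
    ∑ U ∈ (PS D Y).powerset.filter (fun U => ∏ p ∈ U, p < M), gU U := by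
  refine (recip_lower D Y M hD hM).trans (sum_le_sum fun U hU => ?_)
  rw [mem_filter, mem_powerset] at hU
  rw [gU]
  push_cast
  rw [one_div, ← prod_inv_distrib]
  refine prod_le_prod (fun p _ => by positivity) fun p hp => ?_
  have := prime_sub_one_pos (mem_PS.mp (hU.1 hp)).2
  rw [← one_div]
  exact one_div_le_one_div_of_le this (by linarith)

lemma TU_upper (D Y M : ℕ) (hD : 1 ≤ D) :
    ∑ U ∈ (PS D Y).powerset.filter (fun U => ∏ p ∈ U, p < M), gU U ≤
      Real.exp (1 / D) * Hs (primorial D) M := by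
  have hpos : ∀ U ∈ (PS D Y).powerset, ∀ p ∈ U, (0:ℝ) < (p:ℝ) - 1 := fun U hU p hp =>
    prime_sub_one_pos (mem_PS.mp (mem_powerset.mp hU hp)).2
  have hgpos : ∀ V ∈ (PS D Y).powerset, 0 ≤ gU V := fun V hV =>
    prod_nonneg fun p hp => by have := hpos V hV p hp; positivity
  calc _ = ∑ U ∈ (PS D Y).powerset.filter (fun U => ∏ p ∈ U, p < M), ∑ V ∈ U.powerset,
        gU V * (1 / ((∏ p ∈ V, p : ℕ) : ℝ)) * (1 / ((∏ p ∈ U \ V, p : ℕ) : ℝ)) := by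
        refine sum_congr rfl fun U hU => ?_
        rw [mem_filter] at hU
        have : gU U = (∏ p ∈ U, (1 / (p:ℝ))) * ∏ p ∈ U, (1 + 1 / ((p:ℝ) - 1)) := by
          rw [← prod_mul_distrib, gU]
          refine prod_congr rfl fun p hp => ?_
          have := hpos U hU.1 p hp
          have : (0:ℝ) < p := by linarith
          field_simp
          ring
        rw [this, prod_one_add, mul_sum]
        refine sum_congr rfl fun V hV => ?_
        rw [mem_powerset] at hV
        rw [gU, ← prod_sdiff hV]
        push_cast
        simp only [one_div, prod_inv_distrib]
        ring
    _ = ∑ x ∈ ((PS D Y).powerset.filter (fun U => ∏ p ∈ U, p < M)).sigma (fun U => U.powerset),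
        gU x.2 * (1 / ((∏ p ∈ x.2, p : ℕ) : ℝ)) * (1 / ((∏ p ∈ x.1 \ x.2, p : ℕ) : ℝ)) := by
        rw [sum_sigma]
    _ ≤ ∑ x ∈ (PS D Y).powerset ×ˢ ((PS D Y).powerset.filter (fun U => ∏ p ∈ U, p < M)),
        gU x.1 * (1 / ((∏ p ∈ x.1, p : ℕ) : ℝ)) * (1 / ((∏ p ∈ x.2, p : ℕ) : ℝ)) := by
        rw [← sum_image (f := fun x : Finset ℕ × Finset ℕ => gU x.1 * (1 / ((∏ p ∈ x.1, p : ℕ) : ℝ)) *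
          (1 / ((∏ p ∈ x.2, p : ℕ) : ℝ))) (g := fun x : (_ : Finset ℕ) × Finset ℕ => (x.2, x.1 \ x.2))]
        · refine sum_le_sum_of_subset_of_nonneg ?_ ?_
          · intro x hx
            rw [mem_image] at hx
            obtain ⟨⟨U, V⟩, hUV, rfl⟩ := hx
            simp only [mem_sigma, mem_filter, mem_powerset] at hUV
            simp only [mem_product, mem_filter, mem_powerset]
            refine ⟨hUV.2.trans hUV.1.1, sdiff_subset.trans hUV.1.1, ?_⟩
            refine lt_of_le_of_lt ?_ hUV.1.2
            refine prod_le_prod_of_subset_of_one_le' sdiff_subset fun p hp _ => ?_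
            exact (mem_PS.mp (hUV.1.1 hp)).2.one_lt.le
          · intro x hx _
            rw [mem_product] at hx
            have := hgpos x.1 hx.1
            positivity
        · rintro ⟨U, V⟩ hU ⟨U', V'⟩ hU' h
          simp only [coe_sigma, Set.mem_sigma_iff, mem_coe, mem_powerset] at hU hU'
          simp only [Prod.mk.injEq] at h
          obtain ⟨rfl, h⟩ := h
          have : U = U' := by
            rw [← sdiff_union_of_subset hU.2, ← sdiff_union_of_subset hU'.2, h]
          rw [this]
    _ = (∑ V ∈ (PS D Y).powerset, gU V * (1 / ((∏ p ∈ V, p : ℕ) : ℝ))) *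
        ∑ U ∈ (PS D Y).powerset.filter (fun U => ∏ p ∈ U, p < M), 1 / ((∏ p ∈ U, p : ℕ) : ℝ) := by
        rw [sum_product, sum_mul_sum]
    _ ≤ _ := by
        have h1 : ∑ V ∈ (PS D Y).powerset, gU V * (1 / ((∏ p ∈ V, p : ℕ) : ℝ)) ≤ Real.exp (1 / D) := by
          have : ∀ V ∈ (PS D Y).powerset, gU V * (1 / ((∏ p ∈ V, p : ℕ) : ℝ)) =
              ∏ p ∈ V, (1 / (((p:ℝ) - 1) * p)) := by
            intro V hV
            rw [gU]; push_cast
            simp only [one_div, mul_inv, prod_mul_distrib, prod_inv_distrib]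
          rw [sum_congr rfl this, ← prod_one_add]
          calc _ ≤ ∏ p ∈ PS D Y, Real.exp (1 / (((p:ℝ) - 1) * p)) := by
                refine prod_le_prod (fun p hp => ?_) fun p hp => ?_
                · have := prime_sub_one_pos (mem_PS.mp hp).2
                  positivity
                · rw [add_comm]; exact Real.add_one_le_exp _
            _ = Real.exp (∑ p ∈ PS D Y, 1 / (((p:ℝ) - 1) * p)) := by rw [Real.exp_sum]
            _ ≤ _ := by
                apply Real.exp_le_exp.mpr
                refine le_trans (sum_le_sum_of_subset_of_nonneg (filter_subset _ _) ?_)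
                  (sum_inv_mul_pred_le D Y hD)
                intro p hp _
                rw [mem_Ioc] at hp
                have : (2:ℝ) ≤ p := by exact_mod_cast (by omega)
                have : 0 < (p:ℝ) - 1 := by linarith
                positivity
        have h2 := recip_upper D Y M
        gcongr

/-- the cell of a number at scale `ℓ`. -/
noncomputable def cellOf (ℓ : ℝ) (r : ℕ) : ℕ := ⌊Real.log r / ℓ⌋₊

/-- `∑_{U ⊆ P, cell U = j} g(U)` -/
noncomputable def SC (D Y : ℕ) (ℓ : ℝ) (j : ℕ) : ℝ :=
  ∑ U ∈ (PS D Y).powerset.filter (fun U => cellOf ℓ (∏ p ∈ U, p) = j), gU U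

lemma cellOf_lt_iff {ℓ : ℝ} (hℓ : 0 < ℓ) {r : ℕ} (hr : 0 < r) (j : ℕ) :
    cellOf ℓ r < j ↔ r < ⌈Real.exp (j * ℓ)⌉₊ := by
  have hr' : (1:ℝ) ≤ r := by exact_mod_cast hr
  have h0 : 0 ≤ Real.log r := Real.log_nonneg hr'
  rw [cellOf, Nat.floor_lt (by positivity), div_lt_iff₀ hℓ, Nat.lt_ceil,
    Real.log_lt_iff_lt_exp (by linarith)]

lemma SC_eq (D Y : ℕ) {ℓ : ℝ} (hℓ : 0 < ℓ) (j : ℕ) : SC D Y ℓ j =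
    ∑ U ∈ (PS D Y).powerset.filter (fun U => ∏ p ∈ U, p < ⌈Real.exp ((j + 1 : ℕ) * ℓ)⌉₊), gU U -
    ∑ U ∈ (PS D Y).powerset.filter (fun U => ∏ p ∈ U, p < ⌈Real.exp (j * ℓ)⌉₊), gU U := by
  rw [eq_sub_iff_add_eq, SC, ← sum_union]
  · refine sum_congr ?_ fun _ _ => rfl
    ext U
    simp only [mem_union, mem_filter]
    rw [← and_or_left]
    refine and_congr_right fun hU => ?_
    have hr : 0 < ∏ p ∈ U, p := prod_pos fun p hp => (mem_PS.mp (mem_powerset.mp hU hp)).2.pos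
    rw [← cellOf_lt_iff hℓ hr, ← cellOf_lt_iff hℓ hr]
    omega
  · rw [disjoint_filter]
    intro U hU h1
    have hr : 0 < ∏ p ∈ U, p := prod_pos fun p hp => (mem_PS.mp (mem_powerset.mp hU hp)).2.pos
    rw [← cellOf_lt_iff hℓ hr]
    omega

lemma log_ceil_exp (t : ℝ) (ht : 0 ≤ t) : |Real.log (⌈Real.exp t⌉₊ : ℝ) - t| ≤ 1 := by
  have h1 : Real.exp t ≤ (⌈Real.exp t⌉₊ : ℝ) := Nat.le_ceil _
  have h2 : (⌈Real.exp t⌉₊ : ℝ) < Real.exp t + 1 := Nat.ceil_lt_add_one (Real.exp_pos t).le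
  have h3 : 1 ≤ Real.exp t := Real.one_le_exp ht
  have h4 : t ≤ Real.log (⌈Real.exp t⌉₊ : ℝ) := by
    rw [Real.le_log_iff_exp_le (by linarith)]; exact h1
  have h5 : Real.log (⌈Real.exp t⌉₊ : ℝ) ≤ t + 1 := by
    rw [Real.log_le_iff_le_exp (by linarith), Real.exp_add]
    have : (2:ℝ) ≤ Real.exp 1 := by linarith [Real.add_one_le_exp (1:ℝ)]
    nlinarith
  rw [abs_le]; constructor <;> linarith

theorem SC_asymp (δ : ℝ) (hδ : 0 < δ) (K : ℕ) : ∃ D₁ : ℕ, 1 ≤ D₁ ∧ ∀ D, D₁ ≤ D → ∃ ℓ₀ : ℝ, 0 < ℓ₀ ∧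
    ∀ ℓ, ℓ₀ ≤ ℓ → ∀ Y : ℕ, Real.exp (K * ℓ) ≤ Y → ∀ j, j < K →
      |SC D Y ℓ j - dens (primorial D) * ℓ| ≤ δ * (dens (primorial D) * ℓ) := by
  -- choose D with exp(1/D) - 1 ≤ η, 1/D ≤ η
  obtain ⟨η, hη, hη2⟩ : ∃ η : ℝ, 0 < η ∧ 2 * η * K + η ≤ δ / 2 := by
    refine ⟨δ / (2 * (2 * K + 1)), by positivity, le_of_eq ?_⟩
    field_simp
  have hlim : Filter.Tendsto (fun D : ℕ => Real.exp (1 / (D:ℝ))) Filter.atTop (nhds 1) := by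
    have h := (Real.continuous_exp.tendsto 0).comp (tendsto_one_div_atTop_nhds_zero_nat (𝕜 := ℝ))
    rw [Real.exp_zero] at h
    exact h
  obtain ⟨D₁, hD₁⟩ := Filter.eventually_atTop.mp
    (((hlim.eventually (gt_mem_nhds (show (1:ℝ) < 1 + η by linarith))).and
    ((tendsto_one_div_atTop_nhds_zero_nat (𝕜 := ℝ)).eventually (gt_mem_nhds hη))).and
    (Filter.eventually_ge_atTop 1))
  refine ⟨max D₁ 1, le_max_right _ _, fun D hD => ?_⟩
  obtain ⟨⟨hD2, hD3⟩, hD4⟩ := hD₁ D ((le_max_left _ _).trans hD)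
  set W := primorial D with hW
  have hWpos : 0 < W := primorial_pos D
  have hd := dens_pos hWpos
  obtain ⟨C, hC0, hC⟩ := Hs_asymp W hWpos
  set C' := C + dens W with hC'
  refine ⟨max 1 ((2 * (2 * C')+ 4 * η * C') / (δ * dens W)), by positivity, fun ℓ hℓ Y hY j hj => ?_⟩
  have hℓ1 : 1 ≤ ℓ := (le_max_left _ _).trans hℓ
  have hℓ0 : 0 < ℓ := by linarith
  have hℓ2 : 2 * (2 * C') + 4 * η * C' ≤ δ * (dens W * ℓ) := by
    have := (le_max_right _ _).trans hℓ
    rw [div_le_iff₀ (by positivity)] at this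
    linarith
  have hHs : ∀ j : ℕ, |Hs W ⌈Real.exp (j * ℓ)⌉₊ - dens W * (j * ℓ)| ≤ C' := by
    intro j
    have h1 := hC ⌈Real.exp (j * ℓ)⌉₊ (Nat.one_le_iff_ne_zero.mpr
      (Nat.ceil_pos.mpr (Real.exp_pos _)).ne')
    have h2 := log_ceil_exp (j * ℓ) (by positivity)
    have h3 : |dens W * Real.log (⌈Real.exp (j * ℓ)⌉₊ : ℝ) - dens W * (j * ℓ)| ≤ dens W := by
      rw [← mul_sub, abs_mul, abs_of_pos hd]
      nlinarith
    calc _ ≤ _ := abs_sub_le _ (dens W * Real.log (⌈Real.exp (j * ℓ)⌉₊ : ℝ)) _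
      _ ≤ _ := add_le_add h1 h3
  have hHs0 : ∀ M, 0 ≤ Hs W M := fun M => by unfold Hs; positivity
  have hT : ∀ i : ℕ, i ≤ K →
      |∑ U ∈ (PS D Y).powerset.filter (fun U => ∏ p ∈ U, p < ⌈Real.exp (i * ℓ)⌉₊), gU U
        - dens W * (i * ℓ)| ≤ C' + η * (dens W * (i * ℓ) + C') := by
    intro i hi
    have hM : ⌈Real.exp (i * ℓ)⌉₊ ≤ Y + 1 := by
      refine Nat.ceil_le.mpr ?_
      have : Real.exp (i * ℓ) ≤ Real.exp (K * ℓ) := by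
        apply Real.exp_le_exp.mpr; gcongr
      push_cast; linarith
    have h1 := TU_lower D Y _ hD4 hM
    have h2 := TU_upper D Y ⌈Real.exp (i * ℓ)⌉₊ hD4
    have h3 := abs_le.mp (hHs i)
    have h4 := hHs0 ⌈Real.exp (i * ℓ)⌉₊
    have h5 := mul_le_mul_of_nonneg_right hD2.le h4
    have h6 := mul_le_mul_of_nonneg_right hD3.le h4
    have h7 : η * Hs W ⌈Real.exp (i * ℓ)⌉₊ ≤ η * (dens W * (i * ℓ) + C') := by
      gcongr; linarith
    rw [abs_le]
    constructor <;> nlinarith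
  have a1 := abs_le.mp (hT j hj.le)
  have a2 := abs_le.mp (hT (j + 1) hj)
  rw [SC_eq D Y hℓ0]
  have hjK : (j:ℝ) + 1 ≤ K := by exact_mod_cast hj
  have hP : 0 < dens W * ℓ := by positivity
  have key : η * (dens W * (j * ℓ)) + η * (dens W * (((j:ℝ)+1) * ℓ)) ≤ δ / 2 * (dens W * ℓ) := by
    have : η * (dens W * (j * ℓ)) + η * (dens W * (((j:ℝ)+1) * ℓ)) = (η * (2 * j + 1)) * (dens W * ℓ) := by
      ring
    rw [this]
    gcongr
    nlinarith
  push_cast at a1 a2 ⊢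
  rw [abs_le]
  constructor <;> nlinarith

end MT

end

section

set_option linter.unusedSectionVars false
namespace MT
open Finset

section gram
variable {ι L α : Type} [Fintype ι] [DecidableEq ι] [Fintype L] [DecidableEq L]

theorem abs_prod_sub_prod_le (s : Finset ι) (a b : ι → ℝ) :
    |∏ p ∈ s, a p - ∏ p ∈ s, b p| ≤ ∏ p ∈ s, (|b p| + |a p - b p|) - ∏ p ∈ s, |b p| := by
  induction s using Finset.induction_on with
  | empty => simp
  | insert p s hp ih =>
    rw [prod_insert hp, prod_insert hp, prod_insert hp, prod_insert hp]
    set x := ∏ p ∈ s, a p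
    set y := ∏ p ∈ s, b p
    have hy : |y| = ∏ p ∈ s, |b p| := abs_prod _ _
    set z := ∏ p ∈ s, (|b p| + |a p - b p|)
    rw [← hy] at ih ⊢
    have hxz : |x| ≤ z := by
      rw [show |x| = ∏ p ∈ s, |a p| from abs_prod _ _]
      refine prod_le_prod (fun _ _ => abs_nonneg _) (fun q _ => ?_)
      have := abs_add_le (b q) (a q - b q)
      simpa using this
    have h1 : a p * x - b p * y = (a p - b p) * x + b p * (x - y) := by ring
    rw [h1]
    calc |(a p - b p) * x + b p * (x - y)| ≤ |a p - b p| * |x| + |b p| * |x - y| := by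
          rw [← abs_mul, ← abs_mul]; exact abs_add_le _ _
      _ ≤ |a p - b p| * z + |b p| * (z - |y|) := by gcongr
      _ = _ := by ring

/-- sum over pairs of a product. -/
theorem sum_pair_prod (F : ι → L → L → ℝ) :
    ∑ A : ι → L, ∑ A' : ι → L, ∏ p, F p (A p) (A' p) = ∏ p, ∑ l, ∑ l', F p l l' := by
  have h1 : ∀ p, ∑ l, ∑ l', F p l l' = ∑ x : L × L, F p x.1 x.2 := fun p => by
    rw [Fintype.sum_prod_type]
  simp_rw [h1]
  rw [Finset.prod_univ_sum, Fintype.piFinset_univ, ← Fintype.sum_prod_type']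
  exact Fintype.sum_equiv (Equiv.arrowProdEquivProdArrow ι (fun _ => L) (fun _ => L)).symm _ _ (fun x => rfl)

theorem gram_bound (g : ι → L → ℝ) (hg : ∀ p l, 0 ≤ g p l) (hT : ∀ p, 1 ≤ ∑ l, g p l)
    (G : ι → L → L → ℝ) (B : ι → ℝ)
    (hB : ∀ p, ∑ l, ∑ l', |G p l l' - if l = l' then g p l else 0| ≤ B p)
    (u : (ι → L) → ℝ) (U : ℝ) (hU : ∀ A, |u A| ≤ U) :
    |∑ A, ∑ A', u A * u A' * ∏ p, G p (A p) (A' p) - ∑ A, u A ^ 2 * ∏ p, g p (A p)|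
      ≤ U ^ 2 * ((∏ p, ∑ l, g p l) * (Real.exp (∑ p, B p) - 1)) := by
  set M : ι → L → L → ℝ := fun p l l' => if l = l' then g p l else 0 with hM
  have hM0 : ∀ p l l', 0 ≤ M p l l' := fun p l l' => by
    simp only [hM]; split_ifs; exacts [hg _ _, le_rfl]
  have hdiag : ∑ A, u A ^ 2 * ∏ p, g p (A p) = ∑ A, ∑ A', u A * u A' * ∏ p, M p (A p) (A' p) := by
    refine sum_congr rfl fun A _ => ?_
    rw [sum_eq_single A]
    · simp [hM, sq]
    · intro A' _ hne
      obtain ⟨p, hp⟩ := Function.ne_iff.mp hne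
      rw [prod_eq_zero (mem_univ p), mul_zero]
      simp [hM, Ne.symm hp]
    · simp
  rw [hdiag, ← sum_sub_distrib]
  simp_rw [← sum_sub_distrib, ← mul_sub]
  have hU0 : 0 ≤ U ^ 2 := sq_nonneg _
  calc _ ≤ ∑ A, ∑ A', |u A * u A' * (∏ p, G p (A p) (A' p) - ∏ p, M p (A p) (A' p))| := by
        refine (abs_sum_le_sum_abs _ _).trans (sum_le_sum fun A _ => abs_sum_le_sum_abs _ _)
    _ ≤ ∑ A : ι → L, ∑ A' : ι → L, U ^ 2 * (∏ p, (|M p (A p) (A' p)| + |G p (A p) (A' p) - M p (A p) (A' p)|)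
          - ∏ p, |M p (A p) (A' p)|) := by
        refine sum_le_sum fun A _ => sum_le_sum fun A' _ => ?_
        rw [abs_mul, abs_mul]
        have h1 := abs_prod_sub_prod_le univ (fun p => G p (A p) (A' p)) (fun p => M p (A p) (A' p))
        have h2 : |u A| * |u A'| ≤ U ^ 2 := by
          rw [sq]; exact mul_le_mul (hU _) (hU _) (abs_nonneg _) ((abs_nonneg _).trans (hU A))
        exact mul_le_mul h2 h1 (abs_nonneg _) hU0
    _ = U ^ 2 * (∏ p, ∑ l, ∑ l', (|M p l l'| + |G p l l' - M p l l'|) - ∏ p, ∑ l, ∑ l', |M p l l'|) := by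
        simp_rw [← mul_sum, sum_sub_distrib]
        rw [sum_pair_prod (fun p l l' => |M p l l'| + |G p l l' - M p l l'|), sum_pair_prod (fun p l l' => |M p l l'|)]
    _ ≤ _ := by
        gcongr
        have hMs : ∀ p, ∑ l, ∑ l', |M p l l'| = ∑ l, g p l := fun p => by
          refine sum_congr rfl fun l _ => ?_
          simp_rw [abs_of_nonneg (hM0 _ _ _)]
          simp [hM]
        simp_rw [sum_add_distrib, hMs]
        rw [mul_sub, mul_one]
        gcongr
        rw [Real.exp_sum, ← prod_mul_distrib]
        refine prod_le_prod (fun p _ => ?_) (fun p _ => ?_)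
        · have := hT p
          have : 0 ≤ ∑ l, ∑ l', |G p l l' - M p l l'| := sum_nonneg fun _ _ => sum_nonneg fun _ _ => abs_nonneg _
          linarith
        · have h1 := hT p
          have h2 := hB p
          have h3 : 0 ≤ ∑ l, ∑ l', |G p l l' - M p l l'| := sum_nonneg fun _ _ => sum_nonneg fun _ _ => abs_nonneg _
          have h4 := Real.add_one_le_exp (B p)
          calc _ ≤ ∑ l, g p l + B p := by linarith
            _ ≤ (∑ l, g p l) * (B p + 1) := by nlinarith
            _ ≤ _ := by gcongr

/-- The support of a pair. -/
def supp2 (z : L) (A A' : ι → L) : Finset ι := univ.filter fun p => ¬ (A p = z ∧ A' p = z)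

theorem sum_pair_supp_le (z : L) (C : ℝ) (hC : 0 ≤ C) (V : Finset ι) :
    ∑ A : ι → L, ∑ A' : ι → L, (if supp2 z A A' = V then C ^ V.card else 0)
      ≤ ((Fintype.card L : ℝ) ^ 2 * C) ^ V.card := by
  have h : ∀ A A' : ι → L, (if supp2 z A A' = V then C ^ V.card else 0) ≤
      ∏ p, (if p ∈ V then C else if A p = z ∧ A' p = z then 1 else 0) := by
    intro A A'
    split_ifs with h
    · rw [prod_ite]
      rw [prod_const]
      rw [show (univ.filter fun p => p ∈ V) = V by ext; simp]
      rw [prod_eq_one, mul_one]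
      intro p hp
      rw [mem_filter, ← h, supp2, mem_filter] at hp
      rw [if_pos]
      by_contra hh
      exact hp.2 ⟨mem_univ _, hh⟩
    · refine prod_nonneg fun p _ => ?_
      split_ifs <;> first | exact hC | norm_num
  refine (sum_le_sum fun A _ => sum_le_sum fun A' _ => h A A').trans ?_
  rw [sum_pair_prod (fun p l l' => if p ∈ V then C else if l = z ∧ l' = z then 1 else 0)]
  have h2 : ∀ p, ∑ l : L, ∑ l' : L, (if p ∈ V then C else if l = z ∧ l' = z then 1 else 0)
      = if p ∈ V then (Fintype.card L : ℝ) ^ 2 * C else 1 := by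
    intro p
    split_ifs with hp
    · simp [card_univ]; ring
    · rw [sum_eq_single z, sum_eq_single z] <;> simp +contextual
  simp_rw [h2]
  rw [prod_ite, prod_const_one, mul_one, prod_const]
  rw [show (univ.filter fun p => p ∈ V) = V by ext; simp]

theorem abs_sieve (z : L) (S : Finset α) (μ : α → ℝ) (φ : ι → L → α → ℝ)
    (g : ι → L → ℝ) (hg : ∀ p l, 0 ≤ g p l) (hT : ∀ p, 1 ≤ ∑ l, g p l)
    (G : ι → L → L → ℝ) (B : ι → ℝ)
    (hB : ∀ p, ∑ l, ∑ l', |G p l l' - if l = l' then g p l else 0| ≤ B p)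
    (u : (ι → L) → ℝ) (U : ℝ) (hU : ∀ A, |u A| ≤ U) (X : ℝ) (hX : 0 ≤ X) (C : ℝ) (hC : 0 ≤ C)
    (Err : Finset ι → ℝ) (hErr : ∀ V, 0 ≤ Err V) (𝒱 : Finset (Finset ι))
    (hV : ∀ A A', u A ≠ 0 → u A' ≠ 0 → supp2 z A A' ∈ 𝒱)
    (hd : ∀ A A', u A ≠ 0 → u A' ≠ 0 →
      |∑ n ∈ S, μ n * ∏ p, (g p (A p) * φ p (A p) n * (g p (A' p) * φ p (A' p) n))
        - X * ∏ p, G p (A p) (A' p)| ≤ Err (supp2 z A A') * C ^ (supp2 z A A').card) :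
    |∑ n ∈ S, μ n * (∑ A, u A * ∏ p, (g p (A p) * φ p (A p) n)) ^ 2
        - X * ∑ A, u A ^ 2 * ∏ p, g p (A p)|
      ≤ X * (U ^ 2 * ((∏ p, ∑ l, g p l) * (Real.exp (∑ p, B p) - 1)))
        + U ^ 2 * ∑ V ∈ 𝒱, Err V * ((Fintype.card L : ℝ) ^ 2 * C) ^ V.card := by
  have hexp : ∑ n ∈ S, μ n * (∑ A, u A * ∏ p, (g p (A p) * φ p (A p) n)) ^ 2
      = ∑ A, ∑ A', u A * u A' * ∑ n ∈ S, μ n * ∏ p, (g p (A p) * φ p (A p) n * (g p (A' p) * φ p (A' p) n)) := by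
    calc _ = ∑ n ∈ S, ∑ A, ∑ A', u A * u A' * (μ n * ∏ p, (g p (A p) * φ p (A p) n * (g p (A' p) * φ p (A' p) n))) := by
          refine sum_congr rfl fun n _ => ?_
          rw [sq, sum_mul_sum, mul_sum]
          refine sum_congr rfl fun A _ => ?_
          rw [mul_sum]
          refine sum_congr rfl fun A' _ => ?_
          rw [prod_mul_distrib (f := fun p => g p (A p) * φ p (A p) n)]
          ring
      _ = _ := by
          rw [sum_comm]
          refine sum_congr rfl fun A _ => ?_
          rw [sum_comm]
          refine sum_congr rfl fun A' _ => ?_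
          rw [mul_sum]
  have hG := gram_bound g hg hT G B hB u U hU
  set Q := ∑ A, ∑ A', u A * u A' * ∏ p, G p (A p) (A' p) with hQ
  have h2 : |∑ A, ∑ A', u A * u A' * ∑ n ∈ S, μ n * ∏ p, (g p (A p) * φ p (A p) n * (g p (A' p) * φ p (A' p) n))
      - X * Q| ≤ U ^ 2 * ∑ V ∈ 𝒱, Err V * ((Fintype.card L : ℝ) ^ 2 * C) ^ V.card := by
    rw [hQ, mul_sum]
    simp_rw [mul_sum]
    simp_rw [← mul_sum S]
    rw [← sum_sub_distrib]
    simp_rw [← sum_sub_distrib]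
    calc _ ≤ ∑ A, ∑ A', U ^ 2 * ∑ V ∈ 𝒱, Err V * (if supp2 z A A' = V then C ^ V.card else 0) := by
          refine (abs_sum_le_sum_abs _ _).trans (sum_le_sum fun A _ => (abs_sum_le_sum_abs _ _).trans
            (sum_le_sum fun A' _ => ?_))
          have hnn : 0 ≤ ∑ V ∈ 𝒱, Err V * (if supp2 z A A' = V then C ^ V.card else 0) := by
            refine sum_nonneg fun V _ => mul_nonneg (hErr _) ?_
            split_ifs <;> positivity
          by_cases hA : u A = 0
          · simp only [hA, zero_mul, mul_zero, sub_zero, abs_zero]; positivity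
          by_cases hA' : u A' = 0
          · simp only [hA', zero_mul, mul_zero, sub_zero, abs_zero]; positivity
          have h3 := hd A A' hA hA'
          rw [show ∀ a b c d : ℝ, a * b * c - X * (a * b * d) = a * b * (c - X * d) by intros; ring,
            abs_mul, abs_mul]
          refine mul_le_mul ?_ ?_ (abs_nonneg _) (sq_nonneg _)
          · rw [sq]; exact mul_le_mul (hU _) (hU _) (abs_nonneg _) ((abs_nonneg _).trans (hU A))
          · refine h3.trans ?_
            have := single_le_sum (f := fun V => Err V * (if supp2 z A A' = V then C ^ V.card else 0))
              (fun V _ => mul_nonneg (hErr V) (by split_ifs <;> positivity)) (hV A A' hA hA')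
            simpa using this
      _ = U ^ 2 * ∑ V ∈ 𝒱, Err V * ∑ A : ι → L, ∑ A' : ι → L, (if supp2 z A A' = V then C ^ V.card else 0) := by
          simp_rw [← mul_sum]
          congr 1
          simp_rw [mul_sum]
          calc _ = ∑ A : ι → L, ∑ V ∈ 𝒱, ∑ A' : ι → L, Err V * (if supp2 z A A' = V then C ^ V.card else 0) :=
                sum_congr rfl fun A _ => sum_comm
            _ = _ := sum_comm
      _ ≤ _ := by
          rw [mul_sum]
          refine sum_le_sum fun V _ => mul_le_mul_of_nonneg_left ?_ (sq_nonneg _)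
          exact mul_le_mul_of_nonneg_left (sum_pair_supp_le z C hC V) (hErr V)
  rw [hexp]
  have h5 : |X * Q - X * ∑ A, u A ^ 2 * ∏ p, g p (A p)| ≤
      X * (U ^ 2 * ((∏ p, ∑ l, g p l) * (Real.exp (∑ p, B p) - 1))) := by
    rw [← mul_sub, abs_mul, abs_of_nonneg hX]
    gcongr
  have := abs_sub_le (∑ A, ∑ A', u A * u A' * ∑ n ∈ S, μ n * ∏ p, (g p (A p) * φ p (A p) n * (g p (A' p) * φ p (A' p) n))) (X * Q) (X * ∑ A, u A ^ 2 * ∏ p, g p (A p))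
  linarith

end gram
end MT

end

section

set_option linter.unusedSectionVars false
namespace MT
open Finset

noncomputable section
variable {k : ℕ}

def chi (p : ℕ) (z : ℤ) : ℝ := if (p:ℤ) ∣ z then 1 - p else 1
def phi1 (h : Fin k → ℤ) (p : ℕ) (l : Fin k → Bool) (n : ℤ) : ℝ :=
  ∏ i, if l i then chi p (n + h i) else 1
def zl : Fin k → Bool := fun _ => false
def phi2 (h : Fin k → ℤ) (i0 : Fin k) (p : ℕ) (l : Fin k → Bool) (n : ℤ) : ℝ :=
  if l = zl then 1 else if (p:ℤ) ∣ n + h i0 then 0 else phi1 h p l n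
def gl (p : ℕ) (l : Fin k → Bool) : ℝ := ∏ i, if l i then 1 / ((p:ℝ) - 1) else 1
def gl0 (i0 : Fin k) (p : ℕ) (l : Fin k → Bool) : ℝ := if l i0 then 0 else gl p l

/-- distinctness mod p -/
def DistP (h : Fin k → ℤ) (p : ℕ) : Prop := ∀ i j, i ≠ j → ¬ (p:ℤ) ∣ h i - h j

theorem prod_ite_dvd (h : Fin k → ℤ) (p : ℕ) (hd : DistP h p) (v : Fin k → ℝ) (a : ℤ) :
    ∏ i, (if (p:ℤ) ∣ a + h i then v i else 1) = 1 + ∑ i, if (p:ℤ) ∣ a + h i then v i - 1 else 0 := by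
  by_cases hex : ∃ i, (p:ℤ) ∣ a + h i
  · obtain ⟨i, hi⟩ := hex
    have hne : ∀ j, j ≠ i → ¬ (p:ℤ) ∣ a + h j := fun j hj hdvd => by
      apply hd j i hj
      have := dvd_sub hdvd hi
      simpa using this
    rw [prod_eq_single i, sum_eq_single i]
    · simp [hi]
    · intro j _ hj; rw [if_neg (hne j hj)]
    · simp
    · intro j _ hj; rw [if_neg (hne j hj)]
    · simp
  · push Not at hex
    simp [hex]

theorem sum_range_dvd (p : ℕ) (hp : 0 < p) (h : ℤ) (c : ℝ) :
    ∑ a ∈ range p, (if (p:ℤ) ∣ (a:ℤ) + h then c else 0) = c := by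
  have hp' : (0:ℤ) < p := by exact_mod_cast hp
  have h0 := Int.emod_nonneg (-h) hp'.ne'
  have h1 := Int.emod_lt_of_pos (-h) hp'
  have hz : ((-h) % p).toNat < p := by omega
  rw [sum_eq_single ((-h) % p).toNat]
  · rw [if_pos]
    rw [Int.toNat_of_nonneg h0]
    have := Int.emod_add_mul_ediv (-h) p
    exact ⟨-((-h) / p), by linarith⟩
  · intro a ha hne
    rw [if_neg]
    intro hdvd
    apply hne
    have ha' := mem_range.mp ha
    have : (a:ℤ) % p = (-h) % p := by
      have h9 : (p:ℤ) ∣ (a:ℤ) - -h := by simpa using hdvd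
      exact (Int.modEq_iff_dvd.mpr h9).symm
    rw [Int.emod_eq_of_lt (by omega) (by omega)] at this
    omega
  · intro hh; exact absurd (mem_range.mpr hz) hh

theorem local_sum (h : Fin k → ℤ) (p : ℕ) (hp : 0 < p) (hd : DistP h p) (v : Fin k → ℝ) :
    ∑ a ∈ range p, ∏ i, (if (p:ℤ) ∣ (a:ℤ) + h i then v i else 1) = p + ∑ i, (v i - 1) := by
  simp_rw [prod_ite_dvd h p hd v]
  rw [sum_add_distrib, sum_comm]
  simp_rw [sum_range_dvd p hp]
  simp

def mm (l l' : Fin k → Bool) (i : Fin k) : ℕ := (l i).toNat + (l' i).toNat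
def n1 (l l' : Fin k → Bool) : ℕ := (univ.filter fun i => mm l l' i = 1).card
def n2 (l l' : Fin k → Bool) : ℕ := (univ.filter fun i => mm l l' i = 2).card

theorem mm_cases (l l' : Fin k → Bool) (i) : mm l l' i = 0 ∨ mm l l' i = 1 ∨ mm l l' i = 2 := by
  unfold mm; cases l i <;> cases l' i <;> simp

theorem sum_mm (l l' : Fin k → Bool) (f : ℕ → ℝ) (hf : f 0 = 0) :
    ∑ i, f (mm l l' i) = n1 l l' * f 1 + n2 l l' * f 2 := by
  have : ∀ i, f (mm l l' i) = (if mm l l' i = 1 then f 1 else 0) + (if mm l l' i = 2 then f 2 else 0) := by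
    intro i; rcases mm_cases l l' i with h | h | h <;> simp [h, hf]
  simp_rw [this, sum_add_distrib, ← sum_filter, sum_const, n1, n2, nsmul_eq_mul]

theorem n12_le (l l' : Fin k → Bool) : n1 l l' + n2 l l' ≤ k := by
  unfold n1 n2
  rw [← card_union_of_disjoint]
  · exact (card_le_univ _).trans (by simp)
  · rw [disjoint_filter]; intro i _ h; omega

theorem n1_eq_zero (l l' : Fin k → Bool) : n1 l l' = 0 ↔ l = l' := by
  unfold n1
  rw [card_eq_zero, filter_eq_empty_iff]
  constructor
  · intro h; funext i
    have := @h i (mem_univ i)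
    unfold mm at this
    revert this
    cases l i <;> cases l' i <;> simp
  · rintro rfl i _
    unfold mm; omega

theorem n12_eq_zero (l l' : Fin k → Bool) : (n1 l l' = 0 ∧ n2 l l' = 0) ↔ (l = zl ∧ l' = zl) := by
  rw [n1_eq_zero]
  constructor
  · rintro ⟨rfl, h⟩
    have : l = zl := by
      funext i
      unfold n2 at h
      rw [card_eq_zero, filter_eq_empty_iff] at h
      have := @h i (mem_univ i)
      unfold mm at this
      revert this
      cases l i <;> simp [zl]
    exact ⟨this, this⟩
  · rintro ⟨rfl, rfl⟩
    refine ⟨rfl, ?_⟩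
    simp [n2, mm, zl]

theorem n2_self (l : Fin k → Bool) (p : ℕ) : gl p l = (1 / ((p:ℝ) - 1)) ^ (n2 l l) := by
  unfold gl n2 mm
  rw [prod_ite, prod_const, prod_const_one, mul_one]
  congr 2
  ext i
  simp only [mem_filter, mem_univ, true_and]
  cases l i <;> simp

theorem gl_mul (l l' : Fin k → Bool) (p : ℕ) :
    gl p l * gl p l' = (1 / ((p:ℝ) - 1)) ^ (n1 l l' + 2 * n2 l l') := by
  unfold gl
  rw [← prod_mul_distrib]
  have : ∀ i, (if l i then 1 / ((p:ℝ) - 1) else 1) * (if l' i then 1 / ((p:ℝ) - 1) else 1)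
      = (if mm l l' i = 1 then 1 / ((p:ℝ) - 1) else 1) * (if mm l l' i = 2 then (1 / ((p:ℝ) - 1)) ^ 2 else 1) := by
    intro i; unfold mm; cases l i <;> cases l' i <;> simp [sq]
  simp_rw [this]
  rw [prod_mul_distrib, prod_ite, prod_ite, prod_const_one, prod_const_one, prod_const, prod_const, mul_one,
    mul_one, ← pow_mul, ← pow_add]
  rfl

theorem phi1_mul (h : Fin k → ℤ) (p : ℕ) (l l' : Fin k → Bool) (n : ℤ) :
    phi1 h p l n * phi1 h p l' n = ∏ i, (if (p:ℤ) ∣ n + h i then (1 - (p:ℝ)) ^ mm l l' i else 1) := by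
  unfold phi1 chi
  rw [← prod_mul_distrib]
  refine prod_congr rfl fun i _ => ?_
  unfold mm
  by_cases hh : (p:ℤ) ∣ n + h i <;> cases l i <;> cases l' i <;> simp [hh, sq]

theorem phi1_zl (h : Fin k → ℤ) (p : ℕ) (n : ℤ) : phi1 h p zl n = 1 := by simp [phi1, zl]
theorem phi2_zl (h : Fin k → ℤ) (i0) (p : ℕ) (n : ℤ) : phi2 h i0 p zl n = 1 := by simp [phi2]
theorem gl_zl (p : ℕ) : gl p (zl : Fin k → Bool) = 1 := by simp [gl, zl]
theorem gl0_zl (p : ℕ) (i0 : Fin k) : gl0 i0 p (zl : Fin k → Bool) = 1 := by simp [gl0, gl, zl]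

theorem phi2_mul (h : Fin k → ℤ) (p : ℕ) (i0 : Fin k) (l l' : Fin k → Bool) (hne : ¬ (l = zl ∧ l' = zl)) (n : ℤ) :
    phi2 h i0 p l n * phi2 h i0 p l' n =
      ∏ i, (if (p:ℤ) ∣ n + h i then (if i = i0 then 0 else (1 - (p:ℝ)) ^ mm l l' i) else 1) := by
  by_cases hi : (p:ℤ) ∣ n + h i0
  · rw [prod_eq_zero (mem_univ i0) (by simp [hi])]
    unfold phi2
    by_cases h1 : l = zl
    · have h2 : l' ≠ zl := fun h2 => hne ⟨h1, h2⟩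
      simp [h1, h2, hi]
    · simp [h1, hi]
  · have hl : ∀ l, phi2 h i0 p l n = phi1 h p l n := by
      intro l; unfold phi2
      split_ifs with h1
      · rw [h1, phi1_zl]
      · rfl
    rw [hl, hl, phi1_mul]
    refine prod_congr rfl fun i _ => ?_
    by_cases hii : i = i0
    · subst hii; simp [hi]
    · simp [hii]

theorem sum_phi1 (h : Fin k → ℤ) (p : ℕ) (hp : 0 < p) (hd : DistP h p) (l l' : Fin k → Bool) :
    ∑ a ∈ range p, phi1 h p l a * phi1 h p l' a = p - n1 l l' * p + n2 l l' * (((p:ℝ) - 1) ^ 2 - 1) := by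
  simp_rw [phi1_mul]
  rw [local_sum h p hp hd (fun i => (1 - (p:ℝ)) ^ mm l l' i), sum_mm l l' (fun m => (1 - (p:ℝ)) ^ m - 1) (by simp)]
  ring

theorem sum_phi2 (h : Fin k → ℤ) (p : ℕ) (hp : 0 < p) (i0 : Fin k) (hd : DistP h p) (l l' : Fin k → Bool)
    (h1 : l i0 = false) (h2 : l' i0 = false) (hne : ¬ (l = zl ∧ l' = zl)) :
    ∑ a ∈ range p, phi2 h i0 p l a * phi2 h i0 p l' a =
      (p - 1) - n1 l l' * p + n2 l l' * (((p:ℝ) - 1) ^ 2 - 1) := by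
  simp_rw [phi2_mul h p i0 l l' hne]
  rw [local_sum h p hp hd (fun i => if i = i0 then 0 else (1 - (p:ℝ)) ^ mm l l' i)]
  have : ∀ i, (if i = i0 then 0 else (1 - (p:ℝ)) ^ mm l l' i) - 1 = ((1 - (p:ℝ)) ^ mm l l' i - 1) + if i = i0 then -1 else 0 := by
    intro i
    split_ifs with hi
    · subst hi; simp [mm, h1, h2]
    · ring
  simp_rw [this]
  rw [sum_add_distrib, sum_mm l l' (fun m => (1 - (p:ℝ)) ^ m - 1) (by simp)]
  simp
  ring

theorem sum_abs_phi1 (h : Fin k → ℤ) (p : ℕ) (hp : 2 ≤ p) (hd : DistP h p) (l l' : Fin k → Bool) :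
    ∑ a ∈ range p, |phi1 h p l a * phi1 h p l' a| = p + n1 l l' * ((p:ℝ) - 2) + n2 l l' * (((p:ℝ) - 1) ^ 2 - 1) := by
  have hp1 : (2:ℝ) ≤ p := by exact_mod_cast hp
  simp_rw [phi1_mul, abs_prod]
  have : ∀ (a : ℤ) i, |if (p:ℤ) ∣ a + h i then (1 - (p:ℝ)) ^ mm l l' i else 1| = if (p:ℤ) ∣ a + h i then ((p:ℝ) - 1) ^ mm l l' i else 1 := by
    intro a i
    split_ifs
    · rw [abs_pow, abs_sub_comm, abs_of_nonneg (by linarith)]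
    · simp
  simp_rw [this]
  rw [local_sum h p (by omega) hd (fun i => ((p:ℝ) - 1) ^ mm l l' i), sum_mm l l' (fun m => ((p:ℝ) - 1) ^ m - 1) (by simp)]
  ring

theorem abs_phi2_le (h : Fin k → ℤ) (i0 : Fin k) (p : ℕ) (l : Fin k → Bool) (n : ℤ) : |phi2 h i0 p l n| ≤ |phi1 h p l n| := by
  unfold phi2
  split_ifs with h1 h2
  · rw [h1, phi1_zl]
  · simp
  · exact le_rfl

/-- numeric Gram bound -/
theorem numeric_gram (q α β : ℝ) (hq : 1 ≤ q) (hα1 : 1 ≤ α) (hα : α ≤ 1 + 1 / q) (hβ1 : q - 1 ≤ β) (hβ : β ≤ q)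
    (a b : ℕ) (hab : a + b ≤ k) (h0 : ¬ (a = 0 ∧ b = 0)) :
    |(1 / q) ^ (a + 2 * b) * (1 - a * α + b * β) - (if a = 0 then (1 / q) ^ b else 0)| ≤ (3 * k + 3) / q ^ 2 := by
  have hq0 : 0 < q := by linarith
  set r := 1 / q with hr
  have hr0 : 0 < r := by positivity
  have hr1 : r ≤ 1 := by rw [hr, div_le_one hq0]; exact hq
  have hrq : r * q = 1 := by rw [hr]; field_simp
  rw [show (3 * (k:ℝ) + 3) / q ^ 2 = r ^ 2 * (3 * k + 3) by rw [hr]; field_simp]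
  have habR : (a:ℝ) + b ≤ k := by exact_mod_cast hab
  have ha0 : (0:ℝ) ≤ a := by positivity
  have hb0 : (0:ℝ) ≤ b := by positivity
  have hpow : ∀ m n : ℕ, n ≤ m → r ^ m ≤ r ^ n := fun m n h => pow_le_pow_of_le_one hr0.le hr1 h
  have hβ0 : 0 ≤ β := by linarith
  have hα2 : α ≤ 2 := by linarith
  rcases Nat.eq_zero_or_pos a with ha | ha
  · subst ha
    have hb : 1 ≤ b := by omega
    simp only [if_true, Nat.cast_zero, zero_mul, sub_zero, zero_add]
    rcases Nat.eq_or_lt_of_le hb with hb1 | hb2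
    · subst hb1
      have : r ^ (2 * 1) * (1 + ((1:ℕ):ℝ) * β) - r ^ 1 = r ^ 2 * (1 + β - q) := by
        have : r = r ^ 2 * q := by rw [sq, mul_assoc, hrq, mul_one]
        push_cast
        nlinarith
      rw [this, abs_mul, abs_of_pos (by positivity)]
      gcongr
      rw [abs_le]; constructor <;> [linarith; linarith]
    · have h1 : r ^ (2 * b) * (1 + b * β) ≤ r ^ 2 * (1 + k) := by
        calc r ^ (2 * b) * (1 + b * β) ≤ r ^ 3 * (1 + k * q) := by
              apply mul_le_mul (hpow _ _ (by omega)) _ (by positivity) (by positivity)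
              have : (b:ℝ) * β ≤ k * q := by
                apply mul_le_mul _ hβ hβ0 (by positivity)
                push_cast at habR; linarith
              linarith
          _ = r ^ 2 * (r + k * (r * q)) := by ring
          _ ≤ r ^ 2 * (1 + k) := by rw [hrq]; gcongr; linarith
      have h2 : r ^ b ≤ r ^ 2 := hpow _ _ hb2
      have h3 : 0 ≤ r ^ (2 * b) * (1 + b * β) := by positivity
      have h4 : 0 < r ^ b := by positivity
      have hk0 : (0:ℝ) ≤ k := by positivity
      have h5 : 0 < r ^ 2 := by positivity
      rw [abs_le]; constructor <;> nlinarith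
  · rw [if_neg ha.ne', sub_zero, abs_mul, abs_of_pos (by positivity)]
    have hk0 : (0:ℝ) ≤ k := by positivity
    rcases Nat.eq_zero_or_pos b with hb | hb
    · subst hb
      simp only [mul_zero, add_zero, Nat.cast_zero, zero_mul]
      rcases Nat.eq_or_lt_of_le (show 1 ≤ a from ha) with ha1 | ha2
      · subst ha1
        simp only [pow_one, Nat.cast_one, one_mul]
        have : |1 - α| ≤ r := by rw [abs_le]; constructor <;> linarith
        calc r * |1 - α| ≤ r * r := by gcongr
          _ = r ^ 2 * 1 := by ring
          _ ≤ _ := by gcongr; linarith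
      · refine mul_le_mul (hpow _ _ ha2) ?_ (abs_nonneg _) (by positivity)
        rw [abs_le]; constructor <;> nlinarith
    · calc r ^ (a + 2 * b) * |1 - a * α + b * β| ≤ r ^ 3 * (1 + 2 * k + k * q) := by
            apply mul_le_mul (hpow _ _ (by omega)) _ (by positivity) (by positivity)
            · rw [abs_le]
              have : (a:ℝ) * α ≤ k * 2 := by
                apply mul_le_mul <;> linarith
              have : (b:ℝ) * β ≤ k * q := by
                apply mul_le_mul <;> linarith
              have : 0 ≤ (b:ℝ) * β := by positivity
              have : 0 ≤ (a:ℝ) * α := by positivity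
              have : 0 ≤ (k:ℝ) * q := by positivity
              constructor <;> linarith
        _ = r ^ 2 * (r * (1 + 2 * k) + k * (r * q)) := by ring
        _ ≤ r ^ 2 * (1 * (1 + 2 * k) + k * 1) := by rw [hrq]; gcongr
        _ ≤ _ := by apply mul_le_mul_of_nonneg_left _ (by positivity); linarith

theorem numeric_V (q : ℝ) (hq : 1 ≤ q) (a b : ℕ) (hab : a + b ≤ k) (h0 : ¬ (a = 0 ∧ b = 0)) :
    (1 / q) ^ (a + 2 * b) * ((q + 1) + a * (q - 1) + b * (q ^ 2 - 1)) ≤ 3 * k + 3 := by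
  have hq0 : 0 < q := by linarith
  set r := 1 / q with hr
  have hr0 : 0 < r := by positivity
  have hr1 : r ≤ 1 := by rw [hr, div_le_one hq0]; exact hq
  have hrq : r * q = 1 := by rw [hr]; field_simp
  have habR : (a:ℝ) + b ≤ k := by exact_mod_cast hab
  have ha0 : (0:ℝ) ≤ a := by positivity
  have hb0 : (0:ℝ) ≤ b := by positivity
  have hk0 : (0:ℝ) ≤ k := by positivity
  have hpow : ∀ m n : ℕ, n ≤ m → r ^ m ≤ r ^ n := fun m n h => pow_le_pow_of_le_one hr0.le hr1 h
  rcases Nat.eq_zero_or_pos b with hb | hb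
  · subst hb
    simp only [mul_zero, add_zero, Nat.cast_zero, zero_mul]
    calc r ^ a * (q + 1 + a * (q - 1)) ≤ r ^ 1 * (q + q + k * q) := by
          have : 0 ≤ q - 1 := by linarith
          apply mul_le_mul (hpow _ _ (by omega)) _ (by positivity) (by positivity)
          have : (a:ℝ) * (q - 1) ≤ k * q := by
            apply mul_le_mul _ (by linarith) this (by positivity)
            push_cast at habR; linarith
          linarith
      _ = (2 + k) * (r * q) := by ring
      _ ≤ _ := by rw [hrq]; linarith
  · calc r ^ (a + 2 * b) * ((q + 1) + a * (q - 1) + b * (q ^ 2 - 1)) ≤ r ^ 2 * ((q ^ 2 + q ^ 2) + k * q ^ 2) := by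
          have : 0 ≤ q - 1 := by linarith
          have h2 : 0 ≤ q ^ 2 - 1 := by nlinarith
          apply mul_le_mul
          · exact hpow _ _ (by omega)
          · have h3 : (a:ℝ) * (q - 1) ≤ a * q ^ 2 := by gcongr; nlinarith
            have h4 : (b:ℝ) * (q ^ 2 - 1) ≤ b * q ^ 2 := by gcongr; linarith
            nlinarith [mul_le_mul_of_nonneg_right habR (sq_nonneg q)]
          · positivity
          · positivity
      _ = (2 + k) * (r * q) ^ 2 := by ring
      _ ≤ _ := by rw [hrq]; linarith

end
end MT

end

section

set_option linter.unusedSectionVars false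
namespace MT
open Finset

noncomputable section

theorem per_congr {F : ℤ → ℝ} {q : ℕ} (hF : Function.Periodic F (q:ℤ)) {a b : ℤ} (h : a ≡ b [ZMOD q]) : F a = F b := by
  obtain ⟨c, hc⟩ := h.dvd
  have : b = a + c * q := by linarith
  rw [this]
  exact ((hF.int_mul c) a).symm

theorem crt_sum (q p : ℕ) (hq : 0 < q) (hp : 0 < p) (hc : q.Coprime p) (F f : ℤ → ℝ)
    (hF : Function.Periodic F (q:ℤ)) (hf : Function.Periodic f (p:ℤ)) :
    ∑ a ∈ range (q * p), F a * f a = (∑ a ∈ range q, F a) * ∑ a ∈ range p, f a := by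
  rw [sum_mul_sum, ← sum_product']
  refine sum_bij' (fun a _ => (a % q, a % p)) (fun x _ => (Nat.chineseRemainder hc x.1 x.2 : ℕ)) ?_ ?_ ?_ ?_ ?_
  · intro a _
    simp [Nat.mod_lt _ hq, Nat.mod_lt _ hp]
  · intro x _
    exact mem_range.mpr (Nat.chineseRemainder_lt_mul hc _ _ hq.ne' hp.ne')
  · intro a ha
    have h := (Nat.chineseRemainder hc (a % q) (a % p)).2
    have h2 : (Nat.chineseRemainder hc (a % q) (a % p) : ℕ) ≡ a [MOD q * p] := by
      rw [← Nat.modEq_and_modEq_iff_modEq_mul hc]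
      exact ⟨h.1.trans (Nat.mod_modEq _ _), h.2.trans (Nat.mod_modEq _ _)⟩
    exact h2.eq_of_lt_of_lt (Nat.chineseRemainder_lt_mul hc _ _ hq.ne' hp.ne') (mem_range.mp ha)
  · intro x hx
    rw [mem_product, mem_range, mem_range] at hx
    have h := (Nat.chineseRemainder hc x.1 x.2).2
    ext
    · exact (Nat.ModEq.eq_of_lt_of_lt ((Nat.mod_modEq _ _).trans h.1) (Nat.mod_lt _ hq) hx.1)
    · exact (Nat.ModEq.eq_of_lt_of_lt ((Nat.mod_modEq _ _).trans h.2) (Nat.mod_lt _ hp) hx.2)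
  · intro a _
    have h1 : F ((a % q : ℕ) : ℤ) = F a := per_congr hF ((Int.natCast_modEq_iff).mpr (Nat.mod_modEq _ _))
    have h2 : f ((a % p : ℕ) : ℤ) = f a := per_congr hf ((Int.natCast_modEq_iff).mpr (Nat.mod_modEq _ _))
    simp only [h1, h2]

theorem per_mono {F : ℤ → ℝ} {q r : ℕ} (hF : Function.Periodic F (q:ℤ)) (h : q ∣ r) : Function.Periodic F (r:ℤ) := by
  obtain ⟨c, rfl⟩ := h
  intro x
  rw [Nat.cast_mul, mul_comm]
  exact (hF.int_mul c) x

variable {ι α : Type} [DecidableEq ι]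

theorem per_prod (V : Finset ι) (pr : ι → ℕ) (f : ι → ℤ → ℝ) (hf : ∀ p, Function.Periodic (f p) (pr p : ℤ)) :
    Function.Periodic (fun n => ∏ p ∈ V, f p n) ((∏ p ∈ V, pr p : ℕ) : ℤ) := by
  intro x
  refine prod_congr rfl fun p hp => ?_
  exact per_mono (hf p) (dvd_prod_of_mem _ hp) x

theorem per_mul {F f : ℤ → ℝ} {W q : ℕ} (hF : Function.Periodic F (W:ℤ)) (hf : Function.Periodic f (q:ℤ)) :
    Function.Periodic (fun n => F n * f n) ((W * q : ℕ) : ℤ) := by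
  intro x
  have h1 := per_mono hF (dvd_mul_right W q) x
  have h2 := per_mono hf (dvd_mul_left q W) x
  simp only [h1, h2]

theorem crt_prod (V : Finset ι) (W : ℕ) (hW : 0 < W) (pr : ι → ℕ) (hpr : ∀ p, 0 < pr p)
    (hWp : ∀ p, W.Coprime (pr p)) (hpp : ∀ p p', p ≠ p' → (pr p).Coprime (pr p'))
    (F : ℤ → ℝ) (hF : Function.Periodic F (W:ℤ)) (f : ι → ℤ → ℝ) (hf : ∀ p, Function.Periodic (f p) (pr p : ℤ)) :
    ∑ a ∈ range (W * ∏ p ∈ V, pr p), F a * ∏ p ∈ V, f p a = (∑ a ∈ range W, F a) * ∏ p ∈ V, ∑ a ∈ range (pr p), f p a := by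
  induction V using Finset.induction_on with
  | empty => simp
  | insert p V hp ih =>
    rw [prod_insert hp, prod_insert hp]
    have hc : (W * ∏ p ∈ V, pr p).Coprime (pr p) := by
      refine Nat.Coprime.mul_left (hWp p) ?_
      refine Nat.Coprime.prod_left fun p' hp' => hpp _ _ ?_
      rintro rfl; exact hp hp'
    have hpos : 0 < W * ∏ p ∈ V, pr p := Nat.mul_pos hW (prod_pos fun p _ => hpr p)
    have h1 := crt_sum (W * ∏ p ∈ V, pr p) (pr p) hpos (hpr p) hc (fun n => F n * ∏ p ∈ V, f p n) (f p)
      (per_mul hF (per_prod V pr f hf)) (hf p)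
    rw [ih] at h1
    rw [show W * (pr p * ∏ p ∈ V, pr p) = W * (∏ p ∈ V, pr p) * pr p by ring]
    rw [show (∑ a ∈ range W, F a) * ((∑ a ∈ range (pr p), f p a) * ∏ p ∈ V, ∑ a ∈ range (pr p), f p a)
      = (∑ a ∈ range W, F a) * (∏ p ∈ V, ∑ a ∈ range (pr p), f p a) * ∑ a ∈ range (pr p), f p a by ring, ← h1]
    refine sum_congr rfl fun a _ => ?_
    rw [prod_insert hp]; ring

theorem fiber_sum (S : Finset α) (μ : α → ℝ) (e : α → ℤ) (q : ℕ) (hq : 0 < q) (F : ℤ → ℝ) (hF : Function.Periodic F (q:ℤ)) :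
    ∑ s ∈ S, μ s * F (e s) = ∑ a ∈ range q, F a * ∑ s ∈ S with e s ≡ a [ZMOD q], μ s := by
  have hq' : (0:ℤ) < q := by exact_mod_cast hq
  have hm : ∀ s ∈ S, (e s % q).toNat ∈ range q := by
    intro s _
    have h0 := Int.emod_nonneg (e s) hq'.ne'
    have h1 := Int.emod_lt_of_pos (e s) hq'
    rw [mem_range]; omega
  rw [← sum_fiberwise_of_maps_to hm]
  refine sum_congr rfl fun a ha => ?_
  rw [mem_range] at ha
  rw [mul_sum]
  have hset : (S.filter fun s => (e s % q).toNat = a) = S.filter fun s => e s ≡ a [ZMOD q] := by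
    refine filter_congr fun s _ => ?_
    have h0 := Int.emod_nonneg (e s) hq'.ne'
    have h2 : (a:ℤ) % q = a := Int.emod_eq_of_lt (by omega) (by omega)
    unfold Int.ModEq
    rw [h2]; omega
  rw [hset]
  refine sum_congr rfl fun s hs => ?_
  rw [per_congr hF (mem_filter.mp hs).2, mul_comm]

theorem dist_general (S : Finset α) (μ : α → ℝ) (e : α → ℤ) (q : ℕ) (hq : 0 < q) (F : ℤ → ℝ) (hF : Function.Periodic F (q:ℤ))
    (Y Err : ℝ) (hE : ∀ a : ℕ, a < q → F a ≠ 0 → |∑ s ∈ S with e s ≡ a [ZMOD q], μ s - Y| ≤ Err) :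
    |∑ s ∈ S, μ s * F (e s) - Y * ∑ a ∈ range q, F a| ≤ Err * ∑ a ∈ range q, |F a| := by
  rw [fiber_sum S μ e q hq F hF, mul_sum, ← sum_sub_distrib, mul_sum]
  refine (abs_sum_le_sum_abs _ _).trans (sum_le_sum fun a ha => ?_)
  by_cases h0 : F a = 0
  · simp [h0]
  · rw [mul_comm Y, ← mul_sub, abs_mul, mul_comm]
    exact mul_le_mul_of_nonneg_right (hE a (mem_range.mp ha) h0) (abs_nonneg _)

def ind (W : ℕ) (b : ℤ) (n : ℤ) : ℝ := if n ≡ b [ZMOD W] then 1 else 0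

theorem ind_per (W : ℕ) (b : ℤ) : Function.Periodic (ind W b) (W:ℤ) := by
  intro x
  unfold ind
  have : x + W ≡ x [ZMOD W] := by simp [Int.ModEq]
  simp only [show (x + W ≡ b [ZMOD W]) ↔ (x ≡ b [ZMOD W]) from ⟨fun h => this.symm.trans h, fun h => this.trans h⟩]

theorem sum_ind (W : ℕ) (hW : 0 < W) (b : ℤ) : ∑ a ∈ range W, ind W b a = 1 := by
  have := sum_range_dvd W hW (-b) 1
  rw [← this]
  refine sum_congr rfl fun a _ => ?_
  unfold ind
  simp only [Int.modEq_comm (a := (a:ℤ)), Int.modEq_iff_dvd, sub_eq_add_neg]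

theorem hd_general {L : Type} [DecidableEq L] [Fintype ι] (z : L) (W : ℕ) (hW : 0 < W) (b : ℤ) (pr : ι → ℕ) (hpr : ∀ p, 0 < pr p)
    (hWp : ∀ p, W.Coprime (pr p)) (hpp : ∀ p p', p ≠ p' → (pr p).Coprime (pr p'))
    (S : Finset α) (μ : α → ℝ) (e : α → ℤ) (φ : ι → L → ℤ → ℝ) (hφ : ∀ p l, Function.Periodic (φ p l) (pr p : ℤ))
    (hφz : ∀ p n, φ p z n = 1) (g : ι → L → ℝ) (hgz : ∀ p, g p z = 1) (hg : ∀ p l, 0 ≤ g p l)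
    (d : ι → ℝ) (C : ℝ)
    (G : ι → L → L → ℝ) (hGz : ∀ p, G p z z = 1)
    (hG : ∀ p l l', ¬ (l = z ∧ l' = z) → G p l l' = g p l * g p l' * ((∑ a ∈ range (pr p), φ p l a * φ p l' a) / d p))
    (hC : ∀ p l l', ¬ (l = z ∧ l' = z) → g p l * g p l' * (∑ a ∈ range (pr p), |φ p l a * φ p l' a|) ≤ C)
    (X Err : ℝ) (hErr : 0 ≤ Err) (A A' : ι → L)
    (hE : ∀ a : ℕ, a ≡ b [ZMOD W] → (∀ p ∈ supp2 z A A', φ p (A p) a * φ p (A' p) a ≠ 0) →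
      |∑ s ∈ S with e s ≡ a [ZMOD (W * ∏ p ∈ supp2 z A A', pr p : ℕ)], μ s - X / ∏ p ∈ supp2 z A A', d p| ≤ Err) :
    |∑ s ∈ S, (μ s * ind W b (e s)) * ∏ p, (g p (A p) * φ p (A p) (e s) * (g p (A' p) * φ p (A' p) (e s)))
        - X * ∏ p, G p (A p) (A' p)| ≤ Err * C ^ (supp2 z A A').card := by
  set V := supp2 z A A' with hV
  have hnV : ∀ p, p ∉ V → A p = z ∧ A' p = z := by
    intro p hp
    by_contra hh
    exact hp (by rw [hV, supp2, mem_filter]; exact ⟨mem_univ _, hh⟩)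
  have hmV : ∀ p, p ∈ V → ¬ (A p = z ∧ A' p = z) := by
    intro p hp
    rw [hV, supp2, mem_filter] at hp; exact hp.2
  set gg := ∏ p ∈ V, (g p (A p) * g p (A' p)) with hgg
  have hgg0 : 0 ≤ gg := prod_nonneg fun p _ => mul_nonneg (hg _ _) (hg _ _)
  have h1 : ∀ n, ∏ p, (g p (A p) * φ p (A p) n * (g p (A' p) * φ p (A' p) n)) = gg * ∏ p ∈ V, (φ p (A p) n * φ p (A' p) n) := by
    intro n
    rw [hgg, ← prod_mul_distrib]
    rw [← prod_subset (subset_univ V)]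
    · refine prod_congr rfl fun p _ => by ring
    · intro p _ hp
      obtain ⟨h1, h2⟩ := hnV p hp
      rw [h1, h2, hgz, hφz]; ring
  have h2 : ∏ p, G p (A p) (A' p) = gg * ((∏ p ∈ V, ∑ a ∈ range (pr p), φ p (A p) a * φ p (A' p) a) / ∏ p ∈ V, d p) := by
    rw [hgg, ← prod_div_distrib, ← prod_mul_distrib, ← prod_subset (subset_univ V)]
    · refine prod_congr rfl fun p hp => hG _ _ _ (hmV p hp)
    · intro p _ hp
      obtain ⟨h1, h2⟩ := hnV p hp
      rw [h1, h2, hGz]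
  set F : ℤ → ℝ := fun n => ind W b n * ∏ p ∈ V, (φ p (A p) n * φ p (A' p) n) with hFd
  have hff : ∀ p, Function.Periodic (fun n => φ p (A p) n * φ p (A' p) n) (pr p : ℤ) := fun p x => by
    simp only [hφ p (A p) x, hφ p (A' p) x]
  have hF : Function.Periodic F ((W * ∏ p ∈ V, pr p : ℕ) : ℤ) :=
    per_mul (ind_per W b) (per_prod V pr (fun p n => φ p (A p) n * φ p (A' p) n) hff)
  have hqpos : 0 < W * ∏ p ∈ V, pr p := Nat.mul_pos hW (prod_pos fun p _ => hpr p)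
  have hsumF : ∑ a ∈ range (W * ∏ p ∈ V, pr p), F a = ∏ p ∈ V, ∑ a ∈ range (pr p), φ p (A p) a * φ p (A' p) a := by
    rw [crt_prod V W hW pr hpr hWp hpp (ind W b) (ind_per W b) _ hff, sum_ind W hW, one_mul]
  have hsumFa : ∑ a ∈ range (W * ∏ p ∈ V, pr p), |F a| = ∏ p ∈ V, ∑ a ∈ range (pr p), |φ p (A p) a * φ p (A' p) a| := by
    have := crt_prod V W hW pr hpr hWp hpp (ind W b) (ind_per W b) (fun p n => |φ p (A p) n * φ p (A' p) n|)
      (fun p x => by simp only [hφ p (A p) x, hφ p (A' p) x])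
    rw [sum_ind W hW, one_mul] at this
    rw [← this]
    refine sum_congr rfl fun a _ => ?_
    rw [hFd]; simp only
    rw [abs_mul, abs_prod]
    congr 1
    unfold ind; split_ifs <;> simp
  have h3 := dist_general S μ e _ hqpos F hF (X / ∏ p ∈ V, d p) Err (by
    intro a _ ha
    rw [hFd] at ha; simp only at ha
    have ha1 := left_ne_zero_of_mul ha
    have ha2 := right_ne_zero_of_mul ha
    refine hE a ?_ ?_
    · by_contra hh; exact ha1 (by simp [ind, hh])
    · exact prod_ne_zero_iff.mp ha2)
  rw [hsumF, hsumFa] at h3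
  have h4 : ∑ s ∈ S, (μ s * ind W b (e s)) * ∏ p, (g p (A p) * φ p (A p) (e s) * (g p (A' p) * φ p (A' p) (e s)))
      = gg * ∑ s ∈ S, μ s * F (e s) := by
    rw [mul_sum]
    refine sum_congr rfl fun s _ => ?_
    rw [h1]; simp only [hFd]; ring
  rw [h4, h2]
  rw [show gg * ∑ s ∈ S, μ s * F (e s) - X * (gg * ((∏ p ∈ V, ∑ a ∈ range (pr p), φ p (A p) a * φ p (A' p) a) / ∏ p ∈ V, d p))
    = gg * (∑ s ∈ S, μ s * F (e s) - X / (∏ p ∈ V, d p) * ∏ p ∈ V, ∑ a ∈ range (pr p), φ p (A p) a * φ p (A' p) a) by ring]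
  rw [abs_mul, abs_of_nonneg hgg0]
  calc _ ≤ gg * (Err * ∏ p ∈ V, ∑ a ∈ range (pr p), |φ p (A p) a * φ p (A' p) a|) := by gcongr
    _ = Err * ∏ p ∈ V, (g p (A p) * g p (A' p) * ∑ a ∈ range (pr p), |φ p (A p) a * φ p (A' p) a|) := by
        rw [prod_mul_distrib, ← hgg]; ring
    _ ≤ Err * ∏ p ∈ V, C := by
        refine mul_le_mul_of_nonneg_left (prod_le_prod (fun p _ => ?_) (fun p hp => hC _ _ _ (hmV p hp))) hErr
        exact mul_nonneg (mul_nonneg (hg _ _) (hg _ _)) (sum_nonneg fun _ _ => abs_nonneg _)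
    _ = _ := by rw [prod_const]

end
end MT

end

section

set_option linter.unusedSectionVars false
namespace MT
open Finset

noncomputable section
variable {k : ℕ}

theorem chi_per (p : ℕ) (c : ℤ) : Function.Periodic (fun n => chi p (n + c)) (p:ℤ) := by
  intro x
  unfold chi
  have : ((p:ℤ) ∣ x + p + c) ↔ ((p:ℤ) ∣ x + c) := by
    rw [show x + p + c = (x + c) + p by ring]; exact dvd_add_self_right
  simp only [this]

theorem phi1_per (h : Fin k → ℤ) (p : ℕ) (l : Fin k → Bool) : Function.Periodic (phi1 h p l) (p:ℤ) := by
  intro x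
  unfold phi1
  refine prod_congr rfl fun i _ => ?_
  have := chi_per p (h i) x
  simp only at this
  rw [this]

theorem phi2_per (h : Fin k → ℤ) (i0 : Fin k) (p : ℕ) (l : Fin k → Bool) : Function.Periodic (phi2 h i0 p l) (p:ℤ) := by
  intro x
  unfold phi2
  have : ((p:ℤ) ∣ x + p + h i0) ↔ ((p:ℤ) ∣ x + h i0) := by
    rw [show x + p + h i0 = (x + h i0) + p by ring]; exact dvd_add_self_right
  simp only [this, phi1_per h p l x]

def Ck (k : ℕ) : ℝ := (4:ℝ) ^ k * (3 * k + 3)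
theorem Ck_pos (k : ℕ) : 0 < Ck k := by unfold Ck; positivity

def G1 (h : Fin k → ℤ) (p : ℕ) (l l' : Fin k → Bool) : ℝ :=
  gl p l * gl p l' * ((∑ a ∈ range p, phi1 h p l a * phi1 h p l' a) / p)
def G2 (h : Fin k → ℤ) (i0 : Fin k) (p : ℕ) (l l' : Fin k → Bool) : ℝ :=
  if l = zl ∧ l' = zl then 1 else
  gl0 i0 p l * gl0 i0 p l' * ((∑ a ∈ range p, phi2 h i0 p l a * phi2 h i0 p l' a) / ((p:ℝ) - 1))

theorem gl_nonneg (p : ℕ) (hp : 2 ≤ p) (l : Fin k → Bool) : 0 ≤ gl p l := by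
  have : (2:ℝ) ≤ p := by exact_mod_cast hp
  unfold gl
  refine prod_nonneg fun i _ => ?_
  split_ifs
  · exact div_nonneg zero_le_one (by linarith)
  · norm_num

theorem gl0_nonneg (p : ℕ) (hp : 2 ≤ p) (i0 : Fin k) (l : Fin k → Bool) : 0 ≤ gl0 i0 p l := by
  unfold gl0; split_ifs; exacts [le_rfl, gl_nonneg p hp l]

theorem gl0_le (p : ℕ) (hp : 2 ≤ p) (i0 : Fin k) (l : Fin k → Bool) : gl0 i0 p l ≤ gl p l := by
  unfold gl0; split_ifs; exacts [gl_nonneg p hp l, le_rfl]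

theorem sum_gl (p : ℕ) : ∑ l : Fin k → Bool, gl p l = (1 + 1 / ((p:ℝ) - 1)) ^ k := by
  unfold gl
  have := Finset.prod_univ_sum (fun _ : Fin k => (univ : Finset Bool)) (fun _ c => if c then 1 / ((p:ℝ) - 1) else 1)
  rw [Fintype.piFinset_univ] at this
  rw [← this]
  simp [add_comm]

theorem sum_gl0 (p : ℕ) (i0 : Fin k) : ∑ l : Fin k → Bool, gl0 i0 p l = (1 + 1 / ((p:ℝ) - 1)) ^ (k - 1) := by
  have e : ∀ l : Fin k → Bool, gl0 i0 p l = ∏ i, if l i then (if i = i0 then 0 else 1 / ((p:ℝ) - 1)) else 1 := by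
    intro l
    unfold gl0 gl
    split_ifs with h
    · exact (prod_eq_zero (mem_univ i0) (by simp [h])).symm
    · refine prod_congr rfl fun i _ => ?_
      by_cases hi : i = i0
      · subst hi; simp [h]
      · simp [hi]
  simp_rw [e]
  have := Finset.prod_univ_sum (fun _ : Fin k => (univ : Finset Bool)) (fun i c => if c then (if i = i0 then 0 else 1 / ((p:ℝ) - 1)) else 1)
  rw [Fintype.piFinset_univ] at this
  rw [← this, ← mul_prod_erase univ _ (mem_univ i0)]
  have h2 : ∀ i ∈ univ.erase i0, (∑ c : Bool, if c then (if i = i0 then 0 else 1 / ((p:ℝ) - 1)) else 1) = 1 + 1 / ((p:ℝ) - 1) := by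
    intro i hi
    simp [ne_of_mem_erase hi, add_comm]
  rw [prod_congr rfl h2, prod_const, card_erase_of_mem (mem_univ _), card_univ, Fintype.card_fin]
  simp

theorem sum_gl_ge (p : ℕ) (hp : 2 ≤ p) : 1 ≤ ∑ l : Fin k → Bool, gl p l := by
  rw [← gl_zl (k := k) p]
  exact single_le_sum (f := fun l => gl p l) (fun l _ => gl_nonneg p hp l) (mem_univ zl)

theorem sum_gl0_ge (p : ℕ) (hp : 2 ≤ p) (i0 : Fin k) : 1 ≤ ∑ l : Fin k → Bool, gl0 i0 p l := by
  rw [← gl0_zl p i0]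
  exact single_le_sum (f := fun l => gl0 i0 p l) (fun l _ => gl0_nonneg p hp i0 l) (mem_univ zl)

theorem sum_pair_const (c : ℝ) (F : (Fin k → Bool) → (Fin k → Bool) → ℝ) (hF : ∀ l l', F l l' ≤ c) :
    ∑ l, ∑ l', F l l' ≤ 4 ^ k * c := by
  calc _ ≤ ∑ l : Fin k → Bool, ∑ l' : Fin k → Bool, c := sum_le_sum fun l _ => sum_le_sum fun l' _ => hF l l'
    _ = _ := by
      simp only [sum_const, card_univ, nsmul_eq_mul, Fintype.card_pi_const, Fintype.card_bool, Nat.cast_pow, Nat.cast_ofNat]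
      rw [← mul_assoc, ← mul_pow]; norm_num

theorem G1_bound (h : Fin k → ℤ) (p : ℕ) (hp : 2 ≤ p) (hd : DistP h p) :
    ∑ l, ∑ l', |G1 h p l l' - if l = l' then gl p l else 0| ≤ Ck k / ((p:ℝ) - 1) ^ 2 := by
  have hpr : (2:ℝ) ≤ p := by exact_mod_cast hp
  unfold Ck
  rw [mul_div_assoc]
  refine sum_pair_const _ _ fun l l' => ?_
  by_cases h0 : l = zl ∧ l' = zl
  · obtain ⟨rfl, rfl⟩ := h0
    simp only [G1, gl_zl, phi1_zl, if_true]
    have : (p:ℝ) ≠ 0 := by linarith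
    simp [this]
    have : (0:ℝ) ≤ (3 * k + 3) / ((p:ℝ) - 1) ^ 2 := by positivity
    exact this
  · have h1 := numeric_gram (k := k) ((p:ℝ) - 1) 1 ((p:ℝ) - 1 - 1) (by linarith) le_rfl
      (by have : 0 ≤ 1 / ((p:ℝ) - 1) := div_nonneg zero_le_one (by linarith)
          linarith) (by linarith) (by linarith) (n1 l l') (n2 l l') (n12_le l l') (by rw [n12_eq_zero]; exact h0)
    convert h1 using 2
    unfold G1
    rw [gl_mul, sum_phi1 h p (by omega) hd]
    congr 1
    · congr 1
      field_simp
      ring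
    · simp only [n1_eq_zero]
      split_ifs with hh
      · subst hh; exact n2_self l p
      · rfl

theorem G2_bound (h : Fin k → ℤ) (i0 : Fin k) (p : ℕ) (hp : 2 ≤ p) (hd : DistP h p) :
    ∑ l, ∑ l', |G2 h i0 p l l' - if l = l' then gl0 i0 p l else 0| ≤ Ck k / ((p:ℝ) - 1) ^ 2 := by
  have hpr : (2:ℝ) ≤ p := by exact_mod_cast hp
  have hp1 : (0:ℝ) < (p:ℝ) - 1 := by linarith
  unfold Ck
  rw [mul_div_assoc]
  refine sum_pair_const _ _ fun l l' => ?_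
  have hnn : (0:ℝ) ≤ (3 * k + 3) / ((p:ℝ) - 1) ^ 2 := by positivity
  by_cases h0 : l = zl ∧ l' = zl
  · obtain ⟨rfl, rfl⟩ := h0
    simp only [G2, gl0_zl]
    simp [hnn]
  · unfold G2
    rw [if_neg h0]
    by_cases hl : l i0 = true
    · simp [gl0, hl, hnn]
    by_cases hl' : l' i0 = true
    · have : l ≠ l' := by rintro rfl; exact hl hl'
      simp [gl0, hl', this, hnn]
    simp only [Bool.not_eq_true] at hl hl'
    have h1 := numeric_gram (k := k) ((p:ℝ) - 1) (p / ((p:ℝ) - 1)) ((((p:ℝ) - 1) ^ 2 - 1) / ((p:ℝ) - 1)) (by linarith)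
      (by rw [le_div_iff₀ hp1]; linarith)
      (by rw [div_le_iff₀ hp1, add_mul, div_mul_cancel₀ _ hp1.ne']; linarith) (by rw [le_div_iff₀ hp1]; nlinarith)
      (by rw [div_le_iff₀ hp1]; nlinarith) (n1 l l') (n2 l l') (n12_le l l') (by rw [n12_eq_zero]; exact h0)
    convert h1 using 2
    simp only [gl0, hl, hl', Bool.false_eq_true, if_false]
    rw [gl_mul, sum_phi2 h p (by omega) i0 hd l l' hl hl' h0]
    congr 1
    · congr 1
      field_simp
    · simp only [n1_eq_zero]
      split_ifs with hh
      · subst hh; exact n2_self l p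
      · rfl

theorem V1_bound (h : Fin k → ℤ) (p : ℕ) (hp : 2 ≤ p) (hd : DistP h p) (l l' : Fin k → Bool) (h0 : ¬ (l = zl ∧ l' = zl)) :
    gl p l * gl p l' * ∑ a ∈ range p, |phi1 h p l a * phi1 h p l' a| ≤ 3 * k + 3 := by
  have hpr : (2:ℝ) ≤ p := by exact_mod_cast hp
  rw [gl_mul, sum_abs_phi1 h p hp hd]
  have h1 := numeric_V (k := k) ((p:ℝ) - 1) (by linarith) (n1 l l') (n2 l l') (n12_le l l') (by rw [n12_eq_zero]; exact h0)
  convert h1 using 2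
  ring

theorem V2_bound (h : Fin k → ℤ) (i0 : Fin k) (p : ℕ) (hp : 2 ≤ p) (hd : DistP h p) (l l' : Fin k → Bool) (h0 : ¬ (l = zl ∧ l' = zl)) :
    gl0 i0 p l * gl0 i0 p l' * ∑ a ∈ range p, |phi2 h i0 p l a * phi2 h i0 p l' a| ≤ 3 * k + 3 := by
  refine le_trans ?_ (V1_bound h p hp hd l l' h0)
  have := gl0_nonneg p hp i0 l
  have := gl0_nonneg p hp i0 l'
  have := gl_nonneg p hp l
  have := gl_nonneg p hp l'
  have h5 := gl0_le p hp i0 l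
  have h6 := gl0_le p hp i0 l'
  refine mul_le_mul (mul_le_mul h5 h6 (by assumption) (by assumption)) (sum_le_sum fun a _ => ?_)
    (sum_nonneg fun _ _ => abs_nonneg _) (by positivity)
  rw [abs_mul, abs_mul]
  exact mul_le_mul (abs_phi2_le _ _ _ _ _) (abs_phi2_le _ _ _ _ _) (abs_nonneg _) (abs_nonneg _)

/-- size of an index -/
def RR {P : Finset ℕ} (A : P → Fin k → Bool) : ℕ := ∏ p : P, ∏ i, if A p i then (p:ℕ) else 1

theorem supp_le {P : Finset ℕ} (hP : ∀ p ∈ P, p.Prime) (A A' : P → Fin k → Bool) :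
    ∏ p ∈ supp2 zl A A', (p:ℕ) ≤ RR A * RR A' := by
  unfold RR
  rw [← prod_mul_distrib]
  have hge : ∀ p : P, ∀ l : Fin k → Bool, 1 ≤ ∏ i, if l i then (p:ℕ) else 1 := fun p l =>
    Finset.one_le_prod' fun i _ => by split_ifs; exacts [(hP p p.2).one_le, le_rfl]
  have hge2 : ∀ p : P, ∀ l : Fin k → Bool, l ≠ zl → (p:ℕ) ≤ ∏ i, if l i then (p:ℕ) else 1 := fun p l hl => by
    obtain ⟨i, hi⟩ := Function.ne_iff.mp hl
    have hi' : l i = true := by simpa [zl] using hi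
    have := Finset.single_le_prod' (f := fun i => if l i then (p:ℕ) else 1)
      (fun i _ => by split_ifs; exacts [(hP p p.2).one_le, le_rfl]) (mem_univ i)
    simpa [hi'] using this
  calc _ ≤ ∏ p ∈ supp2 zl A A', ((∏ i, if A p i then (p:ℕ) else 1) * ∏ i, if A' p i then (p:ℕ) else 1) := by
        refine prod_le_prod' fun p hp => ?_
        rw [supp2, mem_filter] at hp
        by_cases h1 : A p = zl
        · have h2 : A' p ≠ zl := fun h2 => hp.2 ⟨h1, h2⟩
          calc (p:ℕ) = 1 * p := by ring
            _ ≤ _ := Nat.mul_le_mul (hge _ _) (hge2 _ _ h2)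
        · calc (p:ℕ) = p * 1 := by ring
            _ ≤ _ := Nat.mul_le_mul (hge2 _ _ h1) (hge _ _)
    _ ≤ _ := Finset.prod_le_prod_of_subset_of_one_le' (subset_univ _) fun p _ _ => by
        calc 1 = 1 * 1 := by ring
          _ ≤ _ := Nat.mul_le_mul (hge _ _) (hge _ _)

def VV (P : Finset ℕ) (Y : ℕ) : Finset (Finset P) := univ.filter fun V => ∏ p ∈ V, (p:ℕ) ≤ Y

theorem count_mod (m m' : ℤ) (hm : m ≤ m') (q : ℕ) (hq : 0 < q) (a : ℤ) :
    |∑ n ∈ Ioc m m' with n ≡ a [ZMOD q], (1:ℝ) - (m' - m : ℝ) / q| ≤ 1 := by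
  have hq' : (0:ℤ) < q := by exact_mod_cast hq
  have hqr : (0:ℝ) < q := by exact_mod_cast hq
  have h := Int.Ioc_filter_modEq_card m m' hq' a
  rw [sum_const, nsmul_eq_mul, mul_one]
  have h2 : (((Ioc m m').filter (fun n => n ≡ a [ZMOD q])).card : ℝ) = ((max (⌊((m' - a : ℤ) : ℚ) / q⌋ - ⌊((m - a : ℤ) : ℚ) / q⌋) 0 : ℤ) : ℝ) := by
    have := congrArg (fun z : ℤ => (z:ℝ)) h
    simp only [Int.cast_natCast] at this
    rw [this]
    push_cast
    rfl
  rw [h2]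
  have hle : ⌊((m - a : ℤ) : ℚ) / q⌋ ≤ ⌊((m' - a : ℤ) : ℚ) / q⌋ := by
    apply Int.floor_le_floor
    gcongr
  rw [max_eq_left (by linarith)]
  have e1 := Int.floor_le (((m' - a : ℤ) : ℚ) / q)
  have e2 := Int.lt_floor_add_one (((m' - a : ℤ) : ℚ) / q)
  have e3 := Int.floor_le (((m - a : ℤ) : ℚ) / q)
  have e4 := Int.lt_floor_add_one (((m - a : ℤ) : ℚ) / q)
  set f1 := ⌊((m' - a : ℤ) : ℚ) / q⌋
  set f2 := ⌊((m - a : ℤ) : ℚ) / q⌋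
  have c1 : (f1:ℝ) ≤ ((m':ℝ) - a) / q := by exact_mod_cast e1
  have c2 : ((m':ℝ) - a) / q < f1 + 1 := by exact_mod_cast e2
  have c3 : (f2:ℝ) ≤ ((m:ℝ) - a) / q := by exact_mod_cast e3
  have c4 : ((m:ℝ) - a) / q < f2 + 1 := by exact_mod_cast e4
  have : ((m':ℝ) - m) / q = ((m':ℝ) - a) / q - ((m:ℝ) - a) / q := by ring
  rw [this]; push_cast
  rw [abs_le]; constructor <;> linarith

def TT (k : ℕ) (P : Finset ℕ) : ℝ := (∏ p ∈ P, (1 + 1 / ((p:ℝ) - 1))) ^ k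
def BB (k : ℕ) (P : Finset ℕ) : ℝ := Real.exp (∑ p ∈ P, Ck k / ((p:ℝ) - 1) ^ 2) - 1

theorem BB_nonneg (k : ℕ) (P : Finset ℕ) : 0 ≤ BB k P := by
  unfold BB
  have : 0 ≤ ∑ p ∈ P, Ck k / ((p:ℝ) - 1) ^ 2 := sum_nonneg fun p _ => div_nonneg (Ck_pos k).le (sq_nonneg _)
  linarith [Real.one_le_exp this]

theorem sieve_S1 (h : Fin k → ℤ) (P : Finset ℕ) (hP : ∀ p ∈ P, p.Prime) (hd : ∀ p ∈ P, DistP h p)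
    (W : ℕ) (hW : 0 < W) (hWp : ∀ p ∈ P, W.Coprime p) (b m m' : ℤ) (hm : m ≤ m')
    (u : (P → Fin k → Bool) → ℝ) (U : ℝ) (hU : ∀ A, |u A| ≤ U) (Y : ℕ) (hY : ∀ A, u A ≠ 0 → RR A ≤ Y) :
    |∑ n ∈ Ioc m m', ind W b n * (∑ A, u A * ∏ p : P, (gl p (A p) * phi1 h p (A p) n)) ^ 2
        - ((m' - m : ℝ) / W) * ∑ A, u A ^ 2 * ∏ p : P, gl p (A p)|
      ≤ ((m' - m : ℝ) / W) * (U ^ 2 * (TT k P * BB k P))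
        + U ^ 2 * ∑ V ∈ VV P (Y * Y), Ck k ^ V.card := by
  have hp2 : ∀ p : P, 2 ≤ (p:ℕ) := fun p => (hP p p.2).two_le
  have hmr : (m:ℝ) ≤ m' := by exact_mod_cast hm
  have key := abs_sieve (ι := P) (L := Fin k → Bool) zl (Ioc m m') (fun n => 1 * ind W b n) (fun p l n => phi1 h p l n)
    (fun p l => gl p l) (fun p l => gl_nonneg p (hp2 p) l) (fun p => sum_gl_ge p (hp2 p))
    (fun p => G1 h p) (fun p => Ck k / ((p:ℝ) - 1) ^ 2) (fun p => G1_bound h p (hp2 p) (hd p p.2)) u U hU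
    ((m' - m : ℝ) / W) (div_nonneg (by linarith) (by positivity)) (3 * k + 3) (by positivity) (fun _ => 1) (fun _ => zero_le_one)
    (VV P (Y * Y)) (fun A A' hA hA' => by
      rw [VV, mem_filter]
      exact ⟨mem_univ _, (supp_le hP A A').trans (Nat.mul_le_mul (hY A hA) (hY A' hA'))⟩)
    (fun A A' hA hA' => by
      refine hd_general (ι := P) zl W hW b (fun p => (p:ℕ)) (fun p => by have := hp2 p; omega) (fun p => hWp p p.2)
        (fun p p' hne => (Nat.coprime_primes (hP p p.2) (hP p' p'.2)).mpr (fun hh => hne (Subtype.ext hh)))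
        (Ioc m m') (fun _ => 1) (fun n => n) (fun p l n => phi1 h p l n) (fun p l => phi1_per h p l)
        (fun p n => phi1_zl h p n) (fun p l => gl p l) (fun p => gl_zl p) (fun p l => gl_nonneg p (hp2 p) l)
        (fun p => (p:ℝ)) (3 * k + 3) (fun p => G1 h p) (fun p => ?_) (fun p l l' _ => rfl)
        (fun p l l' h0 => V1_bound h p (hp2 p) (hd p p.2) l l' h0) ((m' - m : ℝ) / W) 1 zero_le_one A A' ?_
      · have : ((p:ℕ):ℝ) ≠ 0 := by have := hp2 p; positivity
        simp [G1, gl_zl, phi1_zl, this]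
      · intro a _ _
        have := count_mod m m' hm (W * ∏ p ∈ supp2 zl A A', (p:ℕ))
          (Nat.mul_pos hW (prod_pos fun p _ => by have := hp2 p; omega)) a
        push_cast at this ⊢
        rw [div_div]
        exact this)
  have hprod : ∏ p : P, ∑ l : Fin k → Bool, gl p l = TT k P := by
    simp_rw [sum_gl]
    rw [TT, prod_pow, ← prod_coe_sort P (fun p => 1 + 1 / ((p:ℝ) - 1))]
  have hsum : ∑ p : P, Ck k / (((p:ℕ):ℝ) - 1) ^ 2 = ∑ p ∈ P, Ck k / ((p:ℝ) - 1) ^ 2 :=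
    sum_coe_sort P (fun p => Ck k / ((p:ℝ) - 1) ^ 2)
  have hcard : (Fintype.card (Fin k → Bool) : ℝ) ^ 2 * (3 * k + 3) = Ck k := by
    unfold Ck
    simp only [Fintype.card_pi_const, Fintype.card_bool, Nat.cast_pow, Nat.cast_ofNat]
    rw [← pow_mul, mul_comm k 2, pow_mul]; norm_num
  rw [hprod, hsum, hcard] at key
  simp only [one_mul] at key
  exact key

theorem sieve_S2 (h : Fin k → ℤ) (i0 : Fin k) (P : Finset ℕ) (hP : ∀ p ∈ P, p.Prime) (hd : ∀ p ∈ P, DistP h p)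
    (W : ℕ) (hW : 0 < W) (hWp : ∀ p ∈ P, W.Coprime p) (b : ℤ) (S : Finset ℕ) (μ : ℕ → ℝ) (X : ℝ) (hX : 0 ≤ X)
    (u : (P → Fin k → Bool) → ℝ) (U : ℝ) (hU : ∀ A, |u A| ≤ U) (Y : ℕ) (hY : ∀ A, u A ≠ 0 → RR A ≤ Y)
    (Err : Finset P → ℝ) (hErr : ∀ V, 0 ≤ Err V)
    (hE : ∀ V ∈ VV P (Y * Y), ∀ a : ℕ, a ≡ b [ZMOD W] → (∀ p ∈ V, ¬ ((p:ℕ):ℤ) ∣ a + h i0) →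
      |∑ N ∈ S with ((N:ℕ):ℤ) - h i0 ≡ a [ZMOD (W * ∏ p ∈ V, (p:ℕ) : ℕ)], μ N - X / ∏ p ∈ V, (((p:ℕ):ℝ) - 1)| ≤ Err V) :
    |∑ N ∈ S, (μ N * ind W b (N - h i0)) * (∑ A, u A * ∏ p : P, (gl0 i0 p (A p) * phi2 h i0 p (A p) (N - h i0))) ^ 2
        - X * ∑ A, u A ^ 2 * ∏ p : P, gl0 i0 p (A p)|
      ≤ X * (U ^ 2 * (TT (k - 1) P * BB k P))
        + U ^ 2 * ∑ V ∈ VV P (Y * Y), Err V * Ck k ^ V.card := by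
  have hp2 : ∀ p : P, 2 ≤ (p:ℕ) := fun p => (hP p p.2).two_le
  have hmem : ∀ A A', u A ≠ 0 → u A' ≠ 0 → supp2 zl A A' ∈ VV P (Y * Y) := fun A A' hA hA' => by
      rw [VV, mem_filter]
      exact ⟨mem_univ _, (supp_le hP A A').trans (Nat.mul_le_mul (hY A hA) (hY A' hA'))⟩
  have key := abs_sieve (ι := P) (L := Fin k → Bool) zl S (fun N => μ N * ind W b (N - h i0)) (fun p l N => phi2 h i0 p l (N - h i0))
    (fun p l => gl0 i0 p l) (fun p l => gl0_nonneg p (hp2 p) i0 l) (fun p => sum_gl0_ge p (hp2 p) i0)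
    (fun p => G2 h i0 p) (fun p => Ck k / ((p:ℝ) - 1) ^ 2) (fun p => G2_bound h i0 p (hp2 p) (hd p p.2)) u U hU
    X hX (3 * k + 3) (by positivity) Err hErr
    (VV P (Y * Y)) hmem
    (fun A A' hA hA' => by
      refine hd_general (ι := P) zl W hW b (fun p => (p:ℕ)) (fun p => by have := hp2 p; omega) (fun p => hWp p p.2)
        (fun p p' hne => (Nat.coprime_primes (hP p p.2) (hP p' p'.2)).mpr (fun hh => hne (Subtype.ext hh)))
        S μ (fun N => (N:ℤ) - h i0) (fun p l n => phi2 h i0 p l n) (fun p l => phi2_per h i0 p l)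
        (fun p n => phi2_zl h i0 p n) (fun p l => gl0 i0 p l) (fun p => gl0_zl p i0) (fun p l => gl0_nonneg p (hp2 p) i0 l)
        (fun p => (p:ℝ) - 1) (3 * k + 3) (fun p => G2 h i0 p) (fun p => ?_) (fun p l l' h0 => ?_)
        (fun p l l' h0 => V2_bound h i0 p (hp2 p) (hd p p.2) l l' h0) X (Err _) (hErr _) A A' ?_
      · simp [G2]
      · simp only [G2]; rw [if_neg h0]
      · intro a ha hnz
        refine hE _ (hmem A A' hA hA') a ha fun p hp hdvd => hnz p hp ?_
        rw [supp2, mem_filter] at hp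
        unfold phi2
        by_cases h1 : A p = zl
        · have h2 : A' p ≠ zl := fun h2 => hp.2 ⟨h1, h2⟩
          simp [h1, h2, hdvd]
        · simp [h1, hdvd])
  have hprod : ∏ p : P, ∑ l : Fin k → Bool, gl0 i0 p l ≤ TT (k - 1) P := by
    rw [TT, ← prod_pow, ← prod_coe_sort P (fun p => (1 + 1 / ((p:ℝ) - 1)) ^ (k - 1))]
    refine prod_le_prod (fun p _ => sum_nonneg fun l _ => gl0_nonneg p (hp2 p) i0 l) fun p _ => ?_
    rw [← sum_gl0 (p:ℕ) i0]
  have hsum : ∑ p : P, Ck k / (((p:ℕ):ℝ) - 1) ^ 2 = ∑ p ∈ P, Ck k / ((p:ℝ) - 1) ^ 2 :=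
    sum_coe_sort P (fun p => Ck k / ((p:ℝ) - 1) ^ 2)
  have hcard : (Fintype.card (Fin k → Bool) : ℝ) ^ 2 * (3 * k + 3) = Ck k := by
    unfold Ck
    simp only [Fintype.card_pi_const, Fintype.card_bool, Nat.cast_pow, Nat.cast_ofNat]
    rw [← pow_mul, mul_comm k 2, pow_mul]; norm_num
  rw [hsum, hcard] at key
  refine key.trans ?_
  have := BB_nonneg k P
  unfold BB at this
  unfold BB
  gcongr

end
end MT

end

section

set_option linter.unusedSectionVars false
namespace MT
open Finset

noncomputable section
variable {k : ℕ} {P : Finset ℕ}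

def gB (b : P → Bool) : ℝ := ∏ p : P, if b p then 1 / (((p:ℕ):ℝ) - 1) else 1
def rB (b : P → Bool) : ℕ := ∏ p : P, if b p then (p:ℕ) else 1
def SP (P : Finset ℕ) (ℓ : ℝ) (j : ℕ) : ℝ :=
  ∑ U ∈ P.powerset.filter (fun U => cellOf ℓ (∏ p ∈ U, p) = j), gU U
/-- transposition -/
def tr (A : P → Fin k → Bool) : Fin k → P → Bool := fun i p => A p i
def cellA (ℓ : ℝ) (A : P → Fin k → Bool) : Fin k → ℕ := fun i => cellOf ℓ (rB (tr A i))

theorem SP_eq (ℓ : ℝ) (j : ℕ) :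
    SP P ℓ j = ∑ b : P → Bool with cellOf ℓ (rB b) = j, gB b := by
  unfold SP
  have hset : ∀ U ∈ P.powerset, ∀ {M : Type} [CommMonoid M] (f : ℕ → M),
      (∏ p : P, if decide ((p:ℕ) ∈ U) = true then f p else 1) = ∏ p ∈ U, f p := by
    intro U hU M _ f
    rw [mem_powerset] at hU
    rw [prod_coe_sort P (fun p => if decide (p ∈ U) = true then f p else 1)]
    simp only [decide_eq_true_eq]
    rw [prod_ite_mem, inter_eq_right.mpr hU]
  refine sum_bij' (fun U _ => fun p : P => decide ((p:ℕ) ∈ U))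
    (fun b _ => (univ.filter fun p => b p = true).map (Function.Embedding.subtype _)) ?_ ?_ ?_ ?_ ?_
  · intro U hU
    rw [mem_filter] at hU
    rw [mem_filter]
    refine ⟨mem_univ _, ?_⟩
    rw [← hU.2, rB, hset U hU.1 (fun p => p)]
  · intro b hb
    rw [mem_filter] at hb
    rw [mem_filter, mem_powerset]
    refine ⟨?_, ?_⟩
    · intro p hp
      rw [Finset.mem_map] at hp
      obtain ⟨q, _, rfl⟩ := hp
      exact q.2
    · rw [← hb.2, rB, prod_map, prod_filter]
      rfl
  · intro U hU
    rw [mem_filter, mem_powerset] at hU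
    ext p
    simp only [Finset.mem_map, mem_filter, mem_univ, true_and, decide_eq_true_eq, Function.Embedding.subtype_apply, Subtype.exists,
      exists_and_left, exists_prop, exists_eq_right_right]
    exact ⟨fun h => h.1, fun h => ⟨h, hU.1 h⟩⟩
  · intro b _
    funext p
    simp [Finset.mem_map]
  · intro U hU
    rw [mem_filter] at hU
    rw [gU, gB, hset U hU.1 (fun p => 1 / ((p:ℝ) - 1))]

theorem gl_prod_tr (A : P → Fin k → Bool) : ∏ p : P, gl (p:ℕ) (A p) = ∏ i, gB (tr A i) := by
  unfold gl gB tr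
  rw [Finset.prod_comm]

theorem main_gen (ℓ : ℝ) (K : ℕ) (t : Fin k → Finset (P → Bool)) (Ψ : (Fin k → ℕ) → ℝ)
    (hΨ : ∀ j, Ψ j ≠ 0 → ∀ i, j i < K) :
    ∑ B ∈ Fintype.piFinset t, Ψ (fun i => cellOf ℓ (rB (B i))) * ∏ i, gB (B i)
      = ∑ j ∈ Fintype.piFinset (fun _ : Fin k => range K), Ψ j * ∏ i, ∑ b ∈ t i with cellOf ℓ (rB b) = j i, gB b := by
  have h1 : ∀ j : Fin k → ℕ, ∏ i, ∑ b ∈ t i with cellOf ℓ (rB b) = j i, gB b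
      = ∑ B ∈ Fintype.piFinset t with (fun i => cellOf ℓ (rB (B i))) = j, ∏ i, gB (B i) := by
    intro j
    rw [prod_univ_sum]
    refine sum_congr ?_ fun _ _ => rfl
    ext B
    simp only [Fintype.mem_piFinset, mem_filter, funext_iff]
    exact forall_and
  simp_rw [h1, mul_sum]
  have h2 : ∀ j, ∑ B ∈ Fintype.piFinset t with (fun i => cellOf ℓ (rB (B i))) = j, Ψ j * ∏ i, gB (B i)
      = ∑ B ∈ Fintype.piFinset t with (fun i => cellOf ℓ (rB (B i))) = j, Ψ (fun i => cellOf ℓ (rB (B i))) * ∏ i, gB (B i) := by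
    intro j
    refine sum_congr rfl fun B hB => ?_
    rw [(mem_filter.mp hB).2]
  simp_rw [h2]
  rw [← sum_filter_add_sum_filter_not (Fintype.piFinset t) (fun B => (fun i => cellOf ℓ (rB (B i))) ∈ Fintype.piFinset (fun _ : Fin k => range K))]
  rw [sum_eq_zero (s := (Fintype.piFinset t).filter fun B => ¬ (fun i => cellOf ℓ (rB (B i))) ∈ Fintype.piFinset (fun _ : Fin k => range K)), add_zero]
  · rw [← sum_fiberwise_of_maps_to (t := Fintype.piFinset (fun _ : Fin k => range K)) (g := fun (B : Fin k → P → Bool) (i : Fin k) => cellOf ℓ (rB (B i)))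
      (fun B hB => (mem_filter.mp hB).2)]
    refine sum_congr rfl fun j hj => sum_congr ?_ fun _ _ => rfl
    ext B
    simp only [mem_filter]
    constructor
    · rintro ⟨⟨h, _⟩, h3⟩; exact ⟨h, h3⟩
    · rintro ⟨h, h3⟩; exact ⟨⟨h, h3 ▸ hj⟩, h3⟩
  · intro B hB
    have := (mem_filter.mp hB).2
    by_cases h0 : Ψ (fun i => cellOf ℓ (rB (B i))) = 0
    · rw [h0, zero_mul]
    · exfalso; apply this
      rw [Fintype.mem_piFinset]
      intro i; rw [mem_range]; exact hΨ _ h0 i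

theorem sum_tr (f : (Fin k → P → Bool) → ℝ) : ∑ A : P → Fin k → Bool, f (tr A) = ∑ B : Fin k → P → Bool, f B := by
  refine Fintype.sum_equiv ⟨tr, fun B p i => B i p, fun _ => rfl, fun _ => rfl⟩ _ _ fun _ => rfl

theorem main_one (ℓ : ℝ) (K : ℕ) (Ψ : (Fin k → ℕ) → ℝ) (hΨ : ∀ j, Ψ j ≠ 0 → ∀ i, j i < K) :
    ∑ A : P → Fin k → Bool, Ψ (cellA ℓ A) * ∏ p : P, gl (p:ℕ) (A p)
      = ∑ j ∈ Fintype.piFinset (fun _ : Fin k => range K), Ψ j * ∏ i, SP P ℓ (j i) := by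
  simp_rw [gl_prod_tr]
  have := main_gen (P := P) ℓ K (fun _ : Fin k => univ) Ψ hΨ
  rw [Fintype.piFinset_univ] at this
  simp_rw [SP_eq]
  rw [← this]
  exact sum_tr (fun B => Ψ (fun i => cellOf ℓ (rB (B i))) * ∏ i, gB (B i))

/-- index vanishing in coordinate i0 -/
def Z0 (i0 : Fin k) (A : P → Fin k → Bool) : Prop := ∀ p, A p i0 = false

instance (i0 : Fin k) (A : P → Fin k → Bool) : Decidable (Z0 i0 A) := by unfold Z0; infer_instance

theorem gl0_prod (i0 : Fin k) (A : P → Fin k → Bool) :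
    ∏ p : P, gl0 i0 (p:ℕ) (A p) = if Z0 i0 A then ∏ p : P, gl (p:ℕ) (A p) else 0 := by
  split_ifs with h
  · refine prod_congr rfl fun p _ => ?_
    simp [gl0, h p]
  · unfold Z0 at h
    push Not at h
    obtain ⟨p, hp⟩ := h
    refine prod_eq_zero (mem_univ p) ?_
    simp only [ne_eq, Bool.not_eq_false] at hp
    simp [gl0, hp]

theorem cellOf_one (ℓ : ℝ) : cellOf ℓ 1 = 0 := by simp [cellOf]

theorem main_two (ℓ : ℝ) (K : ℕ) (i0 : Fin k) (Ψ : (Fin k → ℕ) → ℝ) (hΨ : ∀ j, j i0 = 0 → Ψ j ≠ 0 → ∀ i, j i < K) :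
    ∑ A : P → Fin k → Bool, Ψ (cellA ℓ A) * ∏ p : P, gl0 i0 (p:ℕ) (A p)
      = ∑ j ∈ Fintype.piFinset (fun _ : Fin k => range K) with j i0 = 0, Ψ j * ∏ i ∈ univ.erase i0, SP P ℓ (j i) := by
  simp_rw [gl0_prod, gl_prod_tr]
  set zb : P → Bool := fun _ => false with hzb
  have hr : rB zb = 1 := by simp [rB, hzb]
  have hg : gB zb = 1 := by simp [gB, hzb]
  set t : Fin k → Finset (P → Bool) := fun i => if i = i0 then {zb} else univ with ht
  have := main_gen (P := P) ℓ K t (fun j => if j i0 = 0 then Ψ j else 0) (fun j hj i => by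
    by_cases h0 : j i0 = 0
    · rw [if_pos h0] at hj; exact hΨ j h0 hj i
    · rw [if_neg h0] at hj; exact absurd rfl hj)
  have hL : ∑ A : P → Fin k → Bool, Ψ (cellA ℓ A) * (if Z0 i0 A then ∏ i, gB (tr A i) else 0)
      = ∑ B ∈ Fintype.piFinset t, (fun j => if j i0 = 0 then Ψ j else 0) (fun i => cellOf ℓ (rB (B i))) * ∏ i, gB (B i) := by
    have e1 : ∀ A : P → Fin k → Bool, (Z0 i0 A ↔ tr A i0 = zb) := by
      intro A; unfold Z0 tr; rw [funext_iff]
    have e0 : ∀ A : P → Fin k → Bool, cellA ℓ A = fun i => cellOf ℓ (rB (tr A i)) := fun _ => rfl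
    simp_rw [e1, e0]
    rw [sum_tr (fun B => Ψ (fun i => cellOf ℓ (rB (B i))) * (if B i0 = zb then ∏ i, gB (B i) else 0))]
    simp_rw [mul_ite, mul_zero]
    rw [← sum_filter]
    have e2 : (univ.filter fun B : Fin k → P → Bool => B i0 = zb) = Fintype.piFinset t := by
      ext B
      simp only [mem_filter, mem_univ, true_and, Fintype.mem_piFinset, ht]
      constructor
      · intro h i; split_ifs with hi
        · subst hi; simp [h]
        · simp
      · intro h; simpa using h i0
    rw [e2]
    refine sum_congr rfl fun B hB => ?_
    rw [← e2, mem_filter] at hB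
    simp only [hB.2, hr, cellOf_one, if_true]
  rw [hL, this, sum_filter]
  refine sum_congr rfl fun j _ => ?_
  split_ifs with hj
  · congr 1
    rw [← mul_prod_erase univ _ (mem_univ i0)]
    have : ∑ b ∈ t i0 with cellOf ℓ (rB b) = j i0, gB b = 1 := by
      simp only [ht, if_true]
      rw [filter_singleton, hr, cellOf_one, hj, if_pos rfl, sum_singleton, hg]
    rw [this, one_mul]
    refine prod_congr rfl fun i hi => ?_
    rw [SP_eq]
    simp [ht, ne_of_mem_erase hi]
  · simp

def bw (ℓ : ℝ) (K : ℕ) (P : Finset ℕ) (c : (Fin k → ℕ) → ℝ) (i0 : Fin k) (j : Fin k → ℕ) : ℝ :=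
  ∑ t ∈ range K, SP P ℓ t * c (Function.update j i0 t)

theorem sum_gB (ℓ : ℝ) (K : ℕ) (Θ : ℕ → ℝ) (hΘ : ∀ t, Θ t ≠ 0 → t < K) :
    ∑ b : P → Bool, gB b * Θ (cellOf ℓ (rB b)) = ∑ t ∈ range K, SP P ℓ t * Θ t := by
  simp_rw [SP_eq, sum_mul]
  have h2 : ∀ t, ∑ b : P → Bool with cellOf ℓ (rB b) = t, gB b * Θ t
      = ∑ b : P → Bool with cellOf ℓ (rB b) = t, gB b * Θ (cellOf ℓ (rB b)) := by
    intro j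
    refine sum_congr rfl fun B hB => ?_
    rw [(mem_filter.mp hB).2]
  simp_rw [h2]
  rw [← sum_filter_add_sum_filter_not univ (fun b : P → Bool => cellOf ℓ (rB b) ∈ range K)]
  rw [sum_eq_zero (s := univ.filter fun b : P → Bool => ¬ cellOf ℓ (rB b) ∈ range K), add_zero]
  · rw [← sum_fiberwise_of_maps_to (t := range K) (g := fun b => cellOf ℓ (rB b)) (fun B hB => (mem_filter.mp hB).2)]
    refine sum_congr rfl fun j hj => sum_congr ?_ fun _ _ => rfl
    ext B
    simp only [mem_filter, mem_univ, true_and]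
    constructor
    · rintro ⟨_, h3⟩; exact h3
    · rintro h3; exact ⟨h3 ▸ hj, h3⟩
  · intro b hb
    have := (mem_filter.mp hb).2
    by_cases h0 : Θ (cellOf ℓ (rB b)) = 0
    · rw [h0, mul_zero]
    · exact absurd (mem_range.mpr (hΘ _ h0)) this

theorem phi2_eq_phi1 (h : Fin k → ℤ) (i0 : Fin k) (p : ℕ) (l : Fin k → Bool) (n : ℤ) (hi : ¬ (p:ℤ) ∣ n + h i0) :
    phi2 h i0 p l n = phi1 h p l n := by
  unfold phi2
  split_ifs with h1
  · rw [h1, phi1_zl]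
  · rfl

def setc (i0 : Fin k) (A : P → Fin k → Bool) (b : P → Bool) : P → Fin k → Bool := fun p => Function.update (A p) i0 (b p)

theorem weight_reduce (h : Fin k → ℤ) (i0 : Fin k) (ℓ : ℝ) (K : ℕ) (c : (Fin k → ℕ) → ℝ)
    (hc : ∀ j, c j ≠ 0 → ∀ i, j i < K) (n : ℤ) (hn : ∀ p ∈ P, ¬ (p:ℤ) ∣ n + h i0) :
    ∑ A : P → Fin k → Bool, c (cellA ℓ A) * ∏ p : P, (gl (p:ℕ) (A p) * phi1 h p (A p) n)
      = ∑ A : P → Fin k → Bool, (if Z0 i0 A then bw ℓ K P c i0 (cellA ℓ A) else 0) * ∏ p : P, (gl0 i0 (p:ℕ) (A p) * phi2 h i0 p (A p) n) := by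
  have hR : ∀ A : P → Fin k → Bool, (if Z0 i0 A then bw ℓ K P c i0 (cellA ℓ A) else 0) * ∏ p : P, (gl0 i0 (p:ℕ) (A p) * phi2 h i0 p (A p) n)
      = if Z0 i0 A then bw ℓ K P c i0 (cellA ℓ A) * ∏ p : P, (gl (p:ℕ) (A p) * phi1 h p (A p) n) else 0 := by
    intro A
    split_ifs with hA
    · congr 1
      refine prod_congr rfl fun p _ => ?_
      rw [phi2_eq_phi1 h i0 p _ n (hn p p.2)]
      simp [gl0, hA p]
    · rw [zero_mul]
  simp_rw [hR]
  rw [← sum_filter]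
  rw [← sum_fiberwise_of_maps_to (t := univ.filter fun A : P → Fin k → Bool => Z0 i0 A) (g := fun A => setc i0 A (fun _ => false))
    (fun A _ => by
      rw [mem_filter]; refine ⟨mem_univ _, fun p => ?_⟩
      simp [setc])]
  refine sum_congr rfl fun A0 hA0 => ?_
  have hz := (mem_filter.mp hA0).2
  have hbw : bw ℓ K P c i0 (cellA ℓ A0) = ∑ b : P → Bool, gB b * c (Function.update (cellA ℓ A0) i0 (cellOf ℓ (rB b))) := by
    unfold bw
    rw [sum_gB ℓ K (fun t => c (Function.update (cellA ℓ A0) i0 t)) (fun t ht => by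
      have := hc _ ht i0; simpa using this)]
  rw [hbw, sum_mul]
  refine sum_bij' (fun A _ => fun p => A p i0) (fun b _ => setc i0 A0 b) ?_ ?_ ?_ ?_ ?_
  · intro A _; exact mem_univ _
  · intro b _
    rw [mem_filter]
    refine ⟨mem_univ _, ?_⟩
    funext p
    simp only [setc, Function.update_idem]
    rw [← hz p, Function.update_eq_self]
  · intro A hA
    have := (mem_filter.mp hA).2
    funext p
    rw [← this]
    simp [setc]
  · intro b _
    funext p; simp [setc]
  · intro A hA
    have hA' := (mem_filter.mp hA).2
    have hcell : cellA ℓ A = Function.update (cellA ℓ A0) i0 (cellOf ℓ (rB fun p => A p i0)) := by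
      funext i
      by_cases hi : i = i0
      · subst hi; simp [cellA, tr]; rfl
      · rw [Function.update_of_ne hi, ← hA']
        unfold cellA tr setc
        simp [hi]
    rw [hcell]
    rw [mul_comm (gB _), mul_assoc]
    congr 1
    unfold gB
    rw [← prod_mul_distrib]
    refine prod_congr rfl fun p _ => ?_
    have hp1 : A0 p = Function.update (A p) i0 false := by rw [← hA']; rfl
    have e1 : gl (p:ℕ) (A p) = (if A p i0 then 1 / (((p:ℕ):ℝ) - 1) else 1) * gl (p:ℕ) (A0 p) := by
      unfold gl
      rw [← mul_prod_erase univ _ (mem_univ i0), ← mul_prod_erase univ (fun i => if A0 p i then 1 / (((p:ℕ):ℝ) - 1) else 1) (mem_univ i0)]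
      rw [hz p]
      simp only [Bool.false_eq_true, if_false, one_mul]
      congr 1
      refine prod_congr rfl fun i hi => ?_
      rw [hp1, Function.update_of_ne (ne_of_mem_erase hi)]
    have e2 : phi1 h p (A p) n = phi1 h p (A0 p) n := by
      unfold phi1
      refine prod_congr rfl fun i _ => ?_
      by_cases hi : i = i0
      · subst hi
        simp [chi, hn p p.2]
      · rw [hp1, Function.update_of_ne hi]
    rw [e1, e2]; ring

theorem RR_eq (A : P → Fin k → Bool) : RR A = ∏ i, rB (tr A i) := by
  unfold RR rB tr
  rw [Finset.prod_comm]

theorem rB_pos (hP : ∀ p ∈ P, p.Prime) (b : P → Bool) : 0 < rB b := by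
  unfold rB
  refine prod_pos fun p _ => ?_
  split_ifs; exacts [(hP p p.2).pos, one_pos]

theorem rB_le_exp {ℓ : ℝ} (hℓ : 0 < ℓ) (hP : ∀ p ∈ P, p.Prime) (b : P → Bool) :
    (rB b : ℝ) ≤ Real.exp ((cellOf ℓ (rB b) + 1) * ℓ) := by
  have hpos : (0:ℝ) < rB b := by exact_mod_cast rB_pos hP b
  rw [← Real.log_le_iff_le_exp hpos, ← div_le_iff₀ hℓ]
  exact (Nat.lt_floor_add_one _).le

theorem RR_le {ℓ : ℝ} (hℓ : 0 < ℓ) (hP : ∀ p ∈ P, p.Prime) (K : ℕ) (A : P → Fin k → Bool) (hK : ∑ i, cellA ℓ A i + k ≤ K)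
    (Y : ℕ) (hY : Real.exp (K * ℓ) ≤ Y) : RR A ≤ Y := by
  have : (RR A : ℝ) ≤ Y := by
    rw [RR_eq]; push_cast
    refine le_trans ?_ hY
    calc _ ≤ ∏ i, Real.exp ((cellA ℓ A i + 1) * ℓ) := prod_le_prod (fun _ _ => by positivity) fun i _ => rB_le_exp hℓ hP _
      _ = Real.exp (∑ i, ((cellA ℓ A i : ℝ) + 1) * ℓ) := (Real.exp_sum _ _).symm
      _ ≤ _ := by
        rw [← sum_mul]
        apply Real.exp_le_exp.mpr
        apply mul_le_mul_of_nonneg_right _ hℓ.le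
        rw [sum_add_distrib]
        simp only [sum_const, card_univ, Fintype.card_fin, nsmul_eq_mul, mul_one]
        exact_mod_cast hK
  exact_mod_cast this

theorem RR_le2 {ℓ : ℝ} (hℓ : 0 < ℓ) (hP : ∀ p ∈ P, p.Prime) (K : ℕ) (c : (Fin k → ℕ) → ℝ)
    (hc : ∀ j, c j ≠ 0 → ∑ i, j i + k ≤ K) (i0 : Fin k) (A : P → Fin k → Bool)
    (hA : (if Z0 i0 A then bw ℓ K P c i0 (cellA ℓ A) else 0) ≠ 0)
    (Y : ℕ) (hY : Real.exp (K * ℓ) ≤ Y) : RR A ≤ Y := by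
  by_cases hz : Z0 i0 A
  · rw [if_pos hz, bw] at hA
    obtain ⟨t, _, ht⟩ := exists_ne_zero_of_sum_ne_zero hA
    have h1 := hc _ (right_ne_zero_of_mul ht)
    refine RR_le hℓ hP K A (le_trans ?_ h1) Y hY
    gcongr with i
    by_cases hi : i = i0
    · subst hi
      have : rB (tr A i) = 1 := by
        unfold rB tr
        refine prod_eq_one fun p _ => ?_
        simp [hz p]
      simp [cellA, this, cellOf_one]
    · rw [Function.update_of_ne hi]
  · rw [if_neg hz] at hA; exact absurd rfl hA

end
end MT

end

section

set_option linter.unusedSectionVars false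
namespace MT
open Finset

noncomputable section
variable {k : ℕ}

theorem totient_prod (S : Finset ℕ) (hS : ∀ p ∈ S, p.Prime) :
    (Nat.totient (∏ p ∈ S, p) : ℝ) = ∏ p ∈ S, ((p:ℝ) - 1) := by
  induction S using Finset.induction_on with
  | empty => simp
  | insert a S ha ih =>
    rw [prod_insert ha, prod_insert ha, Nat.totient_mul, Nat.cast_mul, ih fun p hp => hS p (mem_insert_of_mem hp)]
    · congr 1
      have := hS a (mem_insert_self _ _)
      rw [Nat.totient_prime this, Nat.cast_sub this.one_le, Nat.cast_one]
    · refine Nat.Coprime.prod_right fun p hp => ?_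
      rw [Nat.coprime_primes (hS a (mem_insert_self _ _)) (hS p (mem_insert_of_mem hp))]
      rintro rfl; exact ha hp

/-- the Euler product over `P` -/
def EP (P : Finset ℕ) : ℝ := ∏ p ∈ P, (1 + 1 / ((p:ℝ) - 1))

theorem TT_eq (P : Finset ℕ) : TT k P = EP P ^ k := rfl

theorem EP_one_le (P : Finset ℕ) (hP : ∀ p ∈ P, p.Prime) : 1 ≤ EP P := by
  unfold EP
  refine le_of_eq_of_le (prod_const_one (s := P)).symm (prod_le_prod (fun _ _ => zero_le_one) fun p hp => ?_)
  have : (0:ℝ) < (p:ℝ) - 1 := prime_sub_one_pos (hP p hp)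
  have : 0 < 1 / ((p:ℝ) - 1) := by positivity
  linarith

theorem dens_primorial (D : ℕ) : dens (primorial D) * ∏ p ∈ Nat.primesLE D, (1 + 1 / ((p:ℝ) - 1)) = 1 := by
  have e : primorial D = ∏ p ∈ Nat.primesLE D, p := by
    rw [primorial]; rfl
  unfold dens
  rw [e, totient_prod _ fun p hp => (Nat.mem_primesLE.mp hp).2]
  push_cast
  rw [← prod_div_distrib, ← prod_mul_distrib]
  refine prod_eq_one fun p hp => ?_
  have h1 : (0:ℝ) < (p:ℝ) - 1 := prime_sub_one_pos (Nat.mem_primesLE.mp hp).2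
  have h2 : (0:ℝ) < p := by linarith
  field_simp
  ring

theorem dens_le_one (W : ℕ) : dens W ≤ 1 := by
  unfold dens
  refine div_le_one_of_le₀ ?_ (Nat.cast_nonneg _)
  exact_mod_cast Nat.totient_le W

theorem EP_le : ∃ C : ℝ, 1 ≤ C ∧ ∀ D Y : ℕ, D ≤ Y → 2 ≤ Y → EP (PS D Y) ≤ C * (dens (primorial D) * Real.log Y) := by
  obtain ⟨C, hC, h⟩ := mertens_three
  refine ⟨max C 1, le_max_right _ _, fun D Y hDY hY => ?_⟩
  have h1 : ∏ p ∈ Nat.primesLE Y, (1 + 1 / ((p:ℝ) - 1)) = (∏ p ∈ Nat.primesLE D, (1 + 1 / ((p:ℝ) - 1))) * EP (PS D Y) := by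
    unfold EP
    rw [← prod_union]
    · refine prod_congr ?_ fun _ _ => rfl
      ext p
      simp only [mem_union, Nat.mem_primesLE, mem_PS]
      constructor
      · rintro ⟨h1, h2⟩
        by_cases h3 : p ≤ D
        · exact Or.inl ⟨h3, h2⟩
        · exact Or.inr ⟨⟨by omega, h1⟩, h2⟩
      · rintro (⟨h1, h2⟩ | ⟨⟨h1, h3⟩, h2⟩)
        · exact ⟨by omega, h2⟩
        · exact ⟨h3, h2⟩
    · rw [disjoint_left]
      intro p hp hp'
      rw [Nat.mem_primesLE] at hp
      rw [mem_PS] at hp'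
      omega
  have h2 := h Y hY
  rw [h1] at h2
  have hd := dens_pos (primorial_pos D)
  have h3 := mul_le_mul_of_nonneg_left h2 hd.le
  rw [← mul_assoc, dens_primorial, one_mul] at h3
  refine h3.trans ?_
  have hl : 0 ≤ Real.log Y := Real.log_natCast_nonneg _
  have : dens (primorial D) * (C * Real.log Y) = C * (dens (primorial D) * Real.log Y) := by ring
  rw [this]
  gcongr
  exact le_max_left _ _

theorem BB_small (k : ℕ) (η : ℝ) (hη : 0 < η) : ∃ D₁ : ℕ, 1 ≤ D₁ ∧ ∀ D, D₁ ≤ D → ∀ Y, BB k (PS D Y) ≤ η := by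
  have hc := Ck_pos k
  have hl : 0 < Real.log (1 + η) := Real.log_pos (by linarith)
  obtain ⟨D₁, hD⟩ := exists_nat_ge (2 * Ck k / Real.log (1 + η) + 1)
  have h1 : 0 < 2 * Ck k / Real.log (1 + η) := by positivity
  have h1' : (1:ℝ) ≤ D₁ := by linarith
  refine ⟨D₁, by exact_mod_cast h1', fun D hDD Y => ?_⟩
  have hDD' : (D₁:ℝ) ≤ D := by exact_mod_cast hDD
  have hD0 : (0:ℝ) < D := by linarith
  have h2 : ∑ p ∈ PS D Y, Ck k / ((p:ℝ) - 1) ^ 2 ≤ Real.log (1 + η) := by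
    calc _ ≤ ∑ p ∈ PS D Y, 2 * Ck k * (1 / (((p:ℝ) - 1) * p)) := by
          refine sum_le_sum fun p hp => ?_
          have hp' := (mem_PS.mp hp).2
          have h3 : (0:ℝ) < (p:ℝ) - 1 := prime_sub_one_pos hp'
          have h4 : (2:ℝ) ≤ p := by exact_mod_cast hp'.two_le
          rw [mul_one_div, div_le_div_iff₀ (by positivity) (by positivity)]
          nlinarith [mul_pos hc h3, mul_nonneg (mul_pos hc h3).le (by linarith : (0:ℝ) ≤ p - 2)]
      _ = 2 * Ck k * ∑ p ∈ PS D Y, (1 / (((p:ℝ) - 1) * p)) := by rw [mul_sum]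
      _ ≤ 2 * Ck k * ∑ p ∈ Ioc D Y, (1 / (((p:ℝ) - 1) * p)) := by
          refine mul_le_mul_of_nonneg_left ?_ (by positivity)
          refine sum_le_sum_of_subset_of_nonneg (s := PS D Y) (fun p hp => (mem_filter.mp hp).1) fun p hp _ => ?_
          rw [mem_Ioc] at hp
          have : (1:ℝ) ≤ p := by exact_mod_cast (by omega : 1 ≤ p)
          have : (0:ℝ) ≤ p - 1 := by linarith
          positivity
      _ ≤ 2 * Ck k * (1 / D) := by
          gcongr
          exact sum_inv_mul_pred_le D Y (by exact_mod_cast h1'.trans hDD')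
      _ ≤ _ := by
          rw [mul_one_div, div_le_comm₀ hD0 hl]
          linarith
  unfold BB
  have := Real.exp_le_exp.mpr h2
  rw [Real.exp_log (by linarith)] at this
  linarith

theorem sum_V_le (P : Finset ℕ) (hP : ∀ p ∈ P, p.Prime) (κ : ℝ) (hκ : 0 ≤ κ) (n : ℕ) (hn : κ ≤ n) :
    ∑ V : Finset P, κ ^ V.card / ∏ p ∈ V, (((p:ℕ):ℝ) - 1) ≤ EP P ^ n := by
  have h1 : ∀ V : Finset P, κ ^ V.card / ∏ p ∈ V, (((p:ℕ):ℝ) - 1) = ∏ p ∈ V, κ / (((p:ℕ):ℝ) - 1) := by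
    intro V; rw [prod_div_distrib, prod_const]
  simp_rw [h1]
  rw [← powerset_univ, ← prod_one_add, prod_coe_sort P (fun p => 1 + κ / ((p:ℝ) - 1)), EP, ← prod_pow]
  refine prod_le_prod (fun p hp => ?_) fun p hp => ?_
  all_goals have h3 : (0:ℝ) < (p:ℝ) - 1 := prime_sub_one_pos (hP p hp)
  · positivity
  · have h4 : (0:ℝ) < 1 / ((p:ℝ) - 1) := by positivity
    refine le_trans ?_ (one_add_mul_le_pow (by linarith) n)
    rw [mul_one_div]
    gcongr

theorem sum_VV_le (P : Finset ℕ) (hP : ∀ p ∈ P, p.Prime) (κ : ℝ) (hκ : 0 ≤ κ) (n : ℕ) (hn : κ ≤ n) (Z : ℕ) :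
    ∑ V ∈ VV P Z, κ ^ V.card ≤ Z * EP P ^ n := by
  refine le_trans ?_ (mul_le_mul_of_nonneg_left (sum_V_le P hP κ hκ n hn) (Nat.cast_nonneg _))
  rw [mul_sum]
  have h0 : ∀ V : Finset P, 0 < ∏ p ∈ V, (((p:ℕ):ℝ) - 1) := fun V => prod_pos fun p _ => prime_sub_one_pos (hP p p.2)
  refine le_trans (sum_le_sum (g := fun V : Finset P => (Z:ℝ) * (κ ^ V.card / ∏ p ∈ V, (((p:ℕ):ℝ) - 1))) fun V hV => ?_)
    (sum_le_sum_of_subset_of_nonneg (subset_univ _) fun V _ _ => by have := h0 V; positivity)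
  rw [VV, mem_filter] at hV
  have h1 : (∏ p ∈ V, (((p:ℕ):ℝ) - 1)) ≤ Z := by
    have : (∏ p ∈ V, ((p:ℕ):ℝ)) ≤ Z := by exact_mod_cast hV.2
    refine le_trans (prod_le_prod (fun p _ => (prime_sub_one_pos (hP p p.2)).le) fun p _ => ?_) this
    linarith
  rw [mul_div_assoc', le_div_iff₀ (h0 V), mul_comm]
  gcongr

end
end MT

end

section

set_option linter.unusedSectionVars false
namespace MT
open Finset
open ArithmeticFunction (vonMangoldt vonMangoldt_nonneg vonMangoldt_le_log vonMangoldt_apply_prime)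

noncomputable section
variable {k : ℕ}

def Esup (x q : ℕ) : ℝ :=
  ⨆ a : {a : ℕ // a < q ∧ Nat.Coprime a q}, |disc (fun n => vonMangoldt n) (x:ℝ) q a|
def X1 (x : ℕ) : ℝ := ∑ N ∈ Icc x (2 * x), if N.Prime then vonMangoldt N else 0
/-- the von Mangoldt function off the primes -/
def L2 (N : ℕ) : ℝ := if N.Prime then 0 else vonMangoldt N
def ee (x : ℕ) : ℝ := ∑ N ∈ Icc x (2 * x), L2 N

theorem L2_nonneg (N : ℕ) : 0 ≤ L2 N := by
  unfold L2; split_ifs; exacts [le_rfl, vonMangoldt_nonneg]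

theorem ee_nonneg (x : ℕ) : 0 ≤ ee x := sum_nonneg fun _ _ => L2_nonneg _

theorem X1_nonneg (x : ℕ) : 0 ≤ X1 x := sum_nonneg fun N _ => by
  split_ifs; exacts [vonMangoldt_nonneg, le_rfl]

theorem X1_add_ee (x : ℕ) : X1 x + ee x = ∑ N ∈ Icc x (2 * x), vonMangoldt N := by
  unfold X1 ee L2
  rw [← sum_add_distrib]
  refine sum_congr rfl fun N _ => ?_
  split_ifs <;> simp

theorem ee_le (x : ℕ) (hx : 1 ≤ x) : ee x ≤ 2 * √(2 * x) * Real.log (2 * x) := by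
  have h1 : (1:ℝ) ≤ 2 * x := by exact_mod_cast (by omega : 1 ≤ 2 * x)
  refine le_trans ?_ (Chebyshev.psi_sub_theta_le h1)
  have hf : ⌊(2 * x : ℝ)⌋₊ = 2 * x := by
    have : (2 * x : ℝ) = ((2 * x : ℕ) : ℝ) := by push_cast; rfl
    rw [this, Nat.floor_natCast]
  unfold Chebyshev.psi Chebyshev.theta
  rw [hf, sum_filter, ← sum_sub_distrib]
  have e : ∀ N, vonMangoldt N - (if N.Prime then Real.log N else 0) = L2 N := by
    intro N; unfold L2
    split_ifs with h
    · rw [vonMangoldt_apply_prime h, sub_self]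
    · rw [sub_zero]
  simp_rw [e]
  refine sum_le_sum_of_subset_of_nonneg (fun N hN => ?_) fun N _ _ => L2_nonneg N
  rw [mem_Icc] at hN; rw [mem_Ioc]; omega

theorem Esup_nonneg (x q : ℕ) : 0 ≤ Esup x q := Real.iSup_nonneg fun _ => abs_nonneg _

theorem le_Esup (x q a : ℕ) (ha : a < q) (hc : Nat.Coprime a q) :
    |disc (fun n => vonMangoldt n) (x:ℝ) q a| ≤ Esup x q := by
  have hfin : Finite {a : ℕ // a < q ∧ Nat.Coprime a q} :=
    (Set.finite_lt_nat q).subset (fun a ha => ha.1) |>.to_subtype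
  exact le_ciSup (f := fun a : {a : ℕ // a < q ∧ Nat.Coprime a q} => |disc (fun n => vonMangoldt n) (x:ℝ) q a|)
    (Set.finite_range _).bddAbove ⟨a, ha, hc⟩

theorem disc_nat (x q a : ℕ) : disc (fun n => vonMangoldt n) (x:ℝ) q a
    = ∑ n ∈ Icc x (2 * x) with n % q = a % q, vonMangoldt n
      - (1 / (Nat.totient q : ℝ)) * ∑ n ∈ Icc x (2 * x) with Nat.gcd n q = 1, vonMangoldt n := by
  have hf : ⌊(2 * x : ℝ)⌋₊ = 2 * x := by
    have : (2 * x : ℝ) = ((2 * x : ℕ) : ℝ) := by push_cast; rfl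
    rw [this, Nat.floor_natCast]
  unfold disc
  rw [hf, Nat.ceil_natCast, sum_filter, sum_filter]

theorem card_mod_le (x q a : ℕ) (hq : 0 < q) (hqx : q ≤ x) :
    ((#{n ∈ Icc x (2 * x) | n % q = a % q} : ℕ) : ℝ) ≤ 3 * x / q := by
  have h1 := Nat.Ioc_filter_modEq_card (x - 1) (2 * x) hq a
  have h2 : (Icc x (2 * x)).filter (fun n => n % q = a % q) = (Ioc (x - 1) (2 * x)).filter (fun n => n ≡ a [MOD q]) := by
    ext n
    rw [mem_filter, mem_filter, mem_Icc, mem_Ioc]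
    refine and_congr_left fun _ => ?_
    omega
  rw [h2]
  have hx1 : ((x - 1 : ℕ) : ℚ) = x - 1 := by
    rw [Nat.cast_sub (by omega), Nat.cast_one]
  have h3 : ((#{n ∈ Ioc (x - 1) (2 * x) | n ≡ a [MOD q]} : ℕ) : ℚ) ≤ 3 * x / q := by
    have h4 : ((#{n ∈ Ioc (x - 1) (2 * x) | n ≡ a [MOD q]} : ℕ) : ℚ) = (((#{n ∈ Ioc (x - 1) (2 * x) | n ≡ a [MOD q]} : ℕ) : ℤ) : ℚ) := by
      push_cast; rfl
    rw [h4, h1]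
    have hq' : (0:ℚ) < q := by exact_mod_cast hq
    have hqx' : (q:ℚ) ≤ x := by exact_mod_cast hqx
    have hq1 : (1:ℚ) ≤ q := by exact_mod_cast hq
    push_cast
    refine max_le ?_ (by positivity)
    have f1 := Int.floor_le ((2 * (x:ℚ) - a) / q)
    have f2 := Int.lt_floor_add_one ((((x - 1 : ℕ) : ℚ) - a) / q)
    rw [hx1] at f2
    have f3 : (2 * (x:ℚ) - a) / q - (x - 1 - a) / q = (x + 1) / q := by field_simp; ring
    have f4 : ((x:ℚ) + 1) / q + 1 ≤ 3 * x / q := by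
      rw [← sub_nonneg]
      have : 3 * (x:ℚ) / q - ((x + 1) / q + 1) = (2 * x - 1 - q) / q := by field_simp; ring
      rw [this]
      apply div_nonneg _ hq'.le
      linarith
    rw [hx1]
    linarith
  have := (Rat.cast_le (K := ℝ)).mpr h3
  push_cast at this
  exact this

theorem Esup_triv (x q : ℕ) (hq : 0 < q) (hqx : q ≤ x) :
    Esup x q ≤ 5 * x * Real.log (2 * x) / Nat.totient q := by
  have hx : 1 ≤ x := by omega
  have hx' : (1:ℝ) ≤ x := by exact_mod_cast hx
  have hφ : (0:ℝ) < Nat.totient q := by exact_mod_cast Nat.totient_pos.mpr hq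
  have hl : 0 ≤ Real.log (2 * x) := Real.log_nonneg (by linarith)
  have hq' : (0:ℝ) < q := by exact_mod_cast hq
  have hφq : (Nat.totient q : ℝ) ≤ q := by exact_mod_cast Nat.totient_le q
  refine Real.iSup_le (fun a => ?_) (by positivity)
  rw [disc_nat]
  have hΛ : ∀ n ∈ Icc x (2 * x), vonMangoldt n ≤ Real.log (2 * x) := by
    intro n hn
    rw [mem_Icc] at hn
    refine vonMangoldt_le_log.trans (Real.log_le_log ?_ ?_)
    · exact_mod_cast (by omega : 0 < n)
    · exact_mod_cast hn.2
  have b1 : ∑ n ∈ Icc x (2 * x) with n % q = (a:ℕ) % q, vonMangoldt n ≤ 3 * x * Real.log (2 * x) / Nat.totient q := by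
    calc _ ≤ ∑ n ∈ Icc x (2 * x) with n % q = (a:ℕ) % q, Real.log (2 * x) :=
          sum_le_sum fun n hn => hΛ n (mem_filter.mp hn).1
      _ = #{n ∈ Icc x (2 * x) | n % q = (a:ℕ) % q} * Real.log (2 * x) := by rw [sum_const, nsmul_eq_mul]
      _ ≤ (3 * x / q) * Real.log (2 * x) := by
          gcongr; exact card_mod_le x q a hq hqx
      _ = 3 * x * Real.log (2 * x) / q := by ring
      _ ≤ _ := by gcongr
  have b2 : ∑ n ∈ Icc x (2 * x) with Nat.gcd n q = 1, vonMangoldt n ≤ 2 * x * Real.log (2 * x) := by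
    calc _ ≤ ∑ n ∈ Icc x (2 * x), vonMangoldt n :=
          sum_le_sum_of_subset_of_nonneg (filter_subset _ _) fun _ _ _ => vonMangoldt_nonneg
      _ ≤ ∑ n ∈ Icc x (2 * x), Real.log (2 * x) := sum_le_sum hΛ
      _ = (x + 1) * Real.log (2 * x) := by
          rw [sum_const, nsmul_eq_mul, Nat.card_Icc]
          congr 1
          rw [show 2 * x + 1 - x = x + 1 by omega]; push_cast; rfl
      _ ≤ _ := by gcongr; linarith
  have n1 : 0 ≤ ∑ n ∈ Icc x (2 * x) with n % q = (a:ℕ) % q, vonMangoldt n := sum_nonneg fun _ _ => vonMangoldt_nonneg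
  have n2 : 0 ≤ ∑ n ∈ Icc x (2 * x) with Nat.gcd n q = 1, vonMangoldt n := sum_nonneg fun _ _ => vonMangoldt_nonneg
  have b3 : (1 / (Nat.totient q : ℝ)) * ∑ n ∈ Icc x (2 * x) with Nat.gcd n q = 1, vonMangoldt n ≤ 2 * x * Real.log (2 * x) / Nat.totient q := by
    rw [one_div_mul_eq_div]; gcongr
  have n3 : 0 ≤ (1 / (Nat.totient q : ℝ)) * ∑ n ∈ Icc x (2 * x) with Nat.gcd n q = 1, vonMangoldt n := by positivity
  have e : 5 * x * Real.log (2 * x) / Nat.totient q = 3 * x * Real.log (2 * x) / Nat.totient q + 2 * x * Real.log (2 * x) / Nat.totient q := by ring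
  rw [e, abs_le]
  constructor <;> linarith

theorem disc_bound (x q r : ℕ) (hq : 0 < q) (hqx : q < x) (hr : Nat.Coprime r q) :
    |∑ N ∈ Icc x (2 * x) with N % q = r % q, vonMangoldt N - X1 x / Nat.totient q| ≤ Esup x q + ee x / Nat.totient q := by
  have hφ : (0:ℝ) < Nat.totient q := by exact_mod_cast Nat.totient_pos.mpr hq
  have h1 := le_Esup x q (r % q) (Nat.mod_lt _ hq) (by
    rw [Nat.coprime_iff_gcd_eq_one] at *
    rw [← Nat.gcd_rec, Nat.gcd_comm]; exact hr)
  rw [disc_nat, Nat.mod_mod] at h1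
  have h2 : X1 x ≤ ∑ n ∈ Icc x (2 * x) with Nat.gcd n q = 1, vonMangoldt n := by
    unfold X1
    rw [sum_filter]
    refine sum_le_sum fun N hN => ?_
    rw [mem_Icc] at hN
    split_ifs with a b b
    · exact le_rfl
    · exfalso; apply b
      rcases (Nat.Prime.coprime_iff_not_dvd a).mpr (fun hd => absurd (Nat.le_of_dvd hq hd) (by omega)) with h
      exact h
    · exact vonMangoldt_nonneg
    · exact le_rfl
  have h3 : ∑ n ∈ Icc x (2 * x) with Nat.gcd n q = 1, vonMangoldt n ≤ X1 x + ee x := by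
    rw [X1_add_ee]
    exact sum_le_sum_of_subset_of_nonneg (filter_subset _ _) fun _ _ _ => vonMangoldt_nonneg
  have h4 : |(1 / (Nat.totient q : ℝ)) * ∑ n ∈ Icc x (2 * x) with Nat.gcd n q = 1, vonMangoldt n - X1 x / Nat.totient q| ≤ ee x / Nat.totient q := by
    rw [one_div_mul_eq_div, ← sub_div, abs_div, abs_of_pos hφ]
    gcongr
    rw [abs_le]; constructor <;> linarith [ee_nonneg x]
  refine le_trans ?_ (add_le_add h1 h4)
  refine le_trans (le_of_eq ?_) (abs_add_le _ _)
  congr 1; ring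

/-- version in the form needed by `sieve_S2` -/
theorem disc_bound_int (x q : ℕ) (hq : 0 < q) (hqx : q < x) (a h : ℤ) (hc : Int.gcd (a + h) q = 1) :
    |∑ N ∈ Icc x (2 * x) with ((N:ℕ):ℤ) - h ≡ a [ZMOD q], vonMangoldt N - X1 x / Nat.totient q| ≤ Esup x q + ee x / Nat.totient q := by
  have hq' : (0:ℤ) < q := by exact_mod_cast hq
  obtain ⟨r, hr⟩ := Int.eq_ofNat_of_zero_le (Int.emod_nonneg (a + h) hq'.ne')
  have h1 : Nat.Coprime r q := by
    have : Int.gcd ((a + h) % q) q = 1 := by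
      rw [Int.gcd_emod]; exact hc
    rw [hr, Int.gcd_natCast_natCast] at this
    exact this
  have h2 := disc_bound x q r hq hqx h1
  convert h2 using 3
  refine sum_congr ?_ fun _ _ => rfl
  ext N
  simp only [mem_filter, and_congr_right_iff]
  intro _
  have e1 : ((N:ℤ) - h ≡ a [ZMOD q]) ↔ (N:ℤ) ≡ a + h [ZMOD q] := by
    rw [Int.modEq_iff_dvd, Int.modEq_iff_dvd]
    have : a - (N - h) = a + h - (N:ℤ) := by ring
    rw [this]
  have e2 : ((N:ℤ) ≡ a + h [ZMOD q]) ↔ (N:ℤ) ≡ (r:ℤ) [ZMOD q] := by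
    have : (r:ℤ) ≡ a + h [ZMOD q] := by rw [← hr]; exact Int.mod_modEq _ _
    exact ⟨fun h => h.trans this.symm, fun h => h.trans this⟩
  rw [e1, e2, Int.natCast_modEq_iff]
  rfl

end
end MT

end

section

set_option linter.unusedSectionVars false
namespace MT
open Finset Filter
open ArithmeticFunction (vonMangoldt vonMangoldt_nonneg vonMangoldt_le_log vonMangoldt_apply_prime)

noncomputable section
variable {k : ℕ}

theorem ev_log (C : ℝ) (n : ℕ) (a : ℝ) (ha : a < 1) : ∀ᶠ x : ℕ in atTop, C * Real.log x ^ n * (x:ℝ) ^ a ≤ x := by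
  have h1 := isLittleO_log_rpow_rpow_atTop (s := 1 - a) (n:ℝ) (by linarith)
  have h2 := h1.def (c := 1 / (|C| + 1)) (by positivity)
  have h3 := tendsto_natCast_atTop_atTop (R := ℝ) |>.eventually h2
  filter_upwards [h3, eventually_ge_atTop 1] with x hx hx1
  have hx0 : (0:ℝ) < x := by exact_mod_cast hx1
  have hl : 0 ≤ Real.log x := Real.log_natCast_nonneg _
  rw [Real.rpow_natCast, Real.norm_of_nonneg (by positivity), Real.norm_of_nonneg (by positivity)] at hx
  have hC : 0 < |C| + 1 := by positivity
  have h5 : (|C| + 1) * Real.log x ^ n ≤ (x:ℝ) ^ (1 - a) := by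
    rw [one_div_mul_eq_div, le_div_iff₀ hC] at hx
    linarith
  calc C * Real.log x ^ n * (x:ℝ) ^ a ≤ (|C| + 1) * Real.log x ^ n * (x:ℝ) ^ a := by
        gcongr; linarith [le_abs_self C]
    _ ≤ (x:ℝ) ^ (1 - a) * (x:ℝ) ^ a := by gcongr
    _ = x := by rw [← Real.rpow_add hx0]; simp

theorem ev_log_ge (M : ℝ) : ∀ᶠ x : ℕ in atTop, M ≤ Real.log x :=
  (Real.tendsto_log_atTop.comp tendsto_natCast_atTop_atTop).eventually_ge_atTop M

def Yx (θ' : ℝ) (x : ℕ) : ℕ := ⌈(x:ℝ) ^ (θ' / 2)⌉₊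

theorem Yx_facts (θ' : ℝ) (h0 : 0 < θ') (h1 : θ' < 1) (D : ℕ) : ∀ᶠ x : ℕ in atTop,
    2 ≤ Yx θ' x ∧ D ≤ Yx θ' x ∧ ((Yx θ' x * Yx θ' x : ℕ) : ℝ) ≤ 4 * (x:ℝ) ^ θ' ∧ Real.log (Yx θ' x) ≤ Real.log x ∧ Yx θ' x < x := by
  have t1 : Tendsto (fun x : ℕ => (x:ℝ) ^ (θ' / 2)) atTop atTop :=
    (tendsto_rpow_atTop (by linarith)).comp tendsto_natCast_atTop_atTop
  filter_upwards [t1.eventually_ge_atTop (max 2 D), eventually_ge_atTop 1, ev_log 4 0 (θ' / 2) (by linarith)] with x hx hx1 h4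
  have hx0 : (0:ℝ) < x := by exact_mod_cast hx1
  have a1 : (x:ℝ) ^ (θ' / 2) ≤ Yx θ' x := Nat.le_ceil _
  have a2 : (Yx θ' x : ℝ) < (x:ℝ) ^ (θ' / 2) + 1 := Nat.ceil_lt_add_one (by positivity)
  have a3 := le_trans (le_max_left _ _) hx
  have a4 := le_trans (le_max_right _ _) hx
  have b1 : (2:ℝ) ≤ Yx θ' x := a3.trans a1
  have b2 : (D:ℝ) ≤ Yx θ' x := a4.trans a1
  simp only [pow_zero, mul_one] at h4
  have a5 : (Yx θ' x : ℝ) ≤ 2 * (x:ℝ) ^ (θ' / 2) := by linarith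
  have b5 : (Yx θ' x : ℝ) < x := by linarith
  refine ⟨by exact_mod_cast b1, by exact_mod_cast b2, ?_, ?_, by exact_mod_cast b5⟩
  · push_cast
    calc (Yx θ' x : ℝ) * Yx θ' x ≤ (2 * (x:ℝ) ^ (θ' / 2)) * (2 * (x:ℝ) ^ (θ' / 2)) := by gcongr
      _ = 4 * ((x:ℝ) ^ (θ' / 2) * (x:ℝ) ^ (θ' / 2)) := by ring
      _ = _ := by rw [← Real.rpow_add hx0]; congr 2; ring
  · exact Real.log_le_log (by linarith) b5.le

theorem EP_log : ∃ C : ℝ, 1 ≤ C ∧ ∀ D Y : ℕ, D ≤ Y → 2 ≤ Y → EP (PS D Y) ≤ C * Real.log Y := by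
  obtain ⟨C, h1, h⟩ := EP_le
  refine ⟨C, h1, fun D Y a b => (h D Y a b).trans ?_⟩
  have := dens_le_one (primorial D)
  have hl : 0 ≤ Real.log Y := Real.log_natCast_nonneg _
  nlinarith [mul_le_mul_of_nonneg_right this hl]

theorem PS_prime {D Y : ℕ} : ∀ p ∈ PS D Y, p.Prime := fun _ hp => (mem_PS.mp hp).2

theorem err1 (θ' : ℝ) (h0 : 0 < θ') (h1 : θ' < 1) (D : ℕ) (κ : ℝ) (hκ : 0 ≤ κ) (B : ℕ) :
    ∀ᶠ x : ℕ in atTop, ∑ V ∈ VV (PS D (Yx θ' x)) (Yx θ' x * Yx θ' x), κ ^ V.card ≤ x / Real.log x ^ B := by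
  obtain ⟨C, hC, hEP⟩ := EP_log
  obtain ⟨n, hn⟩ := exists_nat_ge κ
  filter_upwards [Yx_facts θ' h0 h1 D, ev_log (4 * C ^ n) (n + B) θ' h1, ev_log_ge 1] with x ⟨y2, yD, yy, yl, _⟩ hx hl
  rw [le_div_iff₀ (by positivity)]
  have b1 := sum_VV_le (PS D (Yx θ' x)) PS_prime κ hκ n hn (Yx θ' x * Yx θ' x)
  have b0 : 0 ≤ EP (PS D (Yx θ' x)) := zero_le_one.trans (EP_one_le (PS D (Yx θ' x)) PS_prime)
  have b2 : EP (PS D (Yx θ' x)) ^ n ≤ (C * Real.log x) ^ n := by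
    have := EP_one_le (PS D (Yx θ' x)) PS_prime
    refine pow_le_pow_left₀ (by linarith) ((hEP D _ yD y2).trans ?_) n
    gcongr
  calc _ ≤ (((Yx θ' x * Yx θ' x : ℕ) : ℝ) * EP (PS D (Yx θ' x)) ^ n) * Real.log x ^ B := by gcongr
    _ ≤ (4 * (x:ℝ) ^ θ') * (C * Real.log x) ^ n * Real.log x ^ B := by gcongr
    _ = 4 * C ^ n * Real.log x ^ (n + B) * (x:ℝ) ^ θ' := by rw [mul_pow, pow_add]; ring
    _ ≤ x := hx

/-- the modulus attached to `V` -/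
def qV (W : ℕ) {P : Finset ℕ} (V : Finset P) : ℕ := W * ∏ p ∈ V, (p:ℕ)

theorem qV_inj (W : ℕ) (hW : 0 < W) {P : Finset ℕ} (hP : ∀ p ∈ P, p.Prime) : Function.Injective (qV W (P := P)) := by
  intro V V' h
  have h1 := Nat.eq_of_mul_eq_mul_left hW h
  have e : ∀ V : Finset P, ∏ p ∈ V, (p:ℕ) = ∏ p ∈ V.map (Function.Embedding.subtype _), p := by
    intro V; rw [prod_map]; rfl
  rw [e, e] at h1
  have h2 := congrArg Nat.primeFactors h1
  have hpr : ∀ V : Finset P, ∀ p ∈ V.map (Function.Embedding.subtype _), p.Prime := by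
    intro V p hp
    rw [Finset.mem_map] at hp
    obtain ⟨q, _, rfl⟩ := hp
    exact hP _ q.2
  rw [Nat.primeFactors_prod (hpr V), Nat.primeFactors_prod (hpr V')] at h2
  exact map_injective _ h2

theorem qV_tot (W : ℕ) {P : Finset ℕ} (hP : ∀ p ∈ P, p.Prime) (hWp : ∀ p ∈ P, W.Coprime p) (V : Finset P) :
    (Nat.totient (qV W V) : ℝ) = Nat.totient W * ∏ p ∈ V, (((p:ℕ):ℝ) - 1) := by
  unfold qV
  rw [Nat.totient_mul, Nat.cast_mul]
  · congr 1
    have e : ∏ p ∈ V, (p:ℕ) = ∏ p ∈ V.map (Function.Embedding.subtype _), p := by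
      rw [prod_map]; rfl
    rw [e, totient_prod, prod_map]
    · rfl
    · intro p hp
      rw [Finset.mem_map] at hp
      obtain ⟨q, _, rfl⟩ := hp
      exact hP _ q.2
  · exact Nat.Coprime.prod_right fun p _ => hWp p p.2

theorem cop_PS (D Y : ℕ) : ∀ p ∈ PS D Y, (primorial D).Coprime p := by
  intro p hp
  rw [mem_PS] at hp
  rw [coprime_primorial_iff]
  intro q hq hqp
  rw [(Nat.prime_dvd_prime_iff_eq hq hp.2).mp hqp]; exact hp.1.1

theorem qV_facts (θ θ' : ℝ) (h0 : 0 < θ') (h1 : θ' < θ) (hθ : θ < 1) (D W : ℕ) : ∀ᶠ x : ℕ in atTop,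
    ∀ V ∈ VV (PS D (Yx θ' x)) (Yx θ' x * Yx θ' x), qV W V ≤ ⌊(x:ℝ) ^ θ⌋₊ ∧ qV W V < x := by
  have e1 := ev_log (4 * W) 0 (1 - (θ - θ')) (by linarith)
  have e2 := ev_log 2 0 θ hθ
  filter_upwards [Yx_facts θ' h0 (h1.trans hθ) D, e1, e2, eventually_ge_atTop 1] with x ⟨_, _, yy, _, _⟩ a1 a2 a3
  intro V hV
  rw [VV, mem_filter] at hV
  have hx0 : (0:ℝ) < x := by exact_mod_cast a3
  have b1 : ((∏ p ∈ V, (p:ℕ) : ℕ) : ℝ) ≤ 4 * (x:ℝ) ^ θ' := le_trans (by exact_mod_cast hV.2) yy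
  have b2 : (qV W V : ℝ) ≤ (x:ℝ) ^ θ := by
    unfold qV
    rw [Nat.cast_mul]
    calc (W:ℝ) * ((∏ p ∈ V, (p:ℕ) : ℕ) : ℝ) ≤ W * (4 * (x:ℝ) ^ θ') := by gcongr
      _ = (4 * W) * (x:ℝ) ^ (1 - (θ - θ')) * (x:ℝ) ^ (θ - 1) := by
          rw [mul_assoc (4 * (W:ℝ)), ← Real.rpow_add hx0]
          rw [show 1 - (θ - θ') + (θ - 1) = θ' by ring]; ring
      _ ≤ x * (x:ℝ) ^ (θ - 1) := by
          gcongr; simpa using a1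
      _ = _ := by
          nth_rewrite 1 [← Real.rpow_one (x:ℝ)]
          rw [← Real.rpow_add hx0]; congr 1; ring
  have : 0 < (x:ℝ) ^ θ := by positivity
  refine ⟨Nat.le_floor b2, ?_⟩
  have : (qV W V : ℝ) < x := by simp only [pow_zero, mul_one] at a2; linarith
  exact_mod_cast this

set_option maxHeartbeats 1000000 in
theorem err2 (θ θ' : ℝ) (h0 : 0 < θ') (h1 : θ' < θ) (hθ : θ < 1) (hEH : EH θ) (D : ℕ) (κ : ℝ) (hκ : 0 ≤ κ) (B : ℕ) :
    ∀ᶠ x : ℕ in atTop, ∑ V ∈ VV (PS D (Yx θ' x)) (Yx θ' x * Yx θ' x),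
      (Esup x (qV (primorial D) V) + ee x / Nat.totient (qV (primorial D) V)) * κ ^ V.card ≤ x / Real.log x ^ B := by
  obtain ⟨C, hC, hEP⟩ := EP_log
  obtain ⟨n, hn⟩ := exists_nat_ge κ
  obtain ⟨n2, hn2⟩ := exists_nat_ge (κ ^ 2)
  obtain ⟨C2, hC2⟩ := hEH ((n2 + 2 + 2 * B : ℕ) : ℝ) (by push_cast; nlinarith [Nat.cast_nonneg (α := ℝ) n2, Nat.cast_nonneg (α := ℝ) B])
  set W := primorial D with hW
  have hWpos : 0 < W := primorial_pos D
  filter_upwards [Yx_facts θ' h0 (h1.trans hθ) D, qV_facts θ θ' h0 h1 hθ D W, ev_log (16 * C ^ n) (n + B + 1) (1/2) (by norm_num), ev_log_ge 1,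
    ev_log_ge (40 * |C2| * C ^ n2), eventually_ge_atTop 2]
    with x ⟨y2, yD, yy, yl, _⟩ hq hx hl hl2 hx2
  set Y := Yx θ' x with hY
  set P := PS D Y with hPdef
  set F := VV P (Y * Y) with hF
  have hP : ∀ p ∈ P, p.Prime := PS_prime
  have hx0 : (2:ℝ) ≤ x := by exact_mod_cast hx2
  have hlog2 : Real.log (2 * x) ≤ 2 * Real.log x := by
    rw [Real.log_mul (by norm_num) (by linarith)]
    have := Real.log_le_log (by norm_num) hx0
    linarith
  have hlog2' : 0 ≤ Real.log (2 * x) := Real.log_nonneg (by linarith)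
  have hEPl : EP P ≤ C * Real.log x := (hEP D _ yD y2).trans (by gcongr)
  have hEP1 := EP_one_le P hP
  have hprod : ∀ V : Finset P, 0 < ∏ p ∈ V, (((p:ℕ):ℝ) - 1) := fun V => prod_pos fun p _ => prime_sub_one_pos (hP p p.2)
  have hW1 : (1:ℝ) ≤ Nat.totient W := by exact_mod_cast Nat.totient_pos.mpr hWpos
  have hphi : ∀ V : Finset P, ∏ p ∈ V, (((p:ℕ):ℝ) - 1) ≤ Nat.totient (qV W V) := by
    intro V
    rw [qV_tot W hP (cop_PS D Y)]
    nlinarith [hprod V]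
  have hqpos : ∀ V : Finset P, 0 < qV W V := fun V =>
    Nat.mul_pos hWpos (prod_pos fun p _ => (hP p p.2).pos)
  -- first part
  have p1 : ∑ V ∈ F, Esup x (qV W V) * κ ^ V.card ≤ x / (2 * Real.log x ^ B) := by
    have cs := sum_sq_le_sum_mul_sum_of_sq_le_mul F (r := fun V => Esup x (qV W V) * κ ^ V.card)
      (f := fun V => Esup x (qV W V)) (g := fun V => Esup x (qV W V) * (κ ^ 2) ^ V.card)
      (fun V _ => Esup_nonneg _ _) (fun V _ => mul_nonneg (Esup_nonneg _ _) (by positivity))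
      (fun V _ => le_of_eq (by rw [← pow_mul, mul_comm 2, pow_mul]; ring))
    have s1 : ∑ V ∈ F, Esup x (qV W V) ≤ |C2| * x / Real.log x ^ (n2 + 2 + 2 * B) := by
      have := hC2 x hx0
      rw [Real.rpow_neg (by linarith), Real.rpow_natCast] at this
      calc ∑ V ∈ F, Esup x (qV W V) = ∑ q ∈ F.image (qV W), Esup x q := by
            rw [sum_image fun a _ b _ hab => qV_inj W hWpos hP hab]
        _ ≤ ∑ q ∈ Icc 1 ⌊(x:ℝ) ^ θ⌋₊, Esup x q := by
            refine sum_le_sum_of_subset_of_nonneg ?_ fun q _ _ => Esup_nonneg x q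
            intro q hq'
            rw [mem_image] at hq'
            obtain ⟨V, hV, rfl⟩ := hq'
            rw [mem_Icc]
            exact ⟨hqpos V, (hq V hV).1⟩
        _ ≤ C2 * x * (Real.log x ^ (n2 + 2 + 2 * B))⁻¹ := this
        _ ≤ |C2| * x * (Real.log x ^ (n2 + 2 + 2 * B))⁻¹ := by gcongr; exact le_abs_self _
        _ = _ := by rw [div_eq_mul_inv]
    have s2 : ∑ V ∈ F, Esup x (qV W V) * (κ ^ 2) ^ V.card ≤ 5 * x * (2 * Real.log x) * (C * Real.log x) ^ n2 := by
      calc _ ≤ ∑ V ∈ F, 5 * x * (2 * Real.log x) * ((κ ^ 2) ^ V.card / ∏ p ∈ V, (((p:ℕ):ℝ) - 1)) := by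
            refine sum_le_sum fun V hV => ?_
            have t := Esup_triv x (qV W V) (hqpos V) (hq V hV).2.le
            have t2 : 5 * x * Real.log (2 * x) / Nat.totient (qV W V) ≤ 5 * x * (2 * Real.log x) / ∏ p ∈ V, (((p:ℕ):ℝ) - 1) := by
              have := hprod V
              gcongr
              exact hphi V
            calc _ ≤ (5 * x * (2 * Real.log x) / ∏ p ∈ V, (((p:ℕ):ℝ) - 1)) * (κ ^ 2) ^ V.card := by
                  gcongr; exact t.trans t2
              _ = _ := by ring
        _ ≤ ∑ V : Finset P, 5 * x * (2 * Real.log x) * ((κ ^ 2) ^ V.card / ∏ p ∈ V, (((p:ℕ):ℝ) - 1)) := by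
            refine sum_le_sum_of_subset_of_nonneg (subset_univ _) fun V _ _ => ?_
            have := hprod V
            positivity
        _ = 5 * x * (2 * Real.log x) * ∑ V : Finset P, ((κ ^ 2) ^ V.card / ∏ p ∈ V, (((p:ℕ):ℝ) - 1)) := by rw [mul_sum]
        _ ≤ 5 * x * (2 * Real.log x) * EP P ^ n2 := by
            gcongr; exact sum_V_le P hP (κ ^ 2) (by positivity) n2 hn2
        _ ≤ _ := by gcongr
    have hl0 : 0 < Real.log x := by linarith
    refine le_of_sq_le_sq ?_ (by positivity)
    refine cs.trans ?_
    calc _ ≤ (|C2| * x / Real.log x ^ (n2 + 2 + 2 * B)) * (5 * x * (2 * Real.log x) * (C * Real.log x) ^ n2) := by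
          gcongr
          exact sum_nonneg fun V _ => mul_nonneg (Esup_nonneg _ _) (by positivity)
      _ = (x / (2 * Real.log x ^ B)) ^ 2 * ((40 * |C2| * C ^ n2) / Real.log x) := by
          rw [mul_pow C, pow_add, pow_add, mul_comm 2 B, pow_mul]
          field_simp
          ring
      _ ≤ (x / (2 * Real.log x ^ B)) ^ 2 * 1 := by
          gcongr
          exact div_le_one_of_le₀ hl2 hl0.le
      _ = _ := mul_one _
  have p2 : ∑ V ∈ F, ee x / Nat.totient (qV W V) * κ ^ V.card ≤ x / (2 * Real.log x ^ B) := by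
    have hee : ee x ≤ 8 * (x:ℝ) ^ (1/2:ℝ) * Real.log x := by
      refine (ee_le x (by omega)).trans ?_
      have : √(2 * x) ≤ 2 * (x:ℝ) ^ (1/2:ℝ) := by
        rw [← Real.sqrt_eq_rpow, Real.sqrt_mul (by norm_num)]
        gcongr
        rw [Real.sqrt_le_left (by norm_num)]; norm_num
      calc 2 * √(2 * x) * Real.log (2 * x) ≤ 2 * (2 * (x:ℝ) ^ (1/2:ℝ)) * (2 * Real.log x) := by gcongr
        _ = _ := by ring
    have hee0 := ee_nonneg x
    have : ∑ V ∈ F, ee x / Nat.totient (qV W V) * κ ^ V.card ≤ ee x * (C * Real.log x) ^ n := by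
      calc _ ≤ ∑ V ∈ F, ee x * (κ ^ V.card / ∏ p ∈ V, (((p:ℕ):ℝ) - 1)) := by
            refine sum_le_sum fun V hV => ?_
            have h5 := hprod V
            calc ee x / Nat.totient (qV W V) * κ ^ V.card ≤ ee x / (∏ p ∈ V, (((p:ℕ):ℝ) - 1)) * κ ^ V.card := by
                  gcongr
                  exact hphi V
              _ = _ := by ring
        _ ≤ ∑ V : Finset P, ee x * (κ ^ V.card / ∏ p ∈ V, (((p:ℕ):ℝ) - 1)) := by
            refine sum_le_sum_of_subset_of_nonneg (subset_univ _) fun V _ _ => ?_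
            have := hprod V
            positivity
        _ = ee x * ∑ V : Finset P, (κ ^ V.card / ∏ p ∈ V, (((p:ℕ):ℝ) - 1)) := by rw [mul_sum]
        _ ≤ ee x * EP P ^ n := by
            gcongr; exact sum_V_le P hP κ hκ n hn
        _ ≤ _ := by gcongr
    refine this.trans ?_
    rw [le_div_iff₀ (by positivity)]
    calc _ ≤ (8 * (x:ℝ) ^ (1/2:ℝ) * Real.log x) * (C * Real.log x) ^ n * (2 * Real.log x ^ B) := by gcongr
      _ = 16 * C ^ n * Real.log x ^ (n + B + 1) * (x:ℝ) ^ (1/2:ℝ) := by rw [mul_pow, pow_add, pow_add]; ring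
      _ ≤ x := hx
  simp_rw [add_mul]
  rw [sum_add_distrib]
  calc _ ≤ x / (2 * Real.log x ^ B) + x / (2 * Real.log x ^ B) := add_le_add p1 p2
    _ = _ := by field_simp; ring

end
end MT

end

section

set_option linter.unusedSectionVars false
namespace MT
open Finset
open ArithmeticFunction (vonMangoldt vonMangoldt_nonneg vonMangoldt_le_log vonMangoldt_apply_prime)

noncomputable section
variable {k : ℕ}

theorem abs_chi_le (p : ℕ) (hp : 2 ≤ p) (z : ℤ) :
    1 + |chi p z| / ((p:ℝ) - 1) ≤ (1 + 1 / ((p:ℝ) - 1)) * (if (p:ℤ) ∣ z then 2 else 1) := by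
  have h1 : (0:ℝ) < (p:ℝ) - 1 := by
    have : (2:ℝ) ≤ p := by exact_mod_cast hp
    linarith
  have h2 : 0 < 1 / ((p:ℝ) - 1) := by positivity
  unfold chi
  split_ifs with h
  · rw [abs_sub_comm, abs_of_pos h1, div_self h1.ne']; linarith
  · simp

theorem local_sum_le (h : Fin k → ℤ) (i0 : Fin k) (p : ℕ) (hp : 2 ≤ p) (n : ℤ) :
    ∑ l : Fin k → Bool, |gl0 i0 p l * phi2 h i0 p l n|
      ≤ ∏ i, ((1 + 1 / ((p:ℝ) - 1)) * (if (p:ℤ) ∣ n + h i then 2 else 1)) := by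
  have h1 : (0:ℝ) < (p:ℝ) - 1 := by
    have : (2:ℝ) ≤ p := by exact_mod_cast hp
    linarith
  calc _ ≤ ∑ l : Fin k → Bool, ∏ i, (if l i then |chi p (n + h i)| / ((p:ℝ) - 1) else 1) := by
        refine sum_le_sum fun l _ => ?_
        have e : ∏ i, (if l i then |chi p (n + h i)| / ((p:ℝ) - 1) else 1) = gl p l * |phi1 h p l n| := by
          unfold gl phi1
          rw [abs_prod, ← prod_mul_distrib]
          refine prod_congr rfl fun i _ => ?_
          split_ifs
          · ring
          · simp
        rw [e, abs_mul, abs_of_nonneg (gl0_nonneg p hp i0 l)]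
        refine mul_le_mul (gl0_le p hp i0 l) ?_ (abs_nonneg _) (gl_nonneg p hp l)
        unfold phi2
        split_ifs with hz
        · rw [hz, phi1_zl]
        · simp
        · exact le_rfl
    _ = ∏ i, (1 + |chi p (n + h i)| / ((p:ℝ) - 1)) := by
        have := Finset.prod_univ_sum (fun _ : Fin k => (univ : Finset Bool)) (fun i c => if c then |chi p (n + h i)| / ((p:ℝ) - 1) else 1)
        rw [Fintype.piFinset_univ] at this
        rw [← this]
        simp [add_comm]
    _ ≤ _ := prod_le_prod (fun i _ => by positivity) fun i _ => abs_chi_le p hp _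

theorem two_pow_omega (P : Finset ℕ) (hP : ∀ p ∈ P, p.Prime) (M : ℕ) (hM : ∀ p ∈ P, M ≤ p) (z : ℤ) (hz : z ≠ 0) :
    M ^ (P.filter fun p : ℕ => (p:ℤ) ∣ z).card ≤ z.natAbs := by
  have h1 : ∏ p ∈ P.filter (fun p : ℕ => (p:ℤ) ∣ z), p ∣ z.natAbs := by
    refine Finset.prod_primes_dvd _ (fun p hp => (hP p (mem_filter.mp hp).1).prime) fun p hp => ?_
    exact Int.natCast_dvd.mp (mem_filter.mp hp).2
  refine le_trans ?_ (Nat.le_of_dvd (Int.natAbs_pos.mpr hz) h1)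
  exact pow_card_le_prod _ _ _ fun p hp => hM p (mem_filter.mp hp).1

theorem pointwise (h : Fin k → ℤ) (hk : 1 ≤ k) (i0 : Fin k) (P : Finset ℕ) (hP : ∀ p ∈ P, p.Prime) (hM : ∀ p ∈ P, 2 ^ (8 * k) ≤ p)
    (u : (P → Fin k → Bool) → ℝ) (U : ℝ) (hU : ∀ A, |u A| ≤ U) (n : ℤ) (Z : ℝ) (hn : ∀ i, n + h i ≠ 0 ∧ |((n + h i : ℤ) : ℝ)| ≤ Z) :
    (∑ A, u A * ∏ p : P, (gl0 i0 p (A p) * phi2 h i0 p (A p) n)) ^ 2 ≤ U ^ 2 * EP P ^ (2 * k) * Z ^ (1/4:ℝ) := by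
  have hU0 : 0 ≤ U := (abs_nonneg _).trans (hU fun _ _ => false)
  have hEP0 : 0 ≤ EP P := zero_le_one.trans (EP_one_le P hP)
  set om : Fin k → ℕ := fun i => (P.filter fun p : ℕ => (p:ℤ) ∣ n + h i).card with hom
  have b1 : |∑ A, u A * ∏ p : P, (gl0 i0 p (A p) * phi2 h i0 p (A p) n)| ≤ U * (EP P ^ k * ∏ i, (2:ℝ) ^ om i) := by
    calc _ ≤ ∑ A, |u A * ∏ p : P, (gl0 i0 p (A p) * phi2 h i0 p (A p) n)| := abs_sum_le_sum_abs _ _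
      _ ≤ ∑ A : P → Fin k → Bool, U * ∏ p : P, |gl0 i0 p (A p) * phi2 h i0 p (A p) n| := by
          refine sum_le_sum fun A _ => ?_
          rw [abs_mul, abs_prod]
          gcongr
          exact hU A
      _ = U * ∏ p : P, ∑ l : Fin k → Bool, |gl0 i0 p l * phi2 h i0 p l n| := by
          rw [← mul_sum]
          have := Finset.prod_univ_sum (fun _ : P => (univ : Finset (Fin k → Bool))) (fun p l => |gl0 i0 p l * phi2 h i0 p l n|)
          rw [Fintype.piFinset_univ] at this
          rw [← this]
      _ ≤ U * ∏ p : P, ∏ i, ((1 + 1 / (((p:ℕ):ℝ) - 1)) * (if ((p:ℕ):ℤ) ∣ n + h i then 2 else 1)) := by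
          gcongr with p _
          exact local_sum_le h i0 p (hP p p.2).two_le n
      _ = U * (EP P ^ k * ∏ i, (2:ℝ) ^ om i) := by
          congr 1
          rw [Finset.prod_comm]
          simp_rw [prod_mul_distrib]
          congr 1
          · rw [prod_const, card_univ, Fintype.card_fin, prod_coe_sort P (fun p => 1 + 1 / ((p:ℝ) - 1))]; rfl
          · refine prod_congr rfl fun i _ => ?_
            rw [prod_coe_sort P (fun p => if (p:ℤ) ∣ n + h i then (2:ℝ) else 1), prod_ite, prod_const_one, mul_one, prod_const]
  have i1 : Fin k := i0
  have hZ0 : 0 ≤ Z := (abs_nonneg _).trans (hn i0).2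
  set T : ℝ := ∏ i, (4:ℝ) ^ om i with hT
  have hT0 : 0 ≤ T := by positivity
  have hT4 : T ^ 4 ≤ Z := by
    have h1 : (T ^ 4) ^ k ≤ Z ^ k := by
      calc (T ^ 4) ^ k = ∏ i, ((2:ℝ) ^ (8 * k)) ^ om i := by
            rw [hT, ← pow_mul, ← prod_pow]
            refine prod_congr rfl fun i _ => ?_
            rw [show (4:ℝ) = 2 ^ 2 by norm_num, ← pow_mul, ← pow_mul, ← pow_mul]
            congr 1; ring
        _ ≤ ∏ _i : Fin k, Z := by
            refine prod_le_prod (fun _ _ => by positivity) fun i _ => ?_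
            refine le_trans ?_ (hn i).2
            have := two_pow_omega P hP _ hM (n + h i) (hn i).1
            have h2 : (((2 ^ (8 * k)) ^ om i : ℕ) : ℝ) ≤ ((n + h i).natAbs : ℝ) := by exact_mod_cast this
            push_cast at h2
            refine h2.trans (le_of_eq ?_)
            rw [Nat.cast_natAbs, Int.cast_abs]
        _ = Z ^ k := by rw [prod_const, card_univ, Fintype.card_fin]
    exact le_of_pow_le_pow_left₀ (by omega) hZ0 h1
  have hTZ : T ≤ Z ^ (1/4:ℝ) := by
    have := Real.rpow_le_rpow (by positivity) hT4 (by norm_num : (0:ℝ) ≤ 1/4)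
    rw [← Real.rpow_natCast, ← Real.rpow_mul hT0] at this
    norm_num at this ⊢
    exact this
  calc _ = |∑ A, u A * ∏ p : P, (gl0 i0 p (A p) * phi2 h i0 p (A p) n)| ^ 2 := (sq_abs _).symm
    _ ≤ (U * (EP P ^ k * ∏ i, (2:ℝ) ^ om i)) ^ 2 := by gcongr
    _ = U ^ 2 * EP P ^ (2 * k) * T := by
        rw [mul_pow, mul_pow, ← pow_mul, mul_comm k 2, hT, ← prod_pow, mul_assoc]
        congr 2
        refine prod_congr rfl fun i _ => ?_
        rw [← pow_mul, mul_comm, pow_mul]; norm_num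
    _ ≤ _ := by gcongr

/-- the sieve weight -/
def wt (h : Fin k → ℤ) (P : Finset ℕ) (ℓ : ℝ) (c : (Fin k → ℕ) → ℝ) (n : ℤ) : ℝ :=
  ∑ A : P → Fin k → Bool, c (cellA ℓ A) * ∏ p : P, (gl (p:ℕ) (A p) * phi1 h p (A p) n)

def Lp (N : ℕ) : ℝ := if N.Prime then vonMangoldt N else 0

theorem S2_prime (h : Fin k → ℤ) (hk : 1 ≤ k) (i0 : Fin k) (D Y x : ℕ) (hD : 2 ^ (8 * k) ≤ D) (hYx : Y < x)
    (hd : ∀ p ∈ PS D Y, DistP h p) (b : ℤ) (hb : Int.gcd (b + h i0) (primorial D) = 1)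
    (hx : ∀ i, |h i - h i0| < x) (ℓ : ℝ) (hℓ : 0 < ℓ) (K : ℕ) (hY : Real.exp (K * ℓ) ≤ Y)
    (c : (Fin k → ℕ) → ℝ) (hc : ∀ j, c j ≠ 0 → ∑ i, j i + k ≤ K)
    (hq : ∀ V ∈ VV (PS D Y) (Y * Y), qV (primorial D) V < x)
    (U : ℝ) (hU : ∀ j, |bw ℓ K (PS D Y) c i0 j| ≤ U) :
    X1 x / Nat.totient (primorial D) * (∑ j ∈ Fintype.piFinset (fun _ : Fin k => range K) with j i0 = 0,
        bw ℓ K (PS D Y) c i0 j ^ 2 * ∏ i ∈ univ.erase i0, SP (PS D Y) ℓ (j i) - U ^ 2 * (TT (k - 1) (PS D Y) * BB k (PS D Y)))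
      - U ^ 2 * ∑ V ∈ VV (PS D Y) (Y * Y), (Esup x (qV (primorial D) V) + ee x / Nat.totient (qV (primorial D) V)) * Ck k ^ V.card
      - ee x * (U ^ 2 * EP (PS D Y) ^ (2 * k) * (3 * x) ^ (1/4:ℝ))
    ≤ ∑ N ∈ Icc x (2 * x), Lp N * ind (primorial D) b (N - h i0) * wt h (PS D Y) ℓ c (N - h i0) ^ 2 := by
  set P := PS D Y with hPdef
  set W := primorial D with hW
  have hP : ∀ p ∈ P, p.Prime := PS_prime
  have hWpos : 0 < W := primorial_pos D
  have hcK : ∀ j, c j ≠ 0 → ∀ i, j i < K := by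
    intro j hj i
    have h1 := hc j hj
    have h2 := single_le_sum (f := fun i => j i) (fun _ _ => Nat.zero_le _) (mem_univ i)
    omega
  have hU0 : 0 ≤ U := (abs_nonneg _).trans (hU fun _ => 0)
  set u : (P → Fin k → Bool) → ℝ := fun A => if Z0 i0 A then bw ℓ K P c i0 (cellA ℓ A) else 0 with hu
  have huU : ∀ A, |u A| ≤ U := by
    intro A; simp only [hu]; split_ifs
    · exact hU _
    · simpa using hU0
  set w2 : ℤ → ℝ := fun n => ∑ A, u A * ∏ p : P, (gl0 i0 p (A p) * phi2 h i0 p (A p) n) with hw2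
  have hWφ : (0:ℝ) < Nat.totient W := by exact_mod_cast Nat.totient_pos.mpr hWpos
  have key := sieve_S2 h i0 P hP hd W hWpos (cop_PS D Y) b (Icc x (2 * x)) (fun N => vonMangoldt N) (X1 x / Nat.totient W)
    (div_nonneg (X1_nonneg x) hWφ.le) u U huU Y (fun A hA => RR_le2 hℓ hP K c hc i0 A hA Y hY)
    (fun V => Esup x (qV W V) + ee x / Nat.totient (qV W V))
    (fun V => add_nonneg (Esup_nonneg _ _) (div_nonneg (ee_nonneg _) (Nat.cast_nonneg _)))
    (fun V hV a ha hnd => by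
      have e : X1 x / Nat.totient W / ∏ p ∈ V, (((p:ℕ):ℝ) - 1) = X1 x / Nat.totient (qV W V) := by
        rw [qV_tot W hP (cop_PS D Y), div_div]
      rw [e]
      refine disc_bound_int x (qV W V) (Nat.mul_pos hWpos (prod_pos fun p _ => (hP p p.2).pos)) (hq V hV) a (h i0) ?_
      unfold qV
      rw [← Int.isCoprime_iff_gcd_eq_one]
      push_cast
      refine IsCoprime.mul_right ?_ ?_
      · rw [Int.isCoprime_iff_gcd_eq_one, ← hb, ← Int.gcd_emod (a + h i0), ← Int.gcd_emod (b + h i0)]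
        congr 1
        exact Int.ModEq.add_right _ ha
      · refine IsCoprime.prod_right fun p hp => ?_
        rw [isCoprime_comm, Prime.coprime_iff_not_dvd (Nat.prime_iff_prime_int.mp (hP p p.2))]
        exact hnd p hp)
  have hmain : ∑ A, u A ^ 2 * ∏ p : P, gl0 i0 p (A p)
      = ∑ j ∈ Fintype.piFinset (fun _ : Fin k => range K) with j i0 = 0,
        bw ℓ K P c i0 j ^ 2 * ∏ i ∈ univ.erase i0, SP P ℓ (j i) := by
    rw [← main_two ℓ K i0 (fun j => bw ℓ K P c i0 j ^ 2)]
    · refine sum_congr rfl fun A _ => ?_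
      rw [gl0_prod]
      simp only [hu]
      split_ifs
      · rfl
      · simp
    · intro j hj0 hj i
      have h1 : bw ℓ K P c i0 j ≠ 0 := fun h0 => hj (by simp [h0])
      unfold bw at h1
      obtain ⟨t, ht, h2⟩ := exists_ne_zero_of_sum_ne_zero h1
      have h3 := hcK _ (right_ne_zero_of_mul h2)
      by_cases hi : i = i0
      · rw [hi, hj0]; exact lt_of_le_of_lt (Nat.zero_le _) (mem_range.mp ht)
      · have := h3 i
        rwa [Function.update_of_ne hi] at this
  rw [hmain] at key
  have key2 := (abs_le.mp key).1
  -- split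
  have hsplit : ∑ N ∈ Icc x (2 * x), vonMangoldt N * ind W b (N - h i0) * w2 (N - h i0) ^ 2
      = ∑ N ∈ Icc x (2 * x), Lp N * ind W b (N - h i0) * wt h P ℓ c (N - h i0) ^ 2
        + ∑ N ∈ Icc x (2 * x), L2 N * ind W b (N - h i0) * w2 (N - h i0) ^ 2 := by
    rw [← sum_add_distrib]
    refine sum_congr rfl fun N hN => ?_
    rw [mem_Icc] at hN
    unfold Lp L2
    split_ifs with hp
    · have : wt h P ℓ c (N - h i0) = w2 (N - h i0) := by
        refine weight_reduce h i0 ℓ K c hcK _ fun p hpP hdvd => ?_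
        rw [sub_add_cancel, Int.natCast_dvd_natCast] at hdvd
        rw [Nat.prime_dvd_prime_iff_eq (hP p hpP) hp] at hdvd
        have := (mem_PS.mp hpP).1.2
        omega
      rw [this]; ring
    · ring
  have herr : ∑ N ∈ Icc x (2 * x), L2 N * ind W b (N - h i0) * w2 (N - h i0) ^ 2
      ≤ ee x * (U ^ 2 * EP P ^ (2 * k) * (3 * x) ^ (1/4:ℝ)) := by
    unfold ee
    rw [sum_mul]
    refine sum_le_sum fun N hN => ?_
    rw [mem_Icc] at hN
    have hpw := pointwise h hk i0 P hP (fun p hp => hD.trans (mem_PS.mp hp).1.1.le) u U huU (N - h i0) (3 * x) (fun i => by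
      have h1 := abs_lt.mp (hx i)
      have hN' : (x:ℤ) ≤ N ∧ (N:ℤ) ≤ 2 * x := by exact_mod_cast hN
      have h2 : 0 < (N:ℤ) - h i0 + h i := by linarith [h1.1, hN'.1]
      refine ⟨h2.ne', ?_⟩
      rw [abs_of_pos (by exact_mod_cast h2)]
      have h3 : (N:ℤ) - h i0 + h i ≤ 3 * x := by linarith [h1.2, hN'.2]
      exact_mod_cast h3)
    have hi1 : ind W b (N - h i0) ≤ 1 := by unfold ind; split_ifs <;> norm_num
    have hi0 : 0 ≤ ind W b (N - h i0) := by unfold ind; split_ifs <;> norm_num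
    have hL := L2_nonneg N
    calc L2 N * ind W b (N - h i0) * w2 (N - h i0) ^ 2 ≤ L2 N * 1 * w2 (N - h i0) ^ 2 := by gcongr
      _ = L2 N * w2 (N - h i0) ^ 2 := by ring
      _ ≤ _ := by gcongr
  simp only [hw2] at hsplit herr
  linarith

end
end MT

end

section

set_option linter.unusedSectionVars false
namespace MT
open Finset MeasureTheory Filter Topology

noncomputable section

section cells
variable {ι : Type} [Fintype ι] [DecidableEq ι]

def cell (N : ℕ) (j : ι → ℕ) : Set (ι → ℝ) := Set.univ.pi fun i => Set.Ico ((j i : ℝ) / N) (((j i : ℝ) + 1) / N)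

theorem meas_cell (N : ℕ) (j : ι → ℕ) : MeasurableSet (cell N j) :=
  MeasurableSet.univ_pi fun _ => measurableSet_Ico

theorem vol_cell (N : ℕ) (j : ι → ℕ) : volume (cell N j) = ENNReal.ofReal ((1 / (N:ℝ)) ^ Fintype.card ι) := by
  unfold cell
  rw [Real.volume_pi_Ico]
  have : ∀ i, ((j i : ℝ) + 1) / N - (j i : ℝ) / N = 1 / N := fun i => by ring
  simp_rw [this]
  rw [prod_const, card_univ, ENNReal.ofReal_pow (by positivity)]

theorem volr_cell (N : ℕ) (j : ι → ℕ) : volume.real (cell N j) = (1 / (N:ℝ)) ^ Fintype.card ι := by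
  rw [measureReal_def, vol_cell, ENNReal.toReal_ofReal (by positivity)]

theorem mem_cell {N : ℕ} (hN : 0 < N) (j : ι → ℕ) (y : ι → ℝ) :
    y ∈ cell N j ↔ ∀ i, 0 ≤ y i ∧ ⌊N * y i⌋₊ = j i := by
  have hN' : (0:ℝ) < N := by exact_mod_cast hN
  unfold cell
  simp only [Set.mem_univ_pi, Set.mem_Ico]
  refine forall_congr' fun i => ?_
  rw [div_le_iff₀ hN', lt_div_iff₀ hN']
  constructor
  · rintro ⟨h1, h2⟩
    have h0 : 0 ≤ y i := by
      by_contra h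
      have : y i * N < 0 := mul_neg_of_neg_of_pos (by linarith) hN'
      have h3 : (0:ℝ) ≤ j i := by positivity
      linarith
    refine ⟨h0, ?_⟩
    rw [Nat.floor_eq_iff (by positivity)]
    constructor <;> linarith
  · rintro ⟨h0, h1⟩
    rw [Nat.floor_eq_iff (by positivity)] at h1
    constructor <;> linarith

theorem disj_cell {N : ℕ} (hN : 0 < N) (S : Set (ι → ℕ)) : S.Pairwise (Function.onFun Disjoint (cell N)) := by
  intro j _ j' _ hne
  refine Set.disjoint_left.mpr fun y h1 h2 => hne ?_
  rw [mem_cell hN] at h1 h2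
  funext i
  rw [← (h1 i).2, (h2 i).2]

theorem cell_jensen {N : ℕ} (hN : 0 < N) (j : ι → ℕ) (F : (ι → ℝ) → ℝ) (h1 : Integrable F) (h2 : Integrable fun t => F t ^ 2) :
    (∫ t in cell N j, F t) ^ 2 ≤ (1 / (N:ℝ)) ^ Fintype.card ι * ∫ t in cell N j, F t ^ 2 := by
  set v : ℝ := (1 / (N:ℝ)) ^ Fintype.card ι with hv
  have hv0 : 0 < v := by positivity
  set a : ℝ := ∫ t in cell N j, F t with ha
  have key : 0 ≤ ∫ t in cell N j, (F t - a / v) ^ 2 := integral_nonneg fun t => by positivity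
  have hfin : volume (cell N j) ≠ ⊤ := by rw [vol_cell]; exact ENNReal.ofReal_ne_top
  have e : ∫ t in cell N j, (F t - a / v) ^ 2 = (∫ t in cell N j, F t ^ 2) - 2 * (a / v) * a + (a / v) ^ 2 * v := by
    have : ∀ t, (F t - a / v) ^ 2 = F t ^ 2 - 2 * (a / v) * F t + (a / v) ^ 2 := fun t => by ring
    simp_rw [this]
    have c1 : IntegrableOn (fun _ : ι → ℝ => (a / v) ^ 2) (cell N j) := integrableOn_const hfin
    have c2 : IntegrableOn (fun t => 2 * (a / v) * F t) (cell N j) := h1.integrableOn.const_mul _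
    have c3 : IntegrableOn (fun t => F t ^ 2 - 2 * (a / v) * F t) (cell N j) := h2.integrableOn.sub c2
    rw [integral_add c3 c1, integral_sub h2.integrableOn c2, integral_const_mul, setIntegral_const, volr_cell, smul_eq_mul, ← ha, ← hv]
    ring
  rw [e] at key
  have : (∫ t in cell N j, F t ^ 2) - 2 * (a / v) * a + (a / v) ^ 2 * v = (∫ t in cell N j, F t ^ 2) - a ^ 2 / v := by
    field_simp; ring
  rw [this, sub_nonneg, div_le_iff₀ hv0] at key
  linarith

theorem cell_avg {N : ℕ} (hN : 0 < N) (j : ι → ℕ) (f : (ι → ℝ) → ℝ) :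
    ⨍ y in Metric.closedBall (fun i => ((j i : ℝ) + 1 / 2) / N) (1 / (2 * N)), f y = (N:ℝ) ^ Fintype.card ι * ∫ y in cell N j, f y := by
  have hN' : (0:ℝ) < N := by exact_mod_cast hN
  have e : Metric.closedBall (fun i => ((j i : ℝ) + 1 / 2) / N) (1 / (2 * N)) = Set.Icc (fun i => (j i : ℝ) / N) (fun i => ((j i : ℝ) + 1) / N) := by
    rw [closedBall_pi _ (by positivity), ← Set.pi_univ_Icc]
    congr 1
    funext i
    rw [Real.closedBall_eq_Icc]
    congr 1 <;> field_simp <;> ring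
  have ae : cell N j =ᵐ[volume] Metric.closedBall (fun i => ((j i : ℝ) + 1 / 2) / N) (1 / (2 * N)) := by
    rw [e]
    exact Measure.univ_pi_Ico_ae_eq_Icc
  rw [setAverage_eq, ← setIntegral_congr_set ae, ← measureReal_congr ae, volr_cell, smul_eq_mul]
  congr 1
  simp

theorem cell_fatou (f : (ι → ℝ) → ℝ) (hf : Integrable f) (k : ℕ) (hk : 1 ≤ k) (hs : ∀ y, (∃ i, 1 < y i) → f y = 0) (ε : ℝ) (hε : 0 < ε) :
    ∀ᶠ N : ℕ in atTop, (∫ y in {y : ι → ℝ | ∀ i, 0 ≤ y i}, f y ^ 2) - ε ≤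
      ∑ j ∈ Fintype.piFinset (fun _ : ι => range (N + k)), (1 / (N:ℝ)) ^ Fintype.card ι * ((N:ℝ) ^ Fintype.card ι * ∫ y in cell N j, f y) ^ 2 := by
  set J := ∫ y in {y : ι → ℝ | ∀ i, 0 ≤ y i}, f y ^ 2 with hJ
  set a : ℕ → (ι → ℕ) → ℝ := fun N j => (N:ℝ) ^ Fintype.card ι * ∫ y in cell N j, f y with ha
  set B : ℕ → ℝ := fun N => ∑ j ∈ Fintype.piFinset (fun _ : ι => range (N + k)), (1 / (N:ℝ)) ^ Fintype.card ι * (a N j) ^ 2 with hB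
  have hB0 : ∀ N, 0 ≤ B N := fun N => sum_nonneg fun j _ => by positivity
  by_cases hJε : J - ε ≤ 0
  · exact Eventually.of_forall fun N => hJε.trans (hB0 N)
  push Not at hJε
  set g : ℕ → (ι → ℝ) → ENNReal := fun N y => ∑ j ∈ Fintype.piFinset (fun _ : ι => range (N + k)),
    (cell N j).indicator (fun _ => ENNReal.ofReal (a N j ^ 2)) y with hg
  have hgm : ∀ N, Measurable (g N) := fun N =>
    Finset.measurable_fun_sum _ fun j _ => measurable_const.indicator (meas_cell N j)
  have hgi : ∀ N, ∫⁻ y, g N y = ENNReal.ofReal (B N) := by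
    intro N
    rw [hg, lintegral_finsetSum _ fun j _ => measurable_const.indicator (meas_cell N j), hB, ENNReal.ofReal_sum_of_nonneg fun j _ => by positivity]
    refine sum_congr rfl fun j _ => ?_
    rw [lintegral_indicator_const (meas_cell N j), vol_cell, mul_comm, ENNReal.ofReal_mul (by positivity)]
  have hpt : ∀ᵐ y : ι → ℝ, (∀ i, 0 ≤ y i) → ENNReal.ofReal (f y ^ 2) ≤ liminf (fun N => g N y) atTop := by
    filter_upwards [IsUnifLocDoublingMeasure.ae_tendsto_average volume hf.locallyIntegrable 1] with y hy hy0
    by_cases h1 : ∃ i, 1 < y i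
    · rw [hs y h1]; simp
    push Not at h1
    set jj : ℕ → ι → ℕ := fun N i => ⌊N * y i⌋₊ with hjj
    have hmem : ∀ N : ℕ, 0 < N → y ∈ cell N (jj N) := fun N hN => (mem_cell hN _ _).mpr fun i => ⟨hy0 i, rfl⟩
    have h2 := hy (ι := ℕ) (l := atTop) (fun N i => ((jj N i : ℝ) + 1 / 2) / N) (fun N => 1 / (2 * N)) (by
      rw [tendsto_nhdsWithin_iff]
      constructor
      · have : Tendsto (fun N : ℕ => (1/2:ℝ) * (1 / (N:ℝ))) atTop (𝓝 ((1/2) * 0)) := tendsto_one_div_atTop_nhds_zero_nat.const_mul _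
        rw [mul_zero] at this
        refine this.congr fun N => by ring
      · filter_upwards [eventually_gt_atTop 0] with N hN
        have : (0:ℝ) < N := by exact_mod_cast hN
        exact Set.mem_Ioi.mpr (by positivity)) (by
      filter_upwards [eventually_gt_atTop 0] with N hN
      have hN' : (0:ℝ) < N := by exact_mod_cast hN
      rw [one_mul, closedBall_pi _ (by positivity), Set.mem_univ_pi]
      intro i
      rw [Real.closedBall_eq_Icc]
      have h3 := hmem N hN i (Set.mem_univ i)
      have e1 : ((jj N i : ℝ) + 1 / 2) / N - 1 / (2 * N) = (jj N i : ℝ) / N := by field_simp; ring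
      have e2 : ((jj N i : ℝ) + 1 / 2) / N + 1 / (2 * N) = ((jj N i : ℝ) + 1) / N := by field_simp; ring
      rw [e1, e2]
      exact ⟨h3.1, h3.2.le⟩)
    have h3 : Tendsto (fun N => ENNReal.ofReal (a N (jj N) ^ 2)) atTop (𝓝 (ENNReal.ofReal (f y ^ 2))) := by
      refine (ENNReal.continuous_ofReal.tendsto _).comp (Tendsto.pow ?_ 2)
      refine h2.congr' ?_
      filter_upwards [eventually_gt_atTop 0] with N hN
      exact cell_avg hN _ f
    rw [← h3.liminf_eq]
    refine liminf_le_liminf ?_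
    filter_upwards [eventually_gt_atTop 0] with N hN
    have hN' : (0:ℝ) < N := by exact_mod_cast hN
    have hin : jj N ∈ Fintype.piFinset (fun _ : ι => range (N + k)) := by
      rw [Fintype.mem_piFinset]
      intro i
      rw [mem_range]
      have : jj N i ≤ N := by
        have := Nat.floor_le_floor (mul_le_mul_of_nonneg_left (h1 i) hN'.le)
        simpa using this
      omega
    refine le_trans ?_ (single_le_sum (fun _ _ => zero_le) hin)
    rw [Set.indicator_of_mem (hmem N hN)]
  have hfa : ENNReal.ofReal J ≤ liminf (fun N => ENNReal.ofReal (B N)) atTop := by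
    have s0 : MeasurableSet {y : ι → ℝ | ∀ i, 0 ≤ y i} := by
      have : {y : ι → ℝ | ∀ i, 0 ≤ y i} = Set.univ.pi fun _ => Set.Ici 0 := by ext; simp [Pi.le_def]
      rw [this]
      exact MeasurableSet.univ_pi fun _ => measurableSet_Ici
    calc ENNReal.ofReal J ≤ ∫⁻ y in {y : ι → ℝ | ∀ i, 0 ≤ y i}, ENNReal.ofReal (f y ^ 2) := by
          have hm : AEStronglyMeasurable (fun y => f y ^ 2) (volume.restrict {y : ι → ℝ | ∀ i, 0 ≤ y i}) := (hf.1.pow 2).restrict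
          rw [hJ, integral_eq_lintegral_of_nonneg_ae (Eventually.of_forall fun y => by positivity) hm]
          exact ENNReal.ofReal_toReal_le
      _ ≤ ∫⁻ y in {y : ι → ℝ | ∀ i, 0 ≤ y i}, liminf (fun N => g N y) atTop := by
          refine lintegral_mono_ae ?_
          rw [ae_restrict_iff' s0]
          exact hpt
      _ ≤ liminf (fun N => ∫⁻ y in {y : ι → ℝ | ∀ i, 0 ≤ y i}, g N y) atTop := lintegral_liminf_le hgm
      _ ≤ _ := by
          refine liminf_le_liminf (Eventually.of_forall fun N => ?_)
          rw [← hgi N]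
          exact setLIntegral_le_lintegral _ _
  have hlt : ENNReal.ofReal (J - ε) < liminf (fun N => ENNReal.ofReal (B N)) atTop := by
    refine lt_of_lt_of_le ?_ hfa
    rw [ENNReal.ofReal_lt_ofReal_iff (by linarith)]
    linarith
  filter_upwards [eventually_lt_of_lt_liminf hlt] with N hN
  exact (ENNReal.ofReal_lt_ofReal_iff_of_nonneg hJε.le).mp hN |>.le

end cells

section fub
variable {k : ℕ}

def extE (i : Fin k) : (({j : Fin k // j ≠ i} → ℝ) × ℝ) ≃ᵐ (Fin k → ℝ) where
  toFun p := fun j => if h : j = i then p.2 else p.1 ⟨j, h⟩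
  invFun t := (fun j => t j, t i)
  left_inv p := by
    ext j
    · simp [j.2]
    · simp
  right_inv t := by
    ext j
    by_cases h : j = i
    · simp [h]
    · simp [h]
  measurable_toFun := by
    refine measurable_pi_lambda _ fun j => ?_
    by_cases h : j = i
    · simp only [Equiv.coe_fn_mk, h, dite_true]; fun_prop
    · simp only [Equiv.coe_fn_mk, h, dite_false]; fun_prop
  measurable_invFun := by
    simp only [Equiv.coe_fn_symm_mk]
    fun_prop

theorem extE_apply (i : Fin k) (y : {j : Fin k // j ≠ i} → ℝ) (s : ℝ) :
    extE i (y, s) = fun j => if h : j = i then s else y ⟨j, h⟩ := rfl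

theorem extE_pi (i : Fin k) (s : Fin k → Set ℝ) :
    extE i ⁻¹' Set.univ.pi s = (Set.univ.pi fun j : {j : Fin k // j ≠ i} => s j) ×ˢ s i := by
  ext ⟨y, t⟩
  simp only [Set.mem_preimage, Set.mem_univ_pi, Set.mem_prod, extE_apply]
  constructor
  · intro h
    refine ⟨fun j => ?_, ?_⟩
    · have := h j
      simpa [j.2] using this
    · have := h i
      simpa using this
  · rintro ⟨h1, h2⟩ j
    by_cases h : j = i
    · subst h; simpa using h2
    · simpa [h] using h1 ⟨j, h⟩

theorem extE_mp (i : Fin k) : MeasurePreserving (extE i) (volume.prod volume) volume := by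
  refine ⟨(extE i).measurable, ?_⟩
  rw [volume_pi]
  refine (Measure.pi_eq fun s hs => ?_).symm
  rw [(extE i).map_apply, extE_pi, Measure.prod_prod, Measure.pi_pi, Fintype.prod_eq_mul_prod_subtype_ne (fun j => volume (s j)) i, mul_comm]

theorem fub_cell (i : Fin k) (F : (Fin k → ℝ) → ℝ) (hF : Integrable F) (hs : ∀ t, t ∉ simplex k → F t = 0) {N : ℕ} (hN : 0 < N)
    (j : {j : Fin k // j ≠ i} → ℕ) :
    ∫ y in cell N j, (∫ s in Set.Ioi (0 : ℝ), F (fun j => if h : j = i then s else y ⟨j, h⟩)) =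
      ∑ t ∈ range (N + k), ∫ y in cell N (fun l => if h : l = i then t else j ⟨l, h⟩), F y := by
  have hN' : (0:ℝ) < N := by exact_mod_cast hN
  have hk : 1 ≤ k := Nat.one_le_iff_ne_zero.mpr fun h => by subst h; exact i.elim0
  have hG : Integrable (fun p => F (extE i p)) (volume.prod volume) :=
    (extE_mp i).integrable_comp_of_integrable hF
  set G := fun p => F (extE i p) with hGd
  set I : ℕ → Set ℝ := fun t => Set.Ico ((t:ℝ) / N) (((t:ℝ) + 1) / N) with hI
  have hIm : ∀ t s, s ∈ I t ↔ 0 ≤ s ∧ ⌊N * s⌋₊ = t := by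
    intro t s
    have := mem_cell (ι := Unit) hN (fun _ => t) (fun _ => s)
    simpa [cell, hI] using this
  have hU : ∀ s, s ∈ ⋃ t ∈ range (N + k), I t ↔ 0 ≤ s ∧ ⌊N * s⌋₊ < N + k := by
    intro s
    simp only [Set.mem_iUnion, hIm, exists_prop, mem_range]
    constructor
    · rintro ⟨t, h1, h2, h3⟩; exact ⟨h2, h3 ▸ h1⟩
    · rintro ⟨h1, h2⟩; exact ⟨_, h2, h1, rfl⟩
  have step1 : ∀ y : {j : Fin k // j ≠ i} → ℝ, ∫ s in Set.Ioi (0 : ℝ), F (fun j => if h : j = i then s else y ⟨j, h⟩) =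
      ∫ s in ⋃ t ∈ range (N + k), I t, G (y, s) := by
    intro y
    rw [← integral_Ici_eq_integral_Ioi]
    refine setIntegral_eq_of_subset_of_forall_sdiff_eq_zero measurableSet_Ici ?_ ?_
    · intro s hs'
      exact ((hU s).mp hs').1
    · rintro s ⟨h1, h2⟩
      refine hs _ fun h3 => h2 ((hU s).mpr ⟨h1, ?_⟩)
      have h4 := single_le_sum (f := fun l : Fin k => if h : l = i then s else y ⟨l, h⟩) (fun l _ => h3.1 l) (mem_univ i)
      have h5 : s ≤ 1 := by
        refine le_trans ?_ h3.2
        simpa using h4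
      have h6 : ⌊N * s⌋₊ ≤ N := by
        have := Nat.floor_le_floor (mul_le_mul_of_nonneg_left h5 hN'.le)
        simpa using this
      omega
  simp_rw [step1]
  rw [← setIntegral_prod G hG.integrableOn]
  have e2 : cell N j ×ˢ (⋃ t ∈ range (N + k), I t) = ⋃ t ∈ range (N + k), cell N j ×ˢ I t := by
    simp_rw [Set.prod_iUnion]
  rw [e2, integral_biUnion_finset _ (fun t _ => (meas_cell N j).prod measurableSet_Ico) ?_ (fun t _ => hG.integrableOn)]
  · refine sum_congr rfl fun t _ => ?_
    rw [← (extE_mp i).setIntegral_preimage_emb (extE i).measurableEmbedding]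
    congr 2
    unfold cell
    rw [extE_pi]
    congr 1
    · congr 1
      funext l
      simp [l.2]
    · simp
  · intro t _ t' _ hne
    refine Set.disjoint_left.mpr fun p h1 h2 => hne ?_
    rw [← ((hIm _ _).mp h1.2).2, ((hIm _ _).mp h2.2).2]

theorem fub_int (i : Fin k) (F : (Fin k → ℝ) → ℝ) (hF : Integrable F) :
    Integrable fun y : {j : Fin k // j ≠ i} → ℝ => ∫ s in Set.Ioi (0 : ℝ), F (fun j => if h : j = i then s else y ⟨j, h⟩) := by
  have hG : Integrable (fun p => F (extE i p)) (volume.prod volume) :=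
    (extE_mp i).integrable_comp_of_integrable hF
  have h2 : Integrable (fun p => F (extE i p)) (volume.prod (volume.restrict (Set.Ioi (0:ℝ)))) := by
    have := hG.integrableOn (s := Set.univ ×ˢ Set.Ioi (0:ℝ))
    rwa [IntegrableOn, ← Measure.prod_restrict, Measure.restrict_univ] at this
  exact h2.integral_prod_left

theorem simplex_le (t : Fin k → ℝ) (h : t ∈ simplex k) (i : Fin k) : t i ≤ 1 :=
  (single_le_sum (f := t) (fun l _ => h.1 l) (mem_univ i)).trans h.2

theorem sum_update (i : Fin k) (K : ℕ) (hK : 0 < K) (φ : (Fin k → ℕ) → ℝ) :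
    ∑ j ∈ Fintype.piFinset (fun _ : Fin k => range K) with j i = 0, (∑ t ∈ range K, φ (Function.update j i t)) ^ 2 =
    ∑ j ∈ Fintype.piFinset (fun _ : {j : Fin k // j ≠ i} => range K), (∑ t ∈ range K, φ (fun l => if h : l = i then t else j ⟨l, h⟩)) ^ 2 := by
  refine sum_nbij' (fun j l => j l) (fun j l => if h : l = i then 0 else j ⟨l, h⟩) ?_ ?_ ?_ ?_ ?_
  · intro j hj
    simp only [mem_filter, Fintype.mem_piFinset] at hj ⊢
    exact fun l => hj.1 l
  · intro j hj
    simp only [mem_filter, Fintype.mem_piFinset, mem_range] at hj ⊢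
    refine ⟨fun l => ?_, by simp⟩
    split_ifs
    · exact hK
    · exact hj _
  · intro j hj
    simp only [mem_filter, Fintype.mem_piFinset] at hj
    funext l
    by_cases h : l = i
    · subst h; simp [hj.2]
    · simp [h]
  · intro j _
    funext l
    simp [l.2]
  · intro j _
    congr 1
    refine sum_congr rfl fun t _ => congr_arg φ ?_
    funext l
    by_cases h : l = i
    · subst h; simp
    · simp [h]

theorem analytic (k : ℕ) (ρ : ℝ) (hk : 1 ≤ k) (hρ : 0 < ρ) (hM : ρ < Mquant k) :
    ∃ (K : ℕ) (c : (Fin k → ℕ) → ℝ), (∀ j, c j ≠ 0 → ∑ i, j i + k ≤ K) ∧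
      ρ * K * ∑ j ∈ Fintype.piFinset (fun _ : Fin k => range K), c j ^ 2 <
        ∑ i : Fin k, ∑ j ∈ Fintype.piFinset (fun _ : Fin k => range K) with j i = 0, (∑ t ∈ range K, c (Function.update j i t)) ^ 2 := by
  have hne : {r : ℝ | ∃ F : (Fin k → ℝ) → ℝ, MemLp F 2 volume ∧
    (∀ t, t ∉ simplex k → F t = 0) ∧ ¬ (F =ᵐ[volume] 0) ∧
    r = (∑ i, sieveJ i F) / sieveI F}.Nonempty := by
    by_contra h
    rw [Set.not_nonempty_iff_eq_empty] at h
    rw [Mquant, h, Real.sSup_empty] at hM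
    linarith
  obtain ⟨r, ⟨F, hF2, hs, -, hr⟩, hlt⟩ := exists_lt_of_lt_csSup hne hM
  have hsq : Integrable fun t => F t ^ 2 := hF2.integrable_sq
  have hFi : Integrable F := by
    have hsub : Function.support F ⊆ Set.Icc 0 1 := by
      intro t ht
      by_contra h
      refine ht (hs t fun h2 => h ⟨fun i => h2.1 i, fun i => simplex_le t h2 i⟩)
    rw [← integrableOn_iff_integrable_of_support_subset hsub]
    have hfin : IsFiniteMeasure (volume.restrict (Set.Icc (0 : Fin k → ℝ) 1)) := ⟨by
      rw [Measure.restrict_apply_univ]; exact isCompact_Icc.measure_lt_top⟩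
    exact (hF2.restrict _).integrable (by norm_num)
  have hI0 : 0 ≤ sieveI F := integral_nonneg fun t => by positivity
  have hI : 0 < sieveI F := by
    rcases hI0.lt_or_eq with h | h
    · exact h
    · rw [← h, div_zero] at hr; linarith
  rw [hr, lt_div_iff₀ hI] at hlt
  set Jt := ∑ i, sieveJ i F with hJt
  obtain ⟨ε, hε, hε2⟩ : ∃ ε > 0, (ρ + ε) * sieveI F + k * ε < Jt := by
    refine ⟨(Jt - ρ * sieveI F) / (2 * (sieveI F + k)), ?_, ?_⟩
    · have : 0 < Jt - ρ * sieveI F := by linarith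
      positivity
    have e : (ρ + (Jt - ρ * sieveI F) / (2 * (sieveI F + k))) * sieveI F + k * ((Jt - ρ * sieveI F) / (2 * (sieveI F + k)))
      = ρ * sieveI F + (Jt - ρ * sieveI F) / 2 := by field_simp; ring
    rw [e]; linarith
  have hev : ∀ᶠ N : ℕ in atTop, ∀ i : Fin k, sieveJ i F - ε ≤
      ∑ j ∈ Fintype.piFinset (fun _ : {j : Fin k // j ≠ i} => range (N + k)), (1 / (N:ℝ)) ^ Fintype.card {j : Fin k // j ≠ i} *
        ((N:ℝ) ^ Fintype.card {j : Fin k // j ≠ i} * ∫ y in cell N j, (∫ s in Set.Ioi (0 : ℝ), F (fun j => if h : j = i then s else y ⟨j, h⟩))) ^ 2 := by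
    rw [eventually_all]
    intro i
    exact cell_fatou _ (fub_int i F hFi) k hk (by
      rintro y ⟨l, hl⟩
      have : ∀ s, F (fun j => if h : j = i then s else y ⟨j, h⟩) = 0 := by
        intro s
        refine hs _ fun h2 => ?_
        have := simplex_le _ h2 l
        simp [l.2] at this
        linarith
      simp [this]) ε hε
  have hbig : ∀ᶠ N : ℕ in atTop, ρ * k ≤ ε * N := by
    have : Tendsto (fun N : ℕ => ε * (N:ℝ)) atTop atTop := tendsto_natCast_atTop_atTop.const_mul_atTop hε
    exact this.eventually_ge_atTop _
  obtain ⟨N, hN1, hN2, hN⟩ := (hev.and (hbig.and (eventually_gt_atTop 0))).exists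
  have hN' : (0:ℝ) < N := by exact_mod_cast hN
  refine ⟨N + k, fun j => (N:ℝ) ^ k * ∫ t in cell N j, F t, ?_, ?_⟩
  · intro j hj
    by_contra hlt
    push Not at hlt
    refine hj ?_
    have : ∫ t in cell N j, F t = 0 := by
      rw [setIntegral_congr_fun (g := fun _ => (0:ℝ)) (meas_cell N j)]
      · simp
      · intro t ht
        refine hs t fun h2 => ?_
        have h3 : ∑ i, (j i : ℝ) / N ≤ ∑ i, t i := sum_le_sum fun i _ => (ht i (Set.mem_univ i)).1
        rw [← sum_div, div_le_iff₀ hN'] at h3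
        have h4 : (∑ i, (j i : ℝ)) ≤ N := by nlinarith [h2.2]
        have h5 : ∑ i, j i ≤ N := by exact_mod_cast h4
        omega
    simp only [this, mul_zero]
  have hIN : ∑ j ∈ Fintype.piFinset (fun _ : Fin k => range (N + k)), ((N:ℝ) ^ k * ∫ t in cell N j, F t) ^ 2 ≤ (N:ℝ) ^ k * sieveI F := by
    calc _ ≤ ∑ j ∈ Fintype.piFinset (fun _ : Fin k => range (N + k)), (N:ℝ) ^ k * ∫ t in cell N j, F t ^ 2 := by
          refine sum_le_sum fun j _ => ?_
          have := cell_jensen hN j F hFi hsq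
          rw [Fintype.card_fin] at this
          calc ((N:ℝ) ^ k * ∫ t in cell N j, F t) ^ 2 = ((N:ℝ) ^ k) ^ 2 * (∫ t in cell N j, F t) ^ 2 := by ring
            _ ≤ ((N:ℝ) ^ k) ^ 2 * ((1 / (N:ℝ)) ^ k * ∫ t in cell N j, F t ^ 2) := by gcongr
            _ = _ := by
                rw [one_div, inv_pow]; field_simp
      _ = (N:ℝ) ^ k * ∫ t in ⋃ j ∈ Fintype.piFinset (fun _ : Fin k => range (N + k)), cell N j, F t ^ 2 := by
          rw [integral_biUnion_finset _ (fun j _ => meas_cell N j) (disj_cell hN _) (fun j _ => hsq.integrableOn), mul_sum]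
      _ ≤ _ := by
          gcongr
          refine setIntegral_mono_set hsq.integrableOn (Eventually.of_forall fun t => by positivity) (LE.le.eventuallyLE ?_)
          intro t ht
          simp only [Set.mem_iUnion, exists_prop] at ht
          obtain ⟨j, _, hj⟩ := ht
          exact fun i => ((mem_cell hN _ _).mp hj i).1
  set S := ∑ j ∈ Fintype.piFinset (fun _ : Fin k => range (N + k)), ((N:ℝ) ^ k * ∫ t in cell N j, F t) ^ 2 with hS
  have hS0 : 0 ≤ S := sum_nonneg fun _ _ => by positivity
  have hJN : ∀ i : Fin k, (N:ℝ) ^ (k + 1) * (sieveJ i F - ε) ≤ ∑ j ∈ Fintype.piFinset (fun _ : Fin k => range (N + k)) with j i = 0,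
      (∑ t ∈ range (N + k), (N:ℝ) ^ k * ∫ t in cell N (Function.update j i t), F t) ^ 2 := by
    intro i
    rw [sum_update i (N + k) (by omega) (fun j => (N:ℝ) ^ k * ∫ t in cell N j, F t)]
    refine (mul_le_mul_of_nonneg_left (hN1 i) (by positivity)).trans (le_of_eq ?_)
    rw [mul_sum]
    refine sum_congr rfl fun j _ => ?_
    have hcard : Fintype.card {j : Fin k // j ≠ i} = k - 1 := by simp
    rw [fub_cell i F hFi hs hN, ← mul_sum, hcard]
    obtain ⟨k', rfl⟩ : ∃ k', k = k' + 1 := ⟨k - 1, by omega⟩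
    rw [Nat.add_sub_cancel, one_div, inv_pow]
    field_simp
    ring
  have hsum := sum_le_sum fun i (_ : i ∈ (univ : Finset (Fin k))) => hJN i
  rw [← mul_sum, sum_sub_distrib, sum_const, card_univ, Fintype.card_fin, nsmul_eq_mul, ← hJt] at hsum
  refine lt_of_lt_of_le ?_ hsum
  calc ρ * ((N + k : ℕ):ℝ) * S ≤ ((ρ + ε) * N) * S := by
        refine mul_le_mul_of_nonneg_right ?_ hS0
        push_cast
        nlinarith
    _ ≤ ((ρ + ε) * N) * ((N:ℝ) ^ k * sieveI F) := by gcongr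
    _ = (N:ℝ) ^ (k + 1) * ((ρ + ε) * sieveI F) := by ring
    _ < _ := by
        gcongr
        linarith

end fub

end
end MT

end

section

set_option linter.unusedSectionVars false
namespace MT
open Finset Filter

noncomputable section
variable {k : ℕ}

def qq1 (K : ℕ) (c : (Fin k → ℕ) → ℝ) (s : ℕ → ℝ) : ℝ :=
  ∑ j ∈ Fintype.piFinset (fun _ : Fin k => range K), c j ^ 2 * ∏ i, s (j i)

def qq2 (K : ℕ) (c : (Fin k → ℕ) → ℝ) (i0 : Fin k) (s : ℕ → ℝ) : ℝ :=
  ∑ j ∈ Fintype.piFinset (fun _ : Fin k => range K) with j i0 = 0,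
    (∑ t ∈ range K, s t * c (Function.update j i0 t)) ^ 2 * ∏ i ∈ univ.erase i0, s (j i)

theorem cont_delta (K : ℕ) (q : (ℕ → ℝ) → ℝ) (hq : Continuous q) (hloc : ∀ s s' : ℕ → ℝ, (∀ j < K, s j = s' j) → q s = q s')
    (ε : ℝ) (hε : 0 < ε) : ∃ δ > 0, ∀ s : ℕ → ℝ, (∀ j < K, |s j - 1| ≤ δ) → |q s - q (fun _ => 1)| ≤ ε := by
  set e : (Fin K → ℝ) → (ℕ → ℝ) := fun s n => if h : n < K then s ⟨n, h⟩ else 1 with he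
  have hec : Continuous e := by
    refine continuous_pi fun n => ?_
    by_cases h : n < K
    · simp only [he, h, dite_true]; fun_prop
    · simp only [he, h, dite_false]; fun_prop
  obtain ⟨δ, hδ, h⟩ := Metric.continuousAt_iff.mp ((hq.comp hec).continuousAt (x := fun _ => 1)) ε hε
  refine ⟨δ / 2, by positivity, fun s hs => ?_⟩
  have h1 := h (x := fun n => s n) (lt_of_le_of_lt ((dist_pi_le_iff (by positivity)).mpr fun n => by
    rw [Real.dist_eq]; exact hs n n.2) (by linarith : δ / 2 < δ))
  simp only [Function.comp] at h1
  rw [hloc s (e fun n => s n) fun j hj => by simp [he, hj], hloc (fun _ => 1) (e fun _ => 1) fun j hj => by simp [he]]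
  exact h1.le

theorem qq1_cont (K : ℕ) (c : (Fin k → ℕ) → ℝ) : Continuous (qq1 K c) := by
  unfold qq1; fun_prop

theorem qq2_cont (K : ℕ) (c : (Fin k → ℕ) → ℝ) (i0 : Fin k) : Continuous (qq2 K c i0) := by
  unfold qq2; fun_prop

theorem qq1_loc (K : ℕ) (c : (Fin k → ℕ) → ℝ) (s s' : ℕ → ℝ) (h : ∀ j < K, s j = s' j) : qq1 K c s = qq1 K c s' := by
  refine sum_congr rfl fun j hj => ?_
  rw [Fintype.mem_piFinset] at hj
  rw [prod_congr rfl fun i _ => h (j i) (mem_range.mp (hj i))]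

theorem qq2_loc (K : ℕ) (c : (Fin k → ℕ) → ℝ) (i0 : Fin k) (s s' : ℕ → ℝ) (h : ∀ j < K, s j = s' j) : qq2 K c i0 s = qq2 K c i0 s' := by
  refine sum_congr rfl fun j hj => ?_
  rw [mem_filter, Fintype.mem_piFinset] at hj
  rw [prod_congr rfl fun i _ => h (j i) (mem_range.mp (hj.1 i)), sum_congr rfl fun t ht => by rw [h t (mem_range.mp ht)]]

theorem qq1_scale (K : ℕ) (c : (Fin k → ℕ) → ℝ) (s : ℕ → ℝ) (L : ℝ) (hL : 0 < L) :
    qq1 K c s = L ^ k * qq1 K c (fun j => s j / L) := by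
  unfold qq1
  rw [mul_sum]
  refine sum_congr rfl fun j _ => ?_
  rw [prod_div_distrib, prod_const, card_univ, Fintype.card_fin]
  field_simp

theorem qq2_scale (hk : 1 ≤ k) (K : ℕ) (c : (Fin k → ℕ) → ℝ) (i0 : Fin k) (s : ℕ → ℝ) (L : ℝ) (hL : 0 < L) :
    qq2 K c i0 s = L ^ (k + 1) * qq2 K c i0 (fun j => s j / L) := by
  unfold qq2
  rw [mul_sum]
  refine sum_congr rfl fun j _ => ?_
  have e : ∑ t ∈ range K, s t / L * c (Function.update j i0 t) = (∑ t ∈ range K, s t * c (Function.update j i0 t)) / L := by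
    rw [sum_div]
    exact sum_congr rfl fun t _ => by ring
  rw [prod_div_distrib, prod_const, card_erase_of_mem (mem_univ _), card_univ, Fintype.card_fin, e]
  obtain ⟨k', rfl⟩ : ∃ k', k = k' + 1 := ⟨k - 1, by omega⟩
  rw [Nat.add_sub_cancel]
  field_simp
  ring

theorem ee_nonneg2 (x : ℕ) : 0 ≤ ee x := sum_nonneg fun _ _ => L2_nonneg _

theorem ee_ev : ∀ᶠ x : ℕ in atTop, ee x * (3 * (x:ℝ)) ^ (1/4:ℝ) ≤ 24 * Real.log x * (x:ℝ) ^ (3/4:ℝ) := by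
  filter_upwards [eventually_ge_atTop 2] with x hx
  have hx2 : (2:ℝ) ≤ x := by exact_mod_cast hx
  have hl : Real.log (2 * x) ≤ 2 * Real.log x := by
    rw [Real.log_mul (by norm_num) (by positivity)]
    linarith [Real.log_le_log (by norm_num) hx2]
  have hs : √(2 * x) ≤ 2 * (x:ℝ) ^ (1/2:ℝ) := by
    rw [← Real.sqrt_eq_rpow, Real.sqrt_mul (by norm_num)]
    gcongr
    rw [Real.sqrt_le_left (by norm_num)]; norm_num
  have h3 : (3 * (x:ℝ)) ^ (1/4:ℝ) ≤ 3 * (x:ℝ) ^ (1/4:ℝ) := by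
    rw [Real.mul_rpow (by norm_num) (by positivity)]
    gcongr
    calc (3:ℝ) ^ (1/4:ℝ) ≤ 3 ^ (1:ℝ) := Real.rpow_le_rpow_of_exponent_le (by norm_num) (by norm_num)
      _ = 3 := Real.rpow_one 3
  have hl0 : 0 ≤ Real.log x := Real.log_natCast_nonneg x
  calc _ ≤ (2 * (2 * (x:ℝ) ^ (1/2:ℝ)) * (2 * Real.log x)) * (3 * (x:ℝ) ^ (1/4:ℝ)) := by
        gcongr
        refine (ee_le x (by omega)).trans ?_
        have : 0 ≤ Real.log (2 * x) := Real.log_nonneg (by linarith)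
        gcongr
    _ = 24 * Real.log x * ((x:ℝ) ^ (1/2:ℝ) * (x:ℝ) ^ (1/4:ℝ)) := by ring
    _ = _ := by rw [← Real.rpow_add (by linarith)]; norm_num

theorem ee_small (ε : ℝ) (hε : 0 < ε) : ∀ᶠ x : ℕ in atTop, ee x ≤ ε * x := by
  filter_upwards [ee_ev, ev_log (24 / ε) 1 (3/4) (by norm_num), eventually_ge_atTop 1] with x h1 h2 h3
  have hx : (1:ℝ) ≤ x := by exact_mod_cast h3
  have h4 : 1 ≤ (3 * (x:ℝ)) ^ (1/4:ℝ) := Real.one_le_rpow (by linarith) (by norm_num)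
  have h5 : ee x ≤ ee x * (3 * (x:ℝ)) ^ (1/4:ℝ) := le_mul_of_one_le_right (ee_nonneg2 x) h4
  rw [pow_one] at h2
  have h6 : 24 * Real.log x * (x:ℝ) ^ (3/4:ℝ) ≤ ε * x := by
    calc _ = ε * (24 / ε * Real.log x * (x:ℝ) ^ (3/4:ℝ)) := by field_simp
      _ ≤ _ := by gcongr
  linarith

theorem wt_S1 (h : Fin k → ℤ) (D Y : ℕ) (hd : ∀ p ∈ PS D Y, DistP h p) (b m m' : ℤ) (hm : m ≤ m')
    (ℓ : ℝ) (hℓ : 0 < ℓ) (K : ℕ) (hY : Real.exp (K * ℓ) ≤ Y)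
    (c : (Fin k → ℕ) → ℝ) (hc : ∀ j, c j ≠ 0 → ∑ i, j i + k ≤ K) (hk : 1 ≤ k) (cm : ℝ) (hcm : ∀ j, |c j| ≤ cm) :
    ∑ n ∈ Ioc m m', ind (primorial D) b n * wt h (PS D Y) ℓ c n ^ 2 ≤
      ((m' - m : ℝ) / primorial D) * (qq1 K c (SP (PS D Y) ℓ) + cm ^ 2 * (TT k (PS D Y) * BB k (PS D Y)))
        + cm ^ 2 * ∑ V ∈ VV (PS D Y) (Y * Y), Ck k ^ V.card := by
  have h1 := sieve_S1 h (PS D Y) PS_prime hd (primorial D) (primorial_pos D) (cop_PS D Y) b m m' hm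
    (fun A => c (cellA ℓ A)) cm (fun A => hcm _) Y (fun A hA => RR_le hℓ PS_prime K A (hc _ hA) Y hY)
  have h2 := main_one (P := PS D Y) ℓ K (fun j => c j ^ 2) (fun j hj i => by
    have h1 := hc j (fun h => hj (by simp [h]))
    have h2 := single_le_sum (f := fun i => j i) (fun _ _ => Nat.zero_le _) (mem_univ i)
    omega)
  rw [h2] at h1
  have h3 := (abs_le.mp h1).2
  unfold wt qq1
  linarith

section ev
variable (h : Fin k → ℤ) (hk : 1 ≤ k) (θ' : ℝ) (h0 : 0 < θ') (h1 : θ' < 1) (K : ℕ) (hK : 0 < K)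
  (c : (Fin k → ℕ) → ℝ) (hc : ∀ j, c j ≠ 0 → ∑ i, j i + k ≤ K) (cm : ℝ) (hcm : ∀ j, |c j| ≤ cm) (D : ℕ)
  (hd : ∀ Y, ∀ p ∈ PS D Y, DistP h p) (b : ℤ) (ε : ℝ) (hε : 0 < ε)

def lx (θ' : ℝ) (K : ℕ) (x : ℕ) : ℝ := θ' * Real.log x / (2 * K)
def Lx (θ' : ℝ) (K D : ℕ) (x : ℕ) : ℝ := dens (primorial D) * lx θ' K x
def lam (θ' : ℝ) (K D : ℕ) : ℝ := dens (primorial D) * (θ' / (2 * K))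

theorem Lx_eq (θ' : ℝ) (K D x : ℕ) : Lx θ' K D x = lam θ' K D * Real.log x := by
  unfold Lx lam lx; ring

include h0 hK in
theorem lam_pos : 0 < lam θ' K D := by
  have := dens_pos (primorial_pos D)
  have : (0:ℝ) < K := by exact_mod_cast hK
  unfold lam; positivity

include h0 hK in
theorem lx_facts (x : ℕ) (hx : 1 ≤ Real.log x) : 0 < lx θ' K x ∧ 0 < Lx θ' K D x ∧ Real.exp (K * lx θ' K x) ≤ Yx θ' x := by
  have hK' : (0:ℝ) < K := by exact_mod_cast hK
  have hx0 : (0:ℝ) < x := by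
    rcases Nat.eq_zero_or_pos x with h | h
    · subst h; simp at hx; linarith
    · exact_mod_cast h
  refine ⟨by unfold lx; positivity, ?_, ?_⟩
  · rw [Lx_eq]
    have := lam_pos θ' h0 K hK D
    positivity
  · refine le_trans (le_of_eq ?_) (Nat.le_ceil _)
    rw [Real.rpow_def_of_pos hx0]
    congr 1
    unfold lx
    field_simp

include hk h0 h1 hK hc hcm hd hε in
theorem S1_ev (Hb : ℕ) (Q1 : ℝ) (hQ0 : 0 ≤ Q1)
    (hQ : ∀ᶠ x : ℕ in atTop, qq1 K c (fun j => SP (PS D (Yx θ' x)) (lx θ' K x) j / Lx θ' K D x) ≤ Q1 + ε)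
    (hT : ∀ᶠ x : ℕ in atTop, cm ^ 2 * (TT k (PS D (Yx θ' x)) * BB k (PS D (Yx θ' x))) ≤ ε * Lx θ' K D x ^ k) :
    ∀ᶠ x : ℕ in atTop, ∑ n ∈ Ioc ((x:ℤ) - Hb - 1) (2 * x + Hb), ind (primorial D) b n * wt h (PS D (Yx θ' x)) (lx θ' K x) c n ^ 2
      ≤ (x / primorial D) * Lx θ' K D x ^ k * ((1 + ε) * (Q1 + 2 * ε) + ε) := by
  have hW : (0:ℝ) < primorial D := by exact_mod_cast primorial_pos D
  have hlam := lam_pos θ' h0 K hK D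
  filter_upwards [hQ, hT, ev_log_ge 1, ev_log_ge (cm ^ 2 * primorial D / (ε * lam θ' K D ^ k)), err1 θ' h0 h1 D (Ck k) (Ck_pos k).le 0,
    (tendsto_natCast_atTop_atTop (R := ℝ)).eventually_ge_atTop ((2 * Hb + 1) / ε)] with x hQ hT hl hl2 he hx
  obtain ⟨a1, a2, a3⟩ := lx_facts θ' h0 K hK D x hl
  have key := wt_S1 h D (Yx θ' x) (hd _) b ((x:ℤ) - Hb - 1) (2 * x + Hb) (by omega) (lx θ' K x) a1 K a3 c hc hk cm hcm
  refine key.trans ?_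
  rw [qq1_scale K c _ _ a2]
  rw [div_le_iff₀ hε] at hx
  rw [div_le_iff₀ (by positivity)] at hl2
  have e1 : (((2 * x + Hb : ℤ):ℝ) - (((x:ℤ) - Hb - 1 : ℤ):ℝ)) ≤ (1 + ε) * x := by
    push_cast; linarith
  have hx0 : (0:ℝ) ≤ x := by positivity
  have e2 : cm ^ 2 * ∑ V ∈ VV (PS D (Yx θ' x)) (Yx θ' x * Yx θ' x), Ck k ^ V.card ≤ (x / primorial D) * Lx θ' K D x ^ k * ε := by
    rw [pow_zero, div_one] at he
    calc _ ≤ cm ^ 2 * x := by gcongr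
      _ = (x / primorial D) * (cm ^ 2 * primorial D) := by field_simp
      _ ≤ (x / primorial D) * (Real.log x * (ε * lam θ' K D ^ k)) := by gcongr
      _ ≤ (x / primorial D) * (Real.log x ^ k * (ε * lam θ' K D ^ k)) := by
          gcongr
          exact le_self_pow₀ hl (by omega)
      _ = _ := by rw [Lx_eq, mul_pow]; ring
  have e3 : Lx θ' K D x ^ k * qq1 K c (fun j => SP (PS D (Yx θ' x)) (lx θ' K x) j / Lx θ' K D x) ≤ Lx θ' K D x ^ k * (Q1 + ε) := by
    gcongr
  calc _ ≤ ((1 + ε) * x / primorial D) * (Lx θ' K D x ^ k * (Q1 + ε) + ε * Lx θ' K D x ^ k) + (x / primorial D) * Lx θ' K D x ^ k * ε := by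
        gcongr ?_ + ?_
        calc _ ≤ ((((2 * x + Hb : ℤ):ℝ) - (((x:ℤ) - Hb - 1 : ℤ):ℝ)) / primorial D) * (Lx θ' K D x ^ k * (Q1 + ε) + ε * Lx θ' K D x ^ k) := by
              refine mul_le_mul_of_nonneg_left (by linarith) (div_nonneg ?_ hW.le)
              push_cast
              have : (0:ℝ) ≤ Hb := by positivity
              linarith
          _ ≤ _ := by
              gcongr
    _ = _ := by ring

include hk h0 hK hc hcm hd hε in
theorem S2_ev (θ : ℝ) (hθ' : θ' < θ) (hθ : θ < 1) (hEH : EH θ) (hD : 2 ^ (8 * k) ≤ D) (hb : ∀ i, Int.gcd (b + h i) (primorial D) = 1) (Q2 CT : ℝ) (hCT : 0 ≤ CT)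
    (hε1 : 2 * ε ≤ 1) (hQ0 : 2 * ε ≤ Q2)
    (hSP : ∀ᶠ x : ℕ in atTop, ∀ j < K, |SP (PS D (Yx θ' x)) (lx θ' K x) j| ≤ 2 * Lx θ' K D x)
    (hEP : ∀ᶠ x : ℕ in atTop, EP (PS D (Yx θ' x)) ≤ CT * Lx θ' K D x)
    (hQ : ∀ᶠ x : ℕ in atTop, Q2 - ε ≤ ∑ i, qq2 K c i (fun j => SP (PS D (Yx θ' x)) (lx θ' K x) j / Lx θ' K D x))
    (hT : ∀ᶠ x : ℕ in atTop, k * ((2 * K * cm * Lx θ' K D x) ^ 2 * (TT (k - 1) (PS D (Yx θ' x)) * BB k (PS D (Yx θ' x)))) ≤ ε * Lx θ' K D x ^ (k + 1)) :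
    ∀ᶠ x : ℕ in atTop, (1 - 2 * ε) * x ≤ X1 x → (x / primorial D) * Lx θ' K D x ^ k * (lx θ' K x * ((1 - 2 * ε) * (Q2 - 2 * ε)) - ε * Real.log x) ≤
      ∑ i, ∑ N ∈ Icc x (2 * x), Lp N * ind (primorial D) b (N - h i) * wt h (PS D (Yx θ' x)) (lx θ' K x) c (N - h i) ^ 2 := by
  have hW : (0:ℝ) < primorial D := by exact_mod_cast primorial_pos D
  have hlam := lam_pos θ' h0 K hK D
  have hcm0 : 0 ≤ cm := (abs_nonneg _).trans (hcm fun _ => 0)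
  have hhx : ∀ᶠ x : ℕ in atTop, ∀ i i0 : Fin k, |h i - h i0| < x := by
    rw [eventually_all]; intro i; rw [eventually_all]; intro i0
    filter_upwards [eventually_gt_atTop (|h i - h i0|).toNat] with x hx
    omega
  set G : ℝ := 24 * (k * (2 * K * cm) ^ 2 * lam θ' K D ^ 2 * (CT * lam θ' K D) ^ (2 * k)) with hG
  have hk' : (1:ℝ) ≤ k := by exact_mod_cast hk
  filter_upwards [hSP, hEP, hQ, hT, hhx, ev_log_ge 1, ev_log_ge ((k * (2 * K * cm) ^ 2 * lam θ' K D ^ 2 + 1) * primorial D / (ε * lam θ' K D ^ k)),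
    err2 θ θ' h0 hθ' hθ hEH D (Ck k) (Ck_pos k).le 2, Yx_facts θ' h0 (hθ'.trans hθ) D, qV_facts θ θ' h0 hθ' hθ D (primorial D),
    ee_ev, ev_log G (2 * k + 3) (3/4) (by norm_num)]
    with x hSP hEP hQ hT hhx hl hl2 he hYf hqf hee hG2 hX
  obtain ⟨a1, a2, a3⟩ := lx_facts θ' h0 K hK D x hl
  set P := PS D (Yx θ' x) with hP
  set L := Lx θ' K D x with hL
  set ℓ := lx θ' K x with hℓ
  have hEP0 : 0 ≤ EP P := zero_le_one.trans (EP_one_le P PS_prime)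
  have hbw : ∀ i j, |bw ℓ K P c i j| ≤ 2 * K * cm * L := by
    intro i j
    unfold bw
    calc _ ≤ ∑ t ∈ range K, |SP P ℓ t * c (Function.update j i t)| := abs_sum_le_sum_abs _ _
      _ ≤ ∑ t ∈ range K, 2 * L * cm := by
          refine sum_le_sum fun t ht => ?_
          rw [abs_mul]
          exact mul_le_mul (hSP t (mem_range.mp ht)) (hcm _) (abs_nonneg _) (by positivity)
      _ = _ := by rw [sum_const, card_range, nsmul_eq_mul]; ring
  have key := fun i => S2_prime h hk i D (Yx θ' x) x hD hYf.2.2.2.2 (hd _) b (hb i) (fun l => hhx l i) ℓ a1 K a3 c hc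
    (fun V hV => (hqf V hV).2) (2 * K * cm * L) (hbw i)
  simp only [← hP] at key
  refine le_trans ?_ (sum_le_sum fun i _ => key i)
  rw [sum_sub_distrib, sum_sub_distrib, ← mul_sum, sum_sub_distrib]
  simp only [sum_const, card_univ, Fintype.card_fin, nsmul_eq_mul]
  have q2 : ∀ i, ∑ j ∈ Fintype.piFinset (fun _ : Fin k => range K) with j i = 0,
        bw ℓ K P c i j ^ 2 * ∏ l ∈ univ.erase i, SP P ℓ (j l) = L ^ (k + 1) * qq2 K c i (fun j => SP P ℓ j / L) := by
    intro i
    rw [← qq2_scale hk K c i _ L a2]; rfl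
  simp_rw [q2]
  rw [← mul_sum]
  set T := TT (k - 1) P * BB k P with hTd
  set q := ∑ i, qq2 K c i (fun j => SP P ℓ j / L) with hq
  have m1 : L ^ (k + 1) * (Q2 - 2 * ε) ≤ L ^ (k + 1) * q - k * ((2 * K * cm * L) ^ 2 * T) := by
    have : L ^ (k + 1) * (Q2 - ε) ≤ L ^ (k + 1) * q := by gcongr
    linarith
  have hphi : (0:ℝ) < Nat.totient (primorial D) := by exact_mod_cast Nat.totient_pos.mpr (primorial_pos D)
  have m2 : (x / primorial D) * L ^ k * (ℓ * ((1 - 2 * ε) * (Q2 - 2 * ε))) ≤ X1 x / Nat.totient (primorial D) * (L ^ (k + 1) * q - k * ((2 * K * cm * L) ^ 2 * T)) := by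
    calc (x / primorial D) * L ^ k * (ℓ * ((1 - 2 * ε) * (Q2 - 2 * ε))) = ((1 - 2 * ε) * x) / Nat.totient (primorial D) * (L ^ (k + 1) * (Q2 - 2 * ε)) := by
          have : L = (Nat.totient (primorial D) : ℝ) / primorial D * ℓ := rfl
          rw [pow_succ]
          nth_rewrite 3 [this]
          field_simp
      _ ≤ _ := by
          have hz : 0 ≤ Q2 - 2 * ε := by linarith
          have hz2 : 0 ≤ 1 - 2 * ε := by linarith
          refine mul_le_mul (by gcongr) m1 (by positivity) ?_
          exact div_nonneg (le_trans (by positivity) hX) hphi.le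
  have m3 : k * ((2 * K * cm * L) ^ 2 * ∑ V ∈ VV P (Yx θ' x * Yx θ' x), (Esup x (qV (primorial D) V) + ee x / Nat.totient (qV (primorial D) V)) * Ck k ^ V.card)
      + k * (ee x * ((2 * K * cm * L) ^ 2 * EP P ^ (2 * k) * (3 * x) ^ (1/4:ℝ))) ≤ (x / primorial D) * L ^ k * (ε * Real.log x) := by
    have n1 : k * ((2 * K * cm * L) ^ 2 * ∑ V ∈ VV P (Yx θ' x * Yx θ' x), (Esup x (qV (primorial D) V) + ee x / Nat.totient (qV (primorial D) V)) * Ck k ^ V.card)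
        ≤ (k * (2 * K * cm) ^ 2 * lam θ' K D ^ 2) * x := by
      calc _ ≤ k * ((2 * K * cm * L) ^ 2 * (x / Real.log x ^ 2)) := by gcongr
        _ = _ := by rw [hL, Lx_eq]; field_simp
    have n2 : k * (ee x * ((2 * K * cm * L) ^ 2 * EP P ^ (2 * k) * (3 * x) ^ (1/4:ℝ))) ≤ x := by
      have hee0 : 0 ≤ ee x * (3 * (x:ℝ)) ^ (1/4:ℝ) := mul_nonneg (ee_nonneg2 x) (by positivity)
      calc _ = k * ((2 * K * cm * L) ^ 2 * EP P ^ (2 * k)) * (ee x * (3 * x) ^ (1/4:ℝ)) := by ring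
        _ ≤ k * ((2 * K * cm * L) ^ 2 * (CT * L) ^ (2 * k)) * (24 * Real.log x * (x:ℝ) ^ (3/4:ℝ)) := by gcongr
        _ = G * Real.log x ^ (2 * k + 3) * (x:ℝ) ^ (3/4:ℝ) := by
            rw [hL, Lx_eq, hG, ← mul_assoc CT, mul_pow (CT * lam θ' K D)]; ring
        _ ≤ x := hG2
    rw [div_le_iff₀ (by positivity)] at hl2
    calc _ ≤ (k * (2 * K * cm) ^ 2 * lam θ' K D ^ 2 + 1) * x := by linarith
      _ = (x / primorial D) * ((k * (2 * K * cm) ^ 2 * lam θ' K D ^ 2 + 1) * primorial D) := by field_simp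
      _ ≤ (x / primorial D) * (Real.log x * (ε * lam θ' K D ^ k)) := by gcongr
      _ ≤ (x / primorial D) * (Real.log x * (ε * lam θ' K D ^ k)) * Real.log x ^ k := by
          refine le_mul_of_one_le_right (by positivity) (one_le_pow₀ hl)
      _ = _ := by rw [hL, Lx_eq, mul_pow]; ring
  linarith

end ev

end
end MT

end

section
set_option linter.unusedSectionVars false
noncomputable section
namespace MT
open Finset Filter

lemma choose_params (m : ℕ) (θ : ℝ) (hθ : 0 < θ) (K : ℕ) (hK : 0 < K) (Q1 Q2 : ℝ) (hQ1 : 0 ≤ Q1)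
    (hQ : 2 * m / θ * K * Q1 < Q2) :
    ∃ θ' ε : ℝ, 0 < θ' ∧ θ' < θ ∧ 0 < ε ∧ 2 * ε ≤ 1 ∧ 2 * ε ≤ Q2 ∧
      m * ((1 + ε) * ((1 + ε) * (Q1 + 2 * ε) + ε)) < θ' / (2 * K) * ((1 - 2 * ε) * (Q2 - 2 * ε)) - ε := by
  have hK' : (0:ℝ) < K := by exact_mod_cast hK
  have hQ2 : 0 < Q2 := lt_of_le_of_lt (by positivity) hQ
  have h1 : 2 * m * K * Q1 / Q2 < θ := by
    rw [div_lt_iff₀ hQ2]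
    have : 2 * m / θ * K * Q1 = 2 * m * K * Q1 / θ := by ring
    rw [this, div_lt_iff₀ hθ] at hQ
    linarith
  obtain ⟨θ', ha, hb⟩ := exists_between h1
  have hθ' : 0 < θ' := lt_of_le_of_lt (by positivity) ha
  rw [div_lt_iff₀ hQ2] at ha
  let f : ℝ → ℝ := fun ε => θ' / (2 * K) * ((1 - 2 * ε) * (Q2 - 2 * ε)) - ε - m * ((1 + ε) * ((1 + ε) * (Q1 + 2 * ε) + ε))
  have hf : Continuous f := by fun_prop
  have hf0 : 0 < f 0 := by
    simp only [f]
    have : m * Q1 < θ' / (2 * K) * Q2 := by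
      rw [div_mul_eq_mul_div, lt_div_iff₀ (by positivity)]; linarith
    simp; linarith
  have e1 : ∀ᶠ ε in nhds (0:ℝ), 0 < f ε := (hf.tendsto 0).eventually (lt_mem_nhds hf0)
  have e2 : ∀ᶠ ε in nhdsWithin (0:ℝ) (Set.Ioi 0), 0 < f ε := e1.filter_mono nhdsWithin_le_nhds
  have e3 : ∀ᶠ ε in nhdsWithin (0:ℝ) (Set.Ioi 0), ε < min (1/2) (Q2/2) :=
    (gt_mem_nhds (by positivity)).filter_mono nhdsWithin_le_nhds
  obtain ⟨ε, a1, a2, a3⟩ := (e2.and (e3.and self_mem_nhdsWithin)).exists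
  have b1 := (lt_min_iff.mp a2).1
  have b2 := (lt_min_iff.mp a2).2
  refine ⟨θ', ε, hθ', hb, a3, by linarith, by linarith, ?_⟩
  simp only [f] at a1
  linarith

lemma exists_b {k : ℕ} (h : Fin k → ℤ) (hh : ∀ p : ℕ, p.Prime → ∃ a : ZMod p, ∀ i, (h i : ZMod p) ≠ a) (D : ℕ) :
    ∃ b : ℤ, ∀ i, (b + h i).gcd (primorial D) = 1 := by
  choose! a ha using hh
  obtain ⟨b, hb⟩ := Nat.chineseRemainderOfFinset (fun p => (-(a p)).val) (fun p => p)
    ((range (D + 1)).filter Nat.Prime) (fun p hp => (mem_filter.mp hp).2.ne_zero)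
    (fun p hp q hq hpq => (Nat.coprime_primes (mem_filter.mp hp).2 (mem_filter.mp hq).2).mpr hpq)
  refine ⟨b, fun i => ?_⟩
  rw [Int.gcd_comm, Int.gcd_def, Int.natAbs_natCast]
  refine coprime_primorial_iff.mpr fun p hp hpd => ?_
  by_contra hD
  have hbp := hb p (mem_filter.mpr ⟨mem_range.mpr (by omega), hp⟩)
  have : Fact p.Prime := ⟨hp⟩
  rw [← ZMod.natCast_eq_natCast_iff] at hbp
  rw [ZMod.natCast_val, ZMod.cast_id] at hbp
  have h2 : (p:ℤ) ∣ b + h i := Int.natCast_dvd.mpr hpd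
  have h3 := (ZMod.intCast_zmod_eq_zero_iff_dvd (b + h i) p).mpr h2
  push_cast at h3
  apply ha p hp i
  rw [hbp] at h3
  linear_combination h3

lemma Lp_nonneg (N : ℕ) : 0 ≤ Lp N := by
  unfold Lp; split_ifs
  · exact ArithmeticFunction.vonMangoldt_nonneg
  · exact le_rfl

lemma S2_swap {k : ℕ} (h : Fin k → ℤ) (Hb : ℕ) (hH : ∀ i, |h i| ≤ Hb) (x : ℕ) (w : ℤ → ℝ) (hw : ∀ n, 0 ≤ w n) :
    ∑ i, ∑ N ∈ Icc x (2 * x), Lp N * w (N - h i) ≤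
      ∑ n ∈ Ioc ((x:ℤ) - Hb - 1) (2 * x + Hb), (∑ i, Lp (n + h i).toNat) * w n := by
  simp_rw [sum_mul]
  rw [sum_comm (s := Ioc _ _)]
  refine sum_le_sum fun i _ => ?_
  have hinj : Set.InjOn (fun N : ℕ => (N:ℤ) - h i) (Icc x (2 * x) : Finset ℕ) := by
    intro a _ b _ hab
    simp only at hab
    omega
  calc _ = ∑ N ∈ Icc x (2 * x), (fun n : ℤ => Lp (n + h i).toNat * w n) ((N:ℤ) - h i) := by
        refine sum_congr rfl fun N _ => ?_
        simp
    _ = ∑ n ∈ (Icc x (2 * x)).image (fun N : ℕ => (N:ℤ) - h i), Lp (n + h i).toNat * w n :=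
        (sum_image (f := fun n : ℤ => Lp (n + h i).toNat * w n) hinj).symm
    _ ≤ _ := by
        refine sum_le_sum_of_subset_of_nonneg ?_ fun n _ _ => mul_nonneg (Lp_nonneg _) (hw _)
        intro n hn
        obtain ⟨N, hN, rfl⟩ := mem_image.mp hn
        rw [mem_Icc] at hN
        have := abs_le.mp (hH i)
        rw [mem_Ioc]
        constructor <;> omega

lemma Lp_sum_le {k : ℕ} (h : Fin k → ℤ) (Hb : ℕ) (hH : ∀ i, |h i| ≤ Hb) (x : ℕ) (hx : 2 * Hb ≤ x) (m : ℕ)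
    (n : ℤ) (hn : n ≤ 2 * x + Hb) (hm : {i : Fin k | Prime (n + h i)}.ncard ≤ m) :
    ∑ i, Lp (n + h i).toNat ≤ m * Real.log (3 * x) := by
  classical
  have key : ∀ i, Lp (n + h i).toNat ≤ if Prime (n + h i) then Real.log (3 * x) else 0 := by
    intro i
    unfold Lp
    by_cases hp : (n + h i).toNat.Prime
    · have h0 : (0:ℤ) ≤ n + h i := by
        by_contra hneg
        rw [Int.toNat_of_nonpos (by omega)] at hp
        exact Nat.not_prime_zero hp
      have h1 : Prime (n + h i) := by
        rw [← Int.toNat_of_nonneg h0]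
        exact Nat.prime_iff_prime_int.mp hp
      rw [if_pos hp, if_pos h1]
      refine (ArithmeticFunction.vonMangoldt_le_log).trans ?_
      refine Real.log_le_log (by exact_mod_cast hp.pos) ?_
      have := abs_le.mp (hH i)
      have h2 : (n + h i).toNat ≤ 3 * x := by omega
      exact_mod_cast h2
    · rw [if_neg hp]
      split_ifs with hq
      · rcases Nat.eq_zero_or_pos x with rfl | hx0
        · simp
        · refine Real.log_nonneg ?_
          have : (1:ℝ) ≤ x := by exact_mod_cast hx0
          linarith
      · exact le_rfl
  have hlog : 0 ≤ Real.log (3 * x) := by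
    rcases Nat.eq_zero_or_pos x with rfl | hx0
    · simp
    · refine Real.log_nonneg ?_
      have : (1:ℝ) ≤ x := by exact_mod_cast hx0
      linarith
  refine (sum_le_sum fun i _ => key i).trans ?_
  rw [← sum_filter, sum_const, nsmul_eq_mul]
  refine mul_le_mul_of_nonneg_right ?_ hlog
  have : {i : Fin k | Prime (n + h i)}.ncard = (univ.filter fun i : Fin k => Prime (n + h i)).card := by
    rw [← Set.ncard_coe_finset]; simp
  rw [this] at hm
  exact_mod_cast hm

lemma ind_nonneg' (W : ℕ) (b n : ℤ) : 0 ≤ ind W b n := by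
  unfold ind; split_ifs <;> norm_num

lemma log3_ev (ε : ℝ) (hε : 0 < ε) : ∀ᶠ x : ℕ in atTop, Real.log (3 * x) ≤ (1 + ε) * Real.log x := by
  filter_upwards [ev_log_ge (Real.log 3 / ε), ev_log_ge 1] with x hx hx1
  have hx0 : (x:ℝ) ≠ 0 := by
    intro h0; rw [h0, Real.log_zero] at hx1; linarith
  rw [Real.log_mul (by norm_num) hx0]
  rw [div_le_iff₀ hε] at hx
  linarith

/-- The pigeonhole step. -/
lemma final_step {k : ℕ} (h : Fin k → ℤ) (m : ℕ) (Hb : ℕ) (hH : ∀ i, |h i| ≤ Hb) (x : ℕ) (hx : 2 * Hb ≤ x)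
    (w : ℤ → ℝ) (hw : ∀ n, 0 ≤ w n)
    (hlt : m * Real.log (3 * x) * ∑ n ∈ Ioc ((x:ℤ) - Hb - 1) (2 * x + Hb), w n < ∑ i, ∑ N ∈ Icc x (2 * x), Lp N * w (N - h i)) :
    ∃ n : ℤ, (x:ℤ) - Hb ≤ n ∧ m + 1 ≤ {i : Fin k | Prime (n + h i)}.ncard := by
  by_contra! hcon
  refine absurd hlt (not_lt.mpr ((S2_swap h Hb hH x w hw).trans ?_))
  rw [mul_sum]
  refine sum_le_sum fun n hn => mul_le_mul_of_nonneg_right ?_ (hw n)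
  rw [mem_Ioc] at hn
  exact Lp_sum_le h Hb hH x hx m n hn.2 (Nat.lt_succ_iff.mp (hcon n (by omega)))

end MT
end

end

section
set_option linter.unusedSectionVars false
noncomputable section
namespace MT
open Finset Filter

lemma qq2sum_delta {k : ℕ} (K : ℕ) (c : (Fin k → ℕ) → ℝ) (ε : ℝ) (hε : 0 < ε) :
    ∃ δ > 0, ∀ s : ℕ → ℝ, (∀ j < K, |s j - 1| ≤ δ) →
      |∑ i, qq2 K c i s - ∑ i, qq2 K c i (fun _ => 1)| ≤ ε := by
  refine cont_delta K (fun s => ∑ i, qq2 K c i s) ?_ ?_ ε hε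
  · exact continuous_finsetSum _ fun i _ => qq2_cont K c i
  · intro s s' hs
    exact sum_congr rfl fun i _ => qq2_loc K c i s s' hs

theorem main (k m : ℕ) (hk : 1 ≤ k) (hm : 1 ≤ m)
    (θ : ℝ) (hθ0 : 0 < θ) (hθ1 : θ < 1) (hEH : EH θ)
    (hM : 2 * m / θ < Mquant k) : DHL k (m + 1) := by
  intro h hadm N
  have hm' : (0:ℝ) < m := by exact_mod_cast hm
  obtain ⟨K, c, hc, hlt⟩ := analytic k (2 * m / θ) hk (by positivity) hM
  set Q1 : ℝ := qq1 K c (fun _ => 1) with hQ1d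
  set Q2 : ℝ := ∑ i, qq2 K c i (fun _ => 1) with hQ2d
  have hQ1e : ∑ j ∈ Fintype.piFinset (fun _ : Fin k => range K), c j ^ 2 = Q1 := by
    simp [hQ1d, qq1]
  have hQ2e : ∑ i : Fin k, ∑ j ∈ Fintype.piFinset (fun _ : Fin k => range K) with j i = 0,
      (∑ t ∈ range K, c (Function.update j i t)) ^ 2 = Q2 := by
    simp [hQ2d, qq2]
  have hQ1n : 0 ≤ Q1 := by rw [← hQ1e]; positivity
  rw [hQ1e, hQ2e] at hlt
  have hK : 0 < K := by
    rcases Nat.eq_zero_or_pos K with h0 | h0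
    · exfalso
      have : Q2 = 0 := by
        rw [← hQ2e]; subst h0; simp
      rw [this, h0] at hlt; simp at hlt
    · exact h0
  have hK' : (0:ℝ) < K := by exact_mod_cast hK
  obtain ⟨θ', ε, hθ'0, hθ'θ, hε, hε1, hε2, hfin⟩ := choose_params m θ hθ0 K hK Q1 Q2 hQ1n hlt
  -- bound for c
  obtain ⟨cm, hcm0, hcm⟩ : ∃ cm : ℝ, 0 ≤ cm ∧ ∀ j, |c j| ≤ cm := by
    refine ⟨∑ j ∈ Fintype.piFinset (fun _ : Fin k => range K), |c j|, by positivity, fun j => ?_⟩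
    by_cases hj : c j = 0
    · rw [hj, abs_zero]; positivity
    · refine single_le_sum (f := fun j => |c j|) (fun _ _ => abs_nonneg _) ?_
      rw [Fintype.mem_piFinset]
      intro i
      rw [mem_range]
      have h1 := hc j hj
      have h2 : j i ≤ ∑ i, j i := single_le_sum (f := j) (fun _ _ => Nat.zero_le _) (mem_univ i)
      omega
  obtain ⟨CE, hCE1, hCE⟩ := EP_le
  set CT : ℝ := CE * (2 * K / θ') with hCT
  have hCT0 : 0 ≤ CT := by positivity
  obtain ⟨δ1, hδ1, hd1⟩ := cont_delta K (qq1 K c) (qq1_cont K c) (qq1_loc K c) ε hε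
  obtain ⟨δ2, hδ2, hd2⟩ := qq2sum_delta K c ε hε
  set δ : ℝ := min 1 (min δ1 δ2) with hδd
  have hδ : 0 < δ := by positivity
  set G : ℝ := cm ^ 2 * CT ^ k + k * (2 * K * cm) ^ 2 * CT ^ (k - 1) + 1 with hG
  have hG0 : 0 < G := by positivity
  obtain ⟨D1, hD1, hSC⟩ := SC_asymp δ hδ K
  obtain ⟨D2, hD2, hBB⟩ := BB_small k (ε / G) (by positivity)
  set Hb : ℕ := ∑ i, (h i).natAbs with hHb
  have hH : ∀ i, |h i| ≤ Hb := by
    intro i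
    rw [Int.abs_eq_natAbs]
    exact_mod_cast single_le_sum (f := fun i => (h i).natAbs) (fun _ _ => Nat.zero_le _) (mem_univ i)
  obtain ⟨D, hDa, hDb, hDc, hDd⟩ : ∃ D : ℕ, D1 ≤ D ∧ D2 ≤ D ∧ 2 ^ (8 * k) ≤ D ∧ 2 * Hb ≤ D := by
    obtain ⟨E, hE⟩ : ∃ E : ℕ, E = 2 ^ (8 * k) := ⟨_, rfl⟩
    rw [← hE]
    exact ⟨D1 + D2 + E + 2 * Hb, by omega, by omega, by omega, by omega⟩
  obtain ⟨ℓ₀, hℓ₀, hSC⟩ := hSC D hDa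
  have hBB := hBB D hDb
  obtain ⟨b, hb⟩ := exists_b h hadm.2 D
  have hd : ∀ Y, ∀ p ∈ PS D Y, DistP h p := by
    intro Y p hp i j hij hdvd
    have hp1 := (mem_PS.mp hp).1.1
    have hne : h i - h j ≠ 0 := sub_ne_zero.mpr fun he => hij (hadm.1.injective he)
    have h1 := Int.le_of_dvd (abs_pos.mpr hne) ((dvd_abs _ _).mpr hdvd)
    have h2 : |h i - h j| ≤ |h i| + |h j| := abs_sub _ _
    have h3 := hH i
    have h4 := hH j
    have h5 : (D:ℤ) < p := by exact_mod_cast hp1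
    have h6 : (2 * Hb : ℤ) ≤ D := by
      exact_mod_cast hDd
    linarith
  have hfac : ∀ᶠ x : ℕ in atTop, 0 < lx θ' K x ∧ 0 < Lx θ' K D x ∧ Real.exp (K * lx θ' K x) ≤ Yx θ' x := by
    filter_upwards [ev_log_ge 1] with x hx
    exact lx_facts θ' hθ'0 K hK D x hx
  have hlxge : ∀ᶠ x : ℕ in atTop, ℓ₀ ≤ lx θ' K x := by
    filter_upwards [ev_log_ge (ℓ₀ * (2 * K) / θ')] with x hx
    rw [div_le_iff₀ hθ'0] at hx
    rw [lx, le_div_iff₀ (by positivity)]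
    linarith
  have hs : ∀ᶠ x : ℕ in atTop, ∀ j < K, |SP (PS D (Yx θ' x)) (lx θ' K x) j / Lx θ' K D x - 1| ≤ δ := by
    filter_upwards [hfac, hlxge] with x hx hx2 j hj
    have h1 : |SP (PS D (Yx θ' x)) (lx θ' K x) j - Lx θ' K D x| ≤ δ * Lx θ' K D x :=
      hSC _ hx2 _ hx.2.2 j hj
    rw [div_sub_one hx.2.1.ne', abs_div, abs_of_pos hx.2.1, div_le_iff₀ hx.2.1]
    exact h1
  have hSP : ∀ᶠ x : ℕ in atTop, ∀ j < K, |SP (PS D (Yx θ' x)) (lx θ' K x) j| ≤ 2 * Lx θ' K D x := by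
    filter_upwards [hfac, hlxge] with x hx hx2 j hj
    have h1 : |SP (PS D (Yx θ' x)) (lx θ' K x) j - Lx θ' K D x| ≤ δ * Lx θ' K D x :=
      hSC _ hx2 _ hx.2.2 j hj
    have h2 : δ * Lx θ' K D x ≤ 1 * Lx θ' K D x := mul_le_mul_of_nonneg_right (min_le_left _ _) hx.2.1.le
    have h3 := abs_le.mp h1
    rw [abs_le]; constructor <;> linarith [hx.2.1]
  have hq1 : ∀ᶠ x : ℕ in atTop, qq1 K c (fun j => SP (PS D (Yx θ' x)) (lx θ' K x) j / Lx θ' K D x) ≤ Q1 + ε := by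
    filter_upwards [hs] with x hx
    have := (abs_le.mp (hd1 _ fun j hj => (hx j hj).trans ((min_le_right _ _).trans (min_le_left _ _)))).2
    linarith
  have hq2 : ∀ᶠ x : ℕ in atTop, Q2 - ε ≤ ∑ i, qq2 K c i (fun j => SP (PS D (Yx θ' x)) (lx θ' K x) j / Lx θ' K D x) := by
    filter_upwards [hs] with x hx
    have := (abs_le.mp (hd2 _ fun j hj => (hx j hj).trans ((min_le_right _ _).trans (min_le_right _ _)))).1
    linarith
  have hEP : ∀ᶠ x : ℕ in atTop, EP (PS D (Yx θ' x)) ≤ CT * Lx θ' K D x := by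
    filter_upwards [Yx_facts θ' hθ'0 (hθ'θ.trans hθ1) D] with x hx
    refine (hCE D _ hx.2.1 hx.1).trans ?_
    have h1 : CT * Lx θ' K D x = CE * (dens (primorial D) * Real.log x) := by
      rw [hCT, Lx, lx]; field_simp
    rw [h1]
    have h2 := (dens_pos (primorial_pos D)).le
    have h3 := hx.2.2.2.1
    have h4 : 0 ≤ CE := by linarith
    gcongr
  have hcomb : ∀ᶠ x : ℕ in atTop, ∀ (r : ℕ) (A : ℝ), 0 ≤ A → A * CT ^ r ≤ G →
      A * (TT r (PS D (Yx θ' x)) * BB k (PS D (Yx θ' x))) ≤ ε * Lx θ' K D x ^ r := by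
    filter_upwards [hEP, hfac] with x hx hf r A hA hAG
    have h0 : 0 ≤ EP (PS D (Yx θ' x)) := zero_le_one.trans (EP_one_le _ PS_prime)
    have hL := hf.2.1
    rw [TT_eq]
    calc A * (EP (PS D (Yx θ' x)) ^ r * BB k (PS D (Yx θ' x)))
        ≤ A * ((CT * Lx θ' K D x) ^ r * (ε / G)) := by
          have := hBB (Yx θ' x)
          have h2 := BB_nonneg k (PS D (Yx θ' x))
          gcongr
      _ = (A * CT ^ r) * (ε / G * Lx θ' K D x ^ r) := by rw [mul_pow]; ring
      _ ≤ G * (ε / G * Lx θ' K D x ^ r) := by gcongr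
      _ = _ := by field_simp
  have hg1 : 0 ≤ cm ^ 2 * CT ^ k := by positivity
  have hg2 : 0 ≤ k * (2 * K * cm) ^ 2 * CT ^ (k - 1) := by positivity
  have hT1 : ∀ᶠ x : ℕ in atTop, cm ^ 2 * (TT k (PS D (Yx θ' x)) * BB k (PS D (Yx θ' x))) ≤ ε * Lx θ' K D x ^ k := by
    filter_upwards [hcomb] with x hx
    exact hx k _ (by positivity) (by linarith)
  have hT2 : ∀ᶠ x : ℕ in atTop, k * ((2 * K * cm * Lx θ' K D x) ^ 2 * (TT (k - 1) (PS D (Yx θ' x)) * BB k (PS D (Yx θ' x)))) ≤ ε * Lx θ' K D x ^ (k + 1) := by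
    filter_upwards [hcomb, hfac] with x hx hf
    have h1 := hx (k - 1) (k * (2 * K * cm) ^ 2) (by positivity) (by linarith)
    have h2 := mul_le_mul_of_nonneg_left h1 (sq_nonneg (Lx θ' K D x))
    calc _ = Lx θ' K D x ^ 2 * (k * (2 * K * cm) ^ 2 * (TT (k - 1) (PS D (Yx θ' x)) * BB k (PS D (Yx θ' x)))) := by ring
      _ ≤ _ := h2
      _ = _ := by
          obtain ⟨r, rfl⟩ : ∃ r, k = r + 1 := ⟨k - 1, by omega⟩
          simp only [Nat.add_sub_cancel]; ring
  have E1 := S1_ev h hk θ' hθ'0 (hθ'θ.trans hθ1) K hK c hc cm hcm D hd b ε hε Hb Q1 hQ1n hq1 hT1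
  have E2 := S2_ev h hk θ' hθ'0 K hK c hc cm hcm D hd b ε hε θ hθ'θ hθ1 hEH hDc hb Q2 CT hCT0 hε1 hε2 hSP hEP hq2 hT2
  obtain ⟨X, hX⟩ := eventually_atTop.mp (E1.and (E2.and (hfac.and ((ee_small ε hε).and ((log3_ev ε hε).and (ev_log_ge 1))))))
  obtain ⟨x, hxX, hmass⟩ := prime_mass ε hε (X + 2 * Hb + Hb + N.toNat + 1)
  obtain ⟨e1, e2, hf, hee, hl3, hl1⟩ := hX x (by omega)
  have hX1 : (1 - 2 * ε) * x ≤ X1 x := by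
    have := X1_add_ee x
    linarith
  have e2 := e2 hX1
  set w : ℤ → ℝ := fun n => ind (primorial D) b n * wt h (PS D (Yx θ' x)) (lx θ' K x) c n ^ 2 with hwd
  have hw : ∀ n, 0 ≤ w n := fun n => mul_nonneg (ind_nonneg' _ _ _) (sq_nonneg _)
  have hx0 : (0:ℝ) < x := by
    have : 0 < x := by omega
    exact_mod_cast this
  have hW : (0:ℝ) < primorial D := by exact_mod_cast primorial_pos D
  have hL := hf.2.1
  obtain ⟨n, hn1, hn2⟩ := final_step h m Hb hH x (by omega) w hw (by
    calc m * Real.log (3 * x) * ∑ n ∈ Ioc ((x:ℤ) - Hb - 1) (2 * x + Hb), w n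
        ≤ m * ((1 + ε) * Real.log x) * (x / primorial D * Lx θ' K D x ^ k * ((1 + ε) * (Q1 + 2 * ε) + ε)) := by
          have : 0 ≤ ∑ n ∈ Ioc ((x:ℤ) - Hb - 1) (2 * x + Hb), w n := sum_nonneg fun n _ => hw n
          gcongr
      _ = (x / primorial D * Lx θ' K D x ^ k * Real.log x) * (m * ((1 + ε) * ((1 + ε) * (Q1 + 2 * ε) + ε))) := by ring
      _ < (x / primorial D * Lx θ' K D x ^ k * Real.log x) * (θ' / (2 * K) * ((1 - 2 * ε) * (Q2 - 2 * ε)) - ε) := by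
          refine mul_lt_mul_of_pos_left hfin (by positivity)
      _ = x / primorial D * Lx θ' K D x ^ k * (lx θ' K x * ((1 - 2 * ε) * (Q2 - 2 * ε)) - ε * Real.log x) := by
          rw [lx]; ring
      _ ≤ _ := e2
      _ = _ := by
          refine sum_congr rfl fun i _ => sum_congr rfl fun N _ => ?_
          simp only [hwd]; ring)
  exact ⟨n, by omega, hn2⟩

end MT
end

end

/-- **Polymath8b, Theorem 3.6 (sieving on the standard simplex)**: if `0 < θ < 1` is
such that `EH[θ]` holds and `M_k > 2m/θ`, then `DHL[k,m+1]` holds. -/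
theorem dhl_of_EH_and_Mk (k m : ℕ) (hk : 2 ≤ k) (hm : 1 ≤ m)
    (θ : ℝ) (hθ0 : 0 < θ) (hθ1 : θ < 1) (hEH : EH θ)
    (hM : 2 * m / θ < Mquant k) :
    DHL k (m + 1) := by
  exact MT.main k m (by omega) hm θ hθ0 hθ1 hEH hM
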